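/- Two minimal Cantor dynamical systems (X,T) and (Y,S) are orbit equivalent if and only if there exists a homeomorphism F : X → Y such that the pushforward map μ ↦ μ ∘ F^{-1} carries the set of T-invariant Borel probability measures on X bijectively onto the set of S-invariant Borel probability measures on Y. -/

import Mathlib

open MeasureTheory

/-- The `T`-orbit of a point under a homeomorphism `T`. -/
def Homeomorph.orbit {X : Type} [TopologicalSpace X] (T : X ≃ₜ X) (x : X) : Set X :=
  Set.range fun n : ℤ => (T.toEquiv ^ n) x

/-- Two Cantor systems are orbit equivalent if a homeomorphism maps orbits onto orbits. -/
def OrbitEquivalent {X Y : Type} [TopologicalSpace X] [TopologicalSpace Y]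
    (T : X ≃ₜ X) (S : Y ≃ₜ Y) : Prop :=
  ∃ h : X ≃ₜ Y, ∀ x : X, (h : X → Y) '' T.orbit x = S.orbit (h x)

set_option linter.unusedSectionVars false
set_option linter.unusedVariables false

namespace CantorOE

open Set Filter Topology

section Basic

variable {X : Type} [TopologicalSpace X]

theorem continuous_of_closed_rel [CompactSpace X] {Y : Type} [TopologicalSpace Y] (f : Y → X)
    (R : Y → X → Prop) (hc : IsClosed {p : Y × X | R p.1 p.2}) (h : ∀ x y, R x y ↔ f x = y) :
    Continuous f := by
  refine continuous_iff_isClosed.2 fun V hV => ?_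
  have : f ⁻¹' V = Prod.fst '' ({p : Y × X | R p.1 p.2} ∩ Prod.snd ⁻¹' V) := by
    ext x
    constructor
    · intro hx
      exact ⟨(x, f x), ⟨(h _ _).2 rfl, hx⟩, rfl⟩
    · rintro ⟨⟨a, b⟩, ⟨h1, h2⟩, rfl⟩
      have := (h _ _).1 h1
      simp only at this
      subst this
      exact h2
  rw [this]
  exact isClosedMap_fst_of_compactSpace _ (hc.inter (hV.preimage continuous_snd))

theorem exists_homeo_of_closed_rel [CompactSpace X] (R : X → X → Prop)
    (hc : IsClosed {p : X × X | R p.1 p.2})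
    (h1 : ∀ x, ∃! y, R x y) (h2 : ∀ y, ∃! x, R x y) :
    ∃ h : X ≃ₜ X, ∀ x y, R x y ↔ h x = y := by
  choose f hf hf' using h1
  choose g hg hg' using h2
  have hR : ∀ x y, R x y ↔ f x = y := fun x y =>
    ⟨fun h => (hf' x y h).symm, fun h => h ▸ hf x⟩
  have hR' : ∀ y x, R x y ↔ g y = x := fun y x =>
    ⟨fun h => (hg' y x h).symm, fun h => h ▸ hg y⟩
  refine ⟨⟨⟨f, g, fun x => (hR' _ _).1 (hf x), fun y => (hR _ _).1 (hg y)⟩,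
    continuous_of_closed_rel f R hc hR,
    continuous_of_closed_rel g (fun y x => R x y) (hc.preimage continuous_swap) hR'⟩, hR⟩

theorem isClopen_setOf_lc {α : Type*} {L : X → α} (hL : IsLocallyConstant L)
    (p : α → Prop) : IsClopen {y | p (L y)} :=
  ⟨⟨hL {a | ¬ p a}⟩, hL {a | p a}⟩

theorem lc_mem {A : Set X} (hA : IsClopen A) : IsLocallyConstant (fun x => x ∈ A) := by
  refine (IsLocallyConstant.iff_eventually_eq _).2 fun x => ?_
  by_cases hx : x ∈ A
  · filter_upwards [hA.isOpen.mem_nhds hx] with y hy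
    simp [hx, hy]
  · filter_upwards [hA.compl.isOpen.mem_nhds hx] with y hy
    exact propext (iff_of_false hy hx)

theorem lc_comp {Y α : Type*} [TopologicalSpace Y] {L : X → α} (hL : IsLocallyConstant L)
    {g : Y → X} (hg : Continuous g) : IsLocallyConstant (fun y => L (g y)) :=
  hL.comp_continuous hg

theorem lc_map {α β : Type*} {L : X → α} {M : X → β} (hL : IsLocallyConstant L)
    (h : ∀ x y, L x = L y → M x = M y) : IsLocallyConstant M :=
  (IsLocallyConstant.iff_eventually_eq _).2 fun x =>
    ((IsLocallyConstant.iff_eventually_eq _).1 hL x).mono fun y hy => h y x hy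

/-- The integer-valued indicator function. -/
noncomputable def ind (A : Set X) : X → ℤ := A.indicator 1

open Classical in
theorem ind_apply (A : Set X) (x : X) : ind A x = if x ∈ A then 1 else 0 := by
  simp [ind, indicator_apply]

theorem lc_ind {A : Set X} (hA : IsClopen A) : IsLocallyConstant (ind A) := by
  classical
  refine lc_map (lc_mem hA) fun x y h => ?_
  simp only [ind_apply, h]

end Basic

section Ret

variable {X : Type} [TopologicalSpace X]

/-- `FR r`: the map `r` is a retraction whose kernel is a finite equivalence relation with
clopen saturations of clopen sets. -/
structure FR (r : X → X) : Prop where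
  cont : Continuous r
  idem : ∀ x, r (r x) = r x
  lab : ∃ P : X → ℕ, IsLocallyConstant P ∧ ∀ x y, r x = r y → P x = P y → x = y
  sat : ∀ A, IsClopen A → IsOpen {x | ∃ y ∈ A, r y = r x}

/-- Set of labels `L y` of the points `y ∈ A` in the `r`-class of `x`. -/
def sig {α : Type*} (r : X → X) (L : X → α) (A : Set X) (x : X) : Set α :=
  {a | ∃ y ∈ A, r y = r x ∧ L y = a}

/-- The trace of `f` along the classes of `r`. -/
noncomputable def tr (r : X → X) (f : X → ℤ) (x : X) : ℤ := ∑ᶠ y ∈ {y | r y = r x}, f y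

theorem sig_congr {α : Type*} {r : X → X} (L : X → α) (A : Set X) {x y : X} (h : r x = r y) :
    sig r L A x = sig r L A y := by
  simp [sig, h]

theorem tr_congr_ret {r : X → X} (f : X → ℤ) {x y : X} (h : r x = r y) :
    tr r f x = tr r f y := by
  simp [tr, h]

variable [CompactSpace X] {r : X → X}

theorem FR.sat_clopen [T2Space X] (hr : FR r) {A : Set X} (hA : IsClopen A) :
    IsClopen {x | ∃ y ∈ A, r y = r x} := by
  refine ⟨?_, hr.sat A hA⟩
  have : {x | ∃ y ∈ A, r y = r x} = r ⁻¹' (r '' A) := by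
    ext x; simp
  rw [this]
  exact ((hA.isClosed.isCompact.image hr.cont).isClosed).preimage hr.cont

theorem FR.fin (hr : FR r) (x : X) : {y | r y = r x}.Finite := by
  obtain ⟨P, hP, hinj⟩ := hr.lab
  refine Set.Finite.of_finite_image (f := P) (hP.range_finite.subset (image_subset_range _ _)) ?_
  intro a ha b hb h
  exact hinj a b (by simp_all) h

theorem FR.lc_sig [T2Space X] (hr : FR r) {α : Type*} {L : X → α} (hL : IsLocallyConstant L)
    {A : Set X} (hA : IsClopen A) : IsLocallyConstant (sig r L A) := by
  refine (IsLocallyConstant.iff_eventually_eq _).2 fun x => ?_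
  have h1 : ∀ a : α, ∀ᶠ y in 𝓝 x, (a ∈ sig r L A y ↔ a ∈ sig r L A x) := by
    intro a
    have hc : IsClopen {x | ∃ y ∈ A ∩ {y | L y = a}, r y = r x} :=
      hr.sat_clopen (hA.inter (hL.isClopen_fiber a))
    filter_upwards [(IsLocallyConstant.iff_eventually_eq _).1 (lc_mem hc) x] with y hy
    have := iff_of_eq hy
    simpa [sig, and_assoc, and_comm, and_left_comm] using this
  have h2 : ∀ᶠ y in 𝓝 x, ∀ a ∈ range L, (a ∈ sig r L A y ↔ a ∈ sig r L A x) :=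
    (eventually_all_finite hL.range_finite).2 fun a _ => h1 a
  filter_upwards [h2] with y hy
  ext a
  by_cases ha : a ∈ range L
  · exact hy a ha
  · refine iff_of_false ?_ ?_ <;>
    · rintro ⟨z, _, _, rfl⟩
      exact ha ⟨z, rfl⟩

theorem tr_ind (hr : FR r) (A : Set X) (x : X) :
    tr r (ind A) x = ({y | y ∈ A ∧ r y = r x}.ncard : ℤ) := by
  classical
  have hf := hr.fin x
  rw [tr, finsum_mem_eq_finite_toFinset_sum _ hf]
  have : {y | y ∈ A ∧ r y = r x} = ((hf.toFinset.filter (· ∈ A) : Finset X) : Set X) := by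
    ext y; simp [and_comm]
  rw [this, ncard_coe_finset]
  simp [ind_apply]

theorem sig_ncard {P : X → ℕ} (hinj : ∀ x y, r x = r y → P x = P y → x = y) (A : Set X)
    (x : X) : (sig r P A x).ncard = {y | y ∈ A ∧ r y = r x}.ncard := by
  have : sig r P A x = P '' {y | y ∈ A ∧ r y = r x} := by
    ext a; simp [sig, and_assoc]
  rw [this, InjOn.ncard_image]
  intro a ha b hb h
  exact hinj a b (by simp_all) h

theorem sig_finite (hr : FR r) {α : Type*} (L : X → α) (A : Set X)
    (x : X) : (sig r L A x).Finite := by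
  have : sig r L A x = L '' {y | y ∈ A ∧ r y = r x} := by
    ext a; simp [sig, and_assoc]
  rw [this]
  exact ((hr.fin x).subset fun y hy => hy.2).image _

theorem FR.lc_tr [T2Space X] (hr : FR r) {f : X → ℤ} (hf : IsLocallyConstant f) :
    IsLocallyConstant (tr r f) := by
  obtain ⟨P, hP, hinj⟩ := hr.lab
  refine lc_map (hr.lc_sig (hP.prodMk hf) isClopen_univ) fun x y h => ?_
  have key : ∀ x, tr r f x = ∑ᶠ q ∈ sig r (fun x => (P x, f x)) univ x, q.2 := by
    intro x
    have : sig r (fun x => (P x, f x)) univ x = (fun x => (P x, f x)) '' {y | r y = r x} := by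
      ext a; simp [sig]
    rw [this, finsum_mem_image]
    · rfl
    · intro a ha b hb h
      exact hinj a b (by simp_all) (congrArg Prod.fst h)
  rw [key, key, h]

theorem tr_add (hr : FR r) (f g : X → ℤ) (x : X) : tr r (f + g) x = tr r f x + tr r g x :=
  finsum_mem_add_distrib (hr.fin x)

theorem tr_sub (hr : FR r) (f g : X → ℤ) (x : X) : tr r (f - g) x = tr r f x - tr r g x :=
  finsum_mem_sub_distrib _ _ (hr.fin x)

theorem tr_zsmul (hr : FR r) (n : ℤ) (f : X → ℤ) (x : X) : tr r (n • f) x = n * tr r f x := by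
  have hf := hr.fin x
  simp only [tr, finsum_mem_eq_finite_toFinset_sum _ hf, Finset.mul_sum, Pi.smul_apply, smul_eq_mul]

theorem tr_sum (hr : FR r) {ι : Type*} (s : Finset ι) (f : ι → X → ℤ) (x : X) :
    tr r (∑ i ∈ s, f i) x = ∑ i ∈ s, tr r (f i) x := by
  have hf := hr.fin x
  simp only [tr, finsum_mem_eq_finite_toFinset_sum _ hf, Finset.sum_apply]
  rw [Finset.sum_comm]

theorem tr_comp (f : X → ℤ) (e : X ≃ X) (he : ∀ x, r (e x) = r x) (x : X) :
    tr r (fun y => f (e y)) x = tr r f x := by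
  refine finsum_mem_eq_of_bijOn e ⟨?_, e.injective.injOn, ?_⟩ fun _ _ => rfl
  · intro y hy
    simp_all
  · intro y hy
    refine ⟨e.symm y, ?_, by simp⟩
    have := he (e.symm y)
    simp_all

/-- The kernel of `r` is contained in the kernel of `s`. -/
def Dom (r s : X → X) : Prop := ∀ x y, r x = r y → s x = s y

omit [TopologicalSpace X] [CompactSpace X] in
theorem Dom.trans {r s t : X → X} (h : Dom r s) (h' : Dom s t) : Dom r t :=
  fun x y hxy => h' _ _ (h _ _ hxy)

open Classical in
theorem tr_dom {s : X → X} (hr : FR r) (hs : FR s) (h : Dom r s) (f : X → ℤ) (x : X) :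
    tr s f x = ∑ e ∈ (hs.fin x).toFinset.filter (fun e => r e = e), tr r f e := by
  have h1 : ∀ e ∈ (hs.fin x).toFinset.filter (fun e => r e = e),
      tr r f e = ∑ y ∈ (hs.fin x).toFinset with r y = e, f y := by
    intro e he
    simp only [Finset.mem_filter, Finite.mem_toFinset, mem_ofPred_eq] at he
    rw [tr, finsum_mem_eq_finite_toFinset_sum _ (hr.fin e)]
    refine Finset.sum_congr ?_ fun _ _ => rfl
    ext y
    simp only [Finite.mem_toFinset, mem_ofPred_eq, Finset.mem_filter, he.2]
    refine ⟨fun hy => ⟨?_, hy⟩, fun hy => hy.2⟩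
    rw [← he.1]
    exact h _ _ (by rw [hy, he.2])
  rw [Finset.sum_congr rfl h1, tr, finsum_mem_eq_finite_toFinset_sum _ (hs.fin x),
    Finset.sum_fiberwise_of_maps_to (g := r)]
  intro y hy
  simp only [Finset.mem_filter, Finite.mem_toFinset, mem_ofPred_eq] at hy ⊢
  exact ⟨by rw [← hy]; exact h _ _ (hr.idem y), hr.idem y⟩

theorem tr_dom_zero {s : X → X} (hr : FR r) (hs : FR s) (h : Dom r s) {f : X → ℤ}
    (hf : ∀ x, tr r f x = 0) (x : X) : tr s f x = 0 := by
  classical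
  rw [tr_dom hr hs h]
  exact Finset.sum_eq_zero fun e _ => hf e

theorem tr_dom_pos {s : X → X} (hr : FR r) (hs : FR s) (h : Dom r s) {f : X → ℤ}
    (hf : ∀ x, 0 < tr r f x) (x : X) : 0 < tr s f x := by
  classical
  rw [tr_dom hr hs h]
  refine Finset.sum_pos (fun e _ => hf e) ⟨r x, ?_⟩
  simp only [Finset.mem_filter, Finite.mem_toFinset, mem_ofPred_eq]
  exact ⟨h _ _ (hr.idem x), hr.idem x⟩

theorem exists_match : ∃ m : Set ℕ → Set ℕ → ℕ → ℕ, ∀ S T : Set ℕ, S.Finite → T.Finite →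
    S.ncard = T.ncard → BijOn (m S T) S T := by
  have : ∀ S T : Set ℕ, ∃ f : ℕ → ℕ, S.Finite → T.Finite → S.ncard = T.ncard → BijOn f S T := by
    intro S T
    by_cases h : S.Finite ∧ T.Finite ∧ S.ncard = T.ncard
    · obtain ⟨f, hf⟩ := h.1.exists_bijOn_of_encard_eq
        (t := T) (by rw [← h.1.cast_ncard_eq, ← h.2.1.cast_ncard_eq, h.2.2])
      exact ⟨f, fun _ _ _ => hf⟩
    · exact ⟨id, fun a b c => absurd ⟨a, b, c⟩ h⟩
  choose m hm using this
  exact ⟨m, hm⟩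

variable [T2Space X]

theorem isClosed_rel {α : Type*} {L : X → α} (hL : IsLocallyConstant L) (p : α → α → Prop) :
    IsClosed {q : X × X | p (L q.1) (L q.2)} :=
  (isClopen_setOf_lc ((lc_comp hL continuous_fst).prodMk (lc_comp hL continuous_snd))
    (fun a => p a.1 a.2)).isClosed

/-- Disjoint clopen sets with equal traces are exchanged by a homeomorphism preserving classes. -/
theorem FR.exists_swap_disjoint (hr : FR r) {A B : Set X} (hA : IsClopen A) (hB : IsClopen B)
    (hd : Disjoint A B) (h : ∀ x, tr r (ind A) x = tr r (ind B) x) :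
    ∃ δ : X ≃ₜ X, (∀ x, r (δ x) = r x) ∧ (∀ x ∈ A, δ x ∈ B) ∧ (∀ x ∈ B, δ x ∈ A) ∧
      ∀ x, x ∉ A → x ∉ B → δ x = x := by
  obtain ⟨P, hP, hinj⟩ := hr.lab
  obtain ⟨m, hm⟩ := exists_match
  have hbij : ∀ x, BijOn (m (sig r P A x) (sig r P B x)) (sig r P A x) (sig r P B x) := by
    intro x
    refine hm _ _ (sig_finite hr _ _ _) (sig_finite hr _ _ _) ?_
    rw [sig_ncard hinj, sig_ncard hinj]
    have := h x
    rw [tr_ind hr, tr_ind hr] at this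
    exact_mod_cast this
  set μ : X → ℕ → ℕ := fun x => m (sig r P A x) (sig r P B x) with hμ
  have hμc : ∀ x y, r x = r y → μ x = μ y := by
    intro x y hxy
    simp only [hμ, sig_congr _ _ hxy]
  set R : X → X → Prop := fun x y => r x = r y ∧
    ((x ∈ A ∧ y ∈ B ∧ μ x (P x) = P y) ∨ (x ∈ B ∧ y ∈ A ∧ μ x (P y) = P x) ∨
      (x ∉ A ∧ x ∉ B ∧ x = y)) with hR
  have hsymm : ∀ x y, R x y → R y x := by
    rintro x y ⟨h0, h | h | h⟩
    · exact ⟨h0.symm, Or.inr (Or.inl ⟨h.2.1, h.1, by rw [hμc _ _ h0.symm]; exact h.2.2⟩)⟩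
    · exact ⟨h0.symm, Or.inl ⟨h.2.1, h.1, by rw [hμc _ _ h0.symm]; exact h.2.2⟩⟩
    · obtain ⟨h1, h2, rfl⟩ := h
      exact ⟨rfl, Or.inr (Or.inr ⟨h1, h2, rfl⟩)⟩
  have hAB : ∀ x, x ∈ A → x ∉ B := fun x h1 h2 => hd.le_bot ⟨h1, h2⟩
  have hex : ∀ x, ∃! y, R x y := by
    intro x
    by_cases hxA : x ∈ A
    · have hxs : P x ∈ sig r P A x := ⟨x, hxA, rfl, rfl⟩
      obtain ⟨y, hyB, hry, hPy⟩ := (hbij x).mapsTo hxs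
      refine ⟨y, ⟨hry.symm, Or.inl ⟨hxA, hyB, hPy.symm⟩⟩, ?_⟩
      rintro z ⟨h0, h1 | h1 | h1⟩
      · exact hinj _ _ (h0.symm.trans hry.symm) (by rw [← h1.2.2, hPy])
      · exact absurd h1.1 (hAB _ hxA)
      · exact absurd hxA h1.1
    by_cases hxB : x ∈ B
    · have hxs : P x ∈ sig r P B x := ⟨x, hxB, rfl, rfl⟩
      obtain ⟨a, ⟨y, hyA, hry, rfl⟩, hPy⟩ := (hbij x).surjOn hxs
      refine ⟨y, ⟨hry.symm, Or.inr (Or.inl ⟨hxB, hyA, hPy⟩)⟩, ?_⟩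
      rintro z ⟨h0, h1 | h1 | h1⟩
      · exact absurd h1.1 hxA
      · refine hinj _ _ (h0.symm.trans hry.symm) ((hbij x).injOn ⟨z, h1.2.1, h0.symm, rfl⟩
          ⟨y, hyA, hry, rfl⟩ ?_)
        rw [hPy]; exact h1.2.2
      · exact absurd hxB h1.2.1
    · refine ⟨x, ⟨rfl, Or.inr (Or.inr ⟨hxA, hxB, rfl⟩)⟩, ?_⟩
      rintro z ⟨h0, h1 | h1 | h1⟩
      · exact absurd h1.1 hxA
      · exact absurd h1.1 hxB
      · exact h1.2.2.symm
  have hcl : IsClosed {p : X × X | R p.1 p.2} := by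
    have hL : IsLocallyConstant (fun x => (μ x, P x, x ∈ A, x ∈ B)) := by
      refine IsLocallyConstant.prodMk ?_ (hP.prodMk ((lc_mem hA).prodMk (lc_mem hB)))
      exact (hr.lc_sig hP hA).comp₂ (hr.lc_sig hP hB) m
    have c1 := isClosed_rel hL (fun a b => a.2.2.1 ∧ b.2.2.2 ∧ a.1 a.2.1 = b.2.1)
    have c2 := isClosed_rel hL (fun a b => a.2.2.2 ∧ b.2.2.1 ∧ a.1 b.2.1 = a.2.1)
    have c3 := isClosed_rel hL (fun a b => ¬ a.2.2.1 ∧ ¬ a.2.2.2)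
    have c4 : IsClosed {p : X × X | p.1 = p.2} := isClosed_diagonal
    have c0 : IsClosed {p : X × X | r p.1 = r p.2} :=
      isClosed_eq (hr.cont.comp continuous_fst) (hr.cont.comp continuous_snd)
    convert! c0.inter (c1.union (c2.union (c3.inter c4))) using 1
    ext p
    simp [hR, and_assoc]
  have hex' : ∀ y, ∃! x, R x y := by
    intro y
    obtain ⟨x, hx, hu⟩ := hex y
    exact ⟨x, hsymm _ _ hx, fun z hz => hu z (hsymm _ _ hz)⟩
  obtain ⟨δ, hδ⟩ := exists_homeo_of_closed_rel R hcl hex hex'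
  refine ⟨δ, fun x => ((hδ x _).2 rfl).1.symm, fun x hx => ?_, fun x hx => ?_, fun x h1 h2 => ?_⟩
  · rcases ((hδ x _).2 rfl).2 with h | h | h
    · exact h.2.1
    · exact absurd h.1 (hAB _ hx)
    · exact absurd hx h.1
  · rcases ((hδ x _).2 rfl).2 with h | h | h
    · exact absurd hx (hAB _ h.1)
    · exact h.2.1
    · exact absurd hx h.2.1
  · rcases ((hδ x _).2 rfl).2 with h | h | h
    · exact absurd h.1 h1
    · exact absurd h.1 h2
    · exact h.2.2.symm

end Ret

section Ret

variable {X : Type} [TopologicalSpace X] [CompactSpace X] [T2Space X] {r : X → X}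

theorem tr_ind_sdiff (hr : FR r) (A B : Set X) (x : X) :
    tr r (ind (A \ B)) x - tr r (ind (B \ A)) x = tr r (ind A) x - tr r (ind B) x := by
  rw [← tr_sub hr, ← tr_sub hr]
  congr 1
  funext y
  by_cases h1 : y ∈ A <;> by_cases h2 : y ∈ B <;> simp [ind_apply, h1, h2]

theorem FR.exists_swap (hr : FR r) {A B : Set X} (hA : IsClopen A) (hB : IsClopen B)
    (h : ∀ x, tr r (ind A) x = tr r (ind B) x) :
    ∃ δ : X ≃ₜ X, (∀ x, r (δ x) = r x) ∧ ∀ x, δ x ∈ B ↔ x ∈ A := by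
  obtain ⟨δ, h1, h2, h3, h4⟩ := hr.exists_swap_disjoint (hA.diff hB) (hB.diff hA)
    (disjoint_left.2 fun x hx hy => hx.2 hy.1) (fun x => by
      have := tr_ind_sdiff hr A B x
      rw [h x] at this
      omega)
  refine ⟨δ, h1, fun x => ?_⟩
  by_cases hxA : x ∈ A <;> by_cases hxB : x ∈ B
  · simp only [hxA, iff_true]
    rw [h4 x (by simp [hxB]) (by simp [hxA])]; exact hxB
  · simp only [hxA, iff_true]
    exact (h2 x ⟨hxA, hxB⟩).1
  · simp only [hxA, iff_false]
    exact (h3 x ⟨hxB, hxA⟩).2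
  · simp only [hxA, iff_false]
    rw [h4 x (by simp [hxA]) (by simp [hxB])]; exact hxB

theorem exists_alloc_labels : ∃ w : Set ℕ → Set ℕ → Set ℕ → ℕ → Set ℕ, ∀ S U V n,
    S.Finite → U ⊆ S → V ⊆ S → Disjoint U V → U.ncard ≤ n → n + V.ncard ≤ S.ncard →
    U ⊆ w S U V n ∧ w S U V n ⊆ S ∧ Disjoint (w S U V n) V ∧ (w S U V n).ncard = n := by
  have : ∀ S U V : Set ℕ, ∀ n, ∃ W : Set ℕ,
      S.Finite → U ⊆ S → V ⊆ S → Disjoint U V → U.ncard ≤ n → n + V.ncard ≤ S.ncard →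
      U ⊆ W ∧ W ⊆ S ∧ Disjoint W V ∧ W.ncard = n := by
    intro S U V n
    by_cases h : S.Finite ∧ U ⊆ S ∧ V ⊆ S ∧ Disjoint U V ∧ U.ncard ≤ n ∧ n + V.ncard ≤ S.ncard
    · obtain ⟨hS, hU, hV, hd, h1, h2⟩ := h
      have hV' := hS.subset hV
      have h3 : n ≤ (S \ V).ncard := by
        rw [ncard_sdiff hV hV']; omega
      obtain ⟨W, hW1, hW2, hW3⟩ := exists_subsuperset_card_eq
        (subset_sdiff.2 ⟨hU, hd⟩ : U ⊆ S \ V) h1 h3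
      exact ⟨W, fun _ _ _ _ _ _ => ⟨hW1, hW2.trans sdiff_subset, (subset_sdiff.1 hW2).2, hW3⟩⟩
    · exact ⟨∅, fun a b c d e f => absurd ⟨a, b, c, d, e, f⟩ h⟩
  choose w hw using this
  exact ⟨w, hw⟩

/-- Prescribing the trace of a clopen subset of `B` containing `N₁` and avoiding `N₂`. -/
theorem FR.exists_alloc (hr : FR r) {B N₁ N₂ : Set X} (hB : IsClopen B) (hN₁ : IsClopen N₁)
    (hN₂ : IsClopen N₂) (h1 : N₁ ⊆ B) (h2 : N₂ ⊆ B) (hd : Disjoint N₁ N₂)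
    (i1 : InjOn r N₁) (i2 : InjOn r N₂) {t : X → ℤ} (ht : IsLocallyConstant t)
    (hinv : ∀ x y, r x = r y → t x = t y) (t1 : ∀ x, 1 ≤ t x)
    (t2 : ∀ x, t x + 1 ≤ tr r (ind B) x) :
    ∃ C, IsClopen C ∧ N₁ ⊆ C ∧ C ⊆ B ∧ Disjoint C N₂ ∧ ∀ x, tr r (ind C) x = t x := by
  obtain ⟨P, hP, hinj⟩ := hr.lab
  obtain ⟨w, hw⟩ := exists_alloc_labels
  set W : X → Set ℕ := fun x => w (sig r P B x) (sig r P N₁ x) (sig r P N₂ x) (t x).toNat with hW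
  have hmono : ∀ {A A' : Set X}, A ⊆ A' → ∀ x, sig r P A x ⊆ sig r P A' x := by
    rintro A A' h x _ ⟨y, hy, h3, rfl⟩
    exact ⟨y, h hy, h3, rfl⟩
  have hcard : ∀ {N : Set X}, InjOn r N → ∀ x, (sig r P N x).ncard ≤ 1 := by
    intro N hN x
    rw [sig_ncard hinj, ncard_le_one ((hr.fin x).subset fun y hy => hy.2)]
    rintro a ⟨ha, ha'⟩ b ⟨hb, hb'⟩
    exact hN ha hb (ha'.trans hb'.symm)
  have hWx : ∀ x, sig r P N₁ x ⊆ W x ∧ W x ⊆ sig r P B x ∧ Disjoint (W x) (sig r P N₂ x) ∧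
      (W x).ncard = (t x).toNat := by
    intro x
    refine hw _ _ _ _ (sig_finite hr _ _ _) (hmono h1 x) (hmono h2 x) ?_ ?_ ?_
    · rw [disjoint_left]
      rintro _ ⟨y, hy, h3, rfl⟩ ⟨z, hz, h4, h5⟩
      have := hinj _ _ (h4.trans h3.symm) h5
      subst this
      exact disjoint_left.1 hd hy hz
    · have := hcard i1 x
      have := t1 x
      omega
    · have := hcard i2 x
      have h3 := t2 x
      have := t1 x
      rw [tr_ind hr, ← sig_ncard hinj] at h3
      omega
  have hWc : ∀ x y, r x = r y → W x = W y := by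
    intro x y hxy
    simp only [hW, sig_congr _ _ hxy, hinv _ _ hxy]
  refine ⟨{x | x ∈ B ∧ P x ∈ W x}, ?_, ?_, fun x hx => hx.1, ?_, ?_⟩
  · have hL : IsLocallyConstant (fun x => ((x ∈ B, P x), (sig r P B x, sig r P N₁ x),
        (sig r P N₂ x, t x))) :=
      ((lc_mem hB).prodMk hP).prodMk (((hr.lc_sig hP hB).prodMk (hr.lc_sig hP hN₁)).prodMk
        ((hr.lc_sig hP hN₂).prodMk ht))
    exact isClopen_setOf_lc hL
      (fun a => a.1.1 ∧ a.1.2 ∈ w a.2.1.1 a.2.1.2 a.2.2.1 a.2.2.2.toNat)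
  · intro x hx
    exact ⟨h1 hx, (hWx x).1 ⟨x, hx, rfl, rfl⟩⟩
  · rw [disjoint_left]
    rintro x ⟨_, hx⟩ hx2
    exact disjoint_left.1 (hWx x).2.2.1 hx ⟨x, hx2, rfl, rfl⟩
  · intro x
    rw [tr_ind hr, ← sig_ncard hinj]
    have : sig r P {x | x ∈ B ∧ P x ∈ W x} x = W x := by
      ext a
      constructor
      · rintro ⟨y, ⟨_, hy⟩, h3, rfl⟩
        rw [← hWc _ _ h3]; exact hy
      · intro ha
        obtain ⟨y, hy, h3, rfl⟩ := (hWx x).2.1 ha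
        exact ⟨y, ⟨hy, by rw [hWc _ _ h3]; exact ha⟩, h3, rfl⟩
    rw [this, (hWx x).2.2.2]
    have := t1 x
    omega

theorem FR.isClopen_fix (hr : FR r) : IsClopen {x | r x = x} := by
  obtain ⟨P, hP, hinj⟩ := hr.lab
  have := isClopen_setOf_lc ((lc_comp hP hr.cont).prodMk hP) (fun a => a.1 = a.2)
  convert! this using 1
  ext x
  exact ⟨fun h => congrArg P h, fun h => hinj _ _ (hr.idem x) h⟩

/-- On a clopen set where it is injective, `r` agrees with a homeomorphism preserving classes. -/
theorem FR.exists_homeo_eqOn (hr : FR r) {A : Set X} (hA : IsClopen A) (hi : InjOn r A) :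
    ∃ ς : X ≃ₜ X, (∀ x, r (ς x) = r x) ∧ ∀ x ∈ A, ς x = r x := by
  have hc : IsClopen {x | r x = x ∧ ∃ a ∈ A, r a = r x} := hr.isClopen_fix.inter (hr.sat_clopen hA)
  obtain ⟨δ, h1, h2⟩ := hr.exists_swap hA hc (by
    intro x
    rw [tr_ind hr, tr_ind hr]
    have : {y | y ∈ {x | r x = x ∧ ∃ a ∈ A, r a = r x} ∧ r y = r x}
        = r '' {y | y ∈ A ∧ r y = r x} := by
      ext y
      constructor
      · rintro ⟨⟨h3, a, ha, h4⟩, h5⟩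
        exact ⟨a, ⟨ha, h4.trans h5⟩, h4.trans h3⟩
      · rintro ⟨a, ⟨ha, h3⟩, rfl⟩
        exact ⟨⟨hr.idem a, a, ha, (hr.idem a).symm⟩, (hr.idem a).trans h3⟩
    rw [this, InjOn.ncard_image (hi.mono fun y hy => hy.1)])
  refine ⟨δ, h1, fun x hx => ?_⟩
  have := ((h2 x).2 hx).1
  rw [← this, h1]

theorem FR.exists_injOn_nhd [TotallyDisconnectedSpace X] (hr : FR r) {K U : Set X}
    (hK : IsClosed K) (hi : InjOn r K) (hU : IsOpen U) (hKU : K ⊆ U) :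
    ∃ N, IsClopen N ∧ K ⊆ N ∧ N ⊆ U ∧ InjOn r N := by
  obtain ⟨P, hP, hinj⟩ := hr.lab
  have hc : IsClosed ({p : X × X | r p.1 = r p.2} ∩ {p | P p.1 ≠ P p.2}) :=
    (isClosed_eq (hr.cont.comp continuous_fst) (hr.cont.comp continuous_snd)).inter
      (isClosed_rel hP (fun a b => a ≠ b))
  obtain ⟨u, v, hu, hv, hKu, hKv, huv⟩ := generalized_tube_lemma hK.isCompact hK.isCompact
    hc.isOpen_compl (by
      rintro ⟨a, b⟩ ⟨ha, hb⟩ ⟨h1, h2⟩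
      exact h2 (congrArg P (hi ha hb h1)))
  obtain ⟨N, hN, hKN, hNU⟩ := exists_clopen_of_closed_subset_open hK ((hu.inter hv).inter hU)
    (subset_inter (subset_inter hKu hKv) hKU)
  refine ⟨N, hN, hKN, fun x hx => (hNU hx).2, fun a ha b hb hab => ?_⟩
  by_contra hne
  have : (a, b) ∈ u ×ˢ v := ⟨(hNU ha).1.1, (hNU hb).1.2⟩
  exact huv this ⟨hab, fun h => hne (hinj _ _ hab h)⟩

theorem FR.of_ker {s : X → X} (hr : FR r) (hs : Continuous s) (idem : ∀ x, s (s x) = s x)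
    (h : ∀ x y, s x = s y ↔ r x = r y) : FR s := by
  obtain ⟨P, hP, hinj⟩ := hr.lab
  refine ⟨hs, idem, ⟨P, hP, fun x y h1 h2 => hinj x y ((h _ _).1 h1) h2⟩, fun A hA => ?_⟩
  simp only [h]
  exact hr.sat A hA

/-- Changing base points so that `r` becomes the identity on `K`. -/
theorem FR.exists_base_change [TotallyDisconnectedSpace X] (hr : FR r) {K : Set X}
    (hK : IsClosed K) (hi : InjOn r K) :
    ∃ s, FR s ∧ (∀ x y, s x = s y ↔ r x = r y) ∧ ∀ x ∈ K, s x = x := by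
  classical
  obtain ⟨N, hN, hKN, -, hiN⟩ := hr.exists_injOn_nhd hK hi isOpen_univ (subset_univ K)
  set s : X → X := fun x => if h : ∃ y ∈ N, r y = r x then h.choose else r x with hs
  have hs1 : ∀ x, (∃ y ∈ N, r y = r x) → s x ∈ N ∧ r (s x) = r x := by
    intro x h
    simp only [hs, dif_pos h]
    exact h.choose_spec
  have hs2 : ∀ x, (¬ ∃ y ∈ N, r y = r x) → s x = r x := by
    intro x h
    simp only [hs, dif_neg h]
  have hrs : ∀ x, r (s x) = r x := by
    intro x
    by_cases h : ∃ y ∈ N, r y = r x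
    · exact (hs1 x h).2
    · rw [hs2 x h, hr.idem]
  have hker : ∀ x y, s x = s y ↔ r x = r y := by
    intro x y
    constructor
    · intro h
      rw [← hrs x, h, hrs]
    · intro h
      by_cases hx : ∃ z ∈ N, r z = r x
      · have hy : ∃ z ∈ N, r z = r y := by rwa [h] at hx
        exact hiN (hs1 x hx).1 (hs1 y hy).1 (by rw [hrs, hrs, h])
      · have hy : ¬ ∃ z ∈ N, r z = r y := by rwa [h] at hx
        rw [hs2 x hx, hs2 y hy, h]
  have hsN : ∀ x ∈ N, s x = x := fun x hx => by
    have h : ∃ y ∈ N, r y = r x := ⟨x, hx, rfl⟩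
    exact hiN (hs1 x h).1 hx (hrs x)
  refine ⟨s, hr.of_ker ?_ (fun x => (hker _ _).2 (hrs x)) hker, hker, fun x hx => hsN x (hKN hx)⟩
  refine continuous_of_closed_rel s (fun x y => r x = r y ∧ (y ∈ N ∨
    ((¬ ∃ z ∈ N, r z = r x) ∧ y = r x))) ?_ ?_
  · have c1 : IsClosed {p : X × X | r p.1 = r p.2} :=
      isClosed_eq (hr.cont.comp continuous_fst) (hr.cont.comp continuous_snd)
    have c2 : IsClosed {p : X × X | p.2 ∈ N} := hN.isClosed.preimage continuous_snd
    have c3 : IsClosed {p : X × X | ¬ ∃ z ∈ N, r z = r p.1} :=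
      (hr.sat_clopen hN).compl.isClosed.preimage continuous_fst
    have c4 : IsClosed {p : X × X | p.2 = r p.1} :=
      isClosed_eq continuous_snd (hr.cont.comp continuous_fst)
    exact c1.inter (c2.union (c3.inter c4))
  · intro x y
    constructor
    · rintro ⟨h1, h2 | ⟨h2, rfl⟩⟩
      · have h : ∃ z ∈ N, r z = r x := ⟨y, h2, h1.symm⟩
        exact hiN (hs1 x h).1 h2 ((hrs x).trans h1)
      · exact hs2 x h2
    · rintro rfl
      refine ⟨(hrs x).symm, ?_⟩
      by_cases h : ∃ z ∈ N, r z = r x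
      · exact Or.inl (hs1 x h).1
      · exact Or.inr ⟨h, hs2 x h⟩

end Ret

section Seq

variable {X : Type} [TopologicalSpace X] [CompactSpace X] [T2Space X]

/-- An increasing sequence of finite clopen equivalence relations. -/
structure RS (r : ℕ → X → X) : Prop where
  fr : ∀ k, FR (r k)
  step : ∀ k, Dom (r k) (r (k + 1))

/-- Functions whose trace eventually vanishes. -/
def Null (r : ℕ → X → X) (f : X → ℤ) : Prop := ∃ k, ∀ x, tr (r k) f x = 0

variable {r : ℕ → X → X}

theorem RS.mono (hr : RS r) {k l : ℕ} (h : k ≤ l) : Dom (r k) (r l) := by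
  induction l, h using Nat.le_induction with
  | base => exact fun _ _ h => h
  | succ n _ ih => exact ih.trans (hr.step n)

theorem RS.null_iff (hr : RS r) (f : X → ℤ) (n : ℕ) :
    Null r f ↔ ∃ k ≥ n, ∀ x, tr (r k) f x = 0 := by
  refine ⟨fun ⟨k, hk⟩ => ⟨max k n, le_max_right _ _, ?_⟩, fun ⟨k, _, hk⟩ => ⟨k, hk⟩⟩
  exact tr_dom_zero (hr.fr _) (hr.fr _) (hr.mono (le_max_left _ _)) hk

theorem RS.null_sub (hr : RS r) {f g : X → ℤ} (hf : Null r f) (hg : Null r g) :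
    Null r (f - g) := by
  obtain ⟨k, hk⟩ := hf
  obtain ⟨l, hl, hl'⟩ := (hr.null_iff g k).1 hg
  have := tr_dom_zero (hr.fr _) (hr.fr _) (hr.mono hl) hk
  exact ⟨l, fun x => by rw [tr_sub (hr.fr l), this, hl', sub_zero]⟩

theorem RS.null_zero (hr : RS r) : Null r (0 : X → ℤ) :=
  ⟨0, fun x => by simp [tr]⟩

theorem RS.null_neg (hr : RS r) {f : X → ℤ} (hf : Null r f) : Null r (-f) := by
  simpa using hr.null_sub hr.null_zero hf

theorem RS.null_add (hr : RS r) {f g : X → ℤ} (hf : Null r f) (hg : Null r g) :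
    Null r (f + g) := by
  simpa using hr.null_sub hf (hr.null_neg hg)

theorem RS.null_sum (hr : RS r) {ι : Type*} (s : Finset ι) {f : ι → X → ℤ}
    (hf : ∀ i ∈ s, Null r (f i)) : Null r (∑ i ∈ s, f i) :=
  Finset.sum_induction f (Null r) (fun _ _ => hr.null_add) hr.null_zero hf

theorem null_comp_sub {s : X → X} (hr : RS r) (k : ℕ) (hs : FR s) (h : Dom s (r k))
    (e : X ≃ X) (he : ∀ x, s (e x) = s x) (f : X → ℤ) :
    Null r ((fun x => f (e x)) - f) := by
  refine ⟨k, tr_dom_zero hs (hr.fr k) h fun x => ?_⟩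
  rw [tr_sub hs, tr_comp f e he, sub_self]

end Seq

section Krieger

variable {X : Type} [TopologicalSpace X] [CompactSpace X] [T2Space X]

theorem FR.conj {r : X → X} (hr : FR r) (e : X ≃ₜ X) : FR (fun x => e (r (e.symm x))) := by
  obtain ⟨P, hP, hinj⟩ := hr.lab
  refine ⟨e.continuous.comp (hr.cont.comp e.symm.continuous), fun x => by simp [hr.idem],
    ⟨fun x => P (e.symm x), lc_comp hP e.symm.continuous, fun x y h1 h2 => ?_⟩, fun A hA => ?_⟩
  · exact e.symm.injective (hinj _ _ (e.injective h1) h2)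
  · have := (hr.sat _ (hA.preimage e.continuous)).preimage e.symm.continuous
    convert! this using 1
    ext x
    simp only [mem_ofPred_eq, EmbeddingLike.apply_eq_iff_eq, mem_preimage]
    constructor
    · rintro ⟨y, hy, h⟩
      exact ⟨e.symm y, by simpa using hy, h⟩
    · rintro ⟨y, hy, h⟩
      exact ⟨e y, hy, by simpa using h⟩

/-- Homeomorphisms acting trivially modulo `Null r`. -/
def CP (r : ℕ → X → X) (e : X ≃ₜ X) : Prop :=
  ∀ f : X → ℤ, IsLocallyConstant f → Null r ((fun x => f (e x)) - f)

variable {r : ℕ → X → X}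

theorem CP.trans (hr : RS r) {e e' : X ≃ₜ X} (h : CP r e) (h' : CP r e') : CP r (e.trans e') := by
  intro f hf
  have := hr.null_add (h _ (lc_comp hf e'.continuous)) (h' f hf)
  convert! this using 1
  funext x
  simp

theorem CP.symm (hr : RS r) {e : X ≃ₜ X} (h : CP r e) : CP r e.symm := by
  intro f hf
  have := hr.null_neg (h _ (lc_comp hf e.symm.continuous))
  convert! this using 1
  funext x
  simp

theorem CP.of_ret (hr : RS r) {s : X → X} (k : ℕ) (hs : FR s) (h : Dom s (r k))
    (e : X ≃ₜ X) (he : ∀ x, s (e x) = s x) : CP r e :=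
  fun f _ => null_comp_sub hr k hs h e.toEquiv he f

theorem CP.glue (hr : RS r) {α : Type*} {L : X → α} (hL : IsLocallyConstant L) (g : X ≃ₜ X)
    (h : ∀ a, ∃ G : X ≃ₜ X, CP r G ∧ ∀ x, L x = a → g x = G x) : CP r g := by
  classical
  choose G hG hg using h
  intro f hf
  have hfin := hL.range_finite
  set F : α → X → ℤ := fun a y => if L (g.symm y) = a then f y else 0 with hF
  have hFc : ∀ a, IsLocallyConstant (F a) := fun a =>
    lc_map ((lc_comp hL g.symm.continuous).prodMk hf) (fun x y hxy => by
      simp only [Prod.mk.injEq] at hxy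
      simp only [hF, hxy.1, hxy.2])
  have := hr.null_sum hfin.toFinset (f := fun a => (fun x => F a (G a x)) - F a)
    (fun a _ => hG a _ (hFc a))
  convert! this using 1
  funext x
  simp only [Finset.sum_apply, Pi.sub_apply, Finset.sum_sub_distrib]
  congr 1
  · rw [Finset.sum_eq_single (L x)]
    · have h1 := hg (L x) x rfl
      simp only [hF, ← h1, Homeomorph.symm_apply_apply, if_true]
    · intro b _ hb
      simp only [hF]
      rw [if_neg]
      intro h2
      have h3 := hg b _ h2
      rw [Homeomorph.apply_symm_apply] at h3
      have h4 := (G b).injective h3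
      rw [← h4] at h2
      exact hb h2.symm
    · intro h2
      exact absurd (hfin.mem_toFinset.2 ⟨x, rfl⟩) h2
  · rw [Finset.sum_eq_single (L (g.symm x))]
    · simp [hF]
    · intro b _ hb
      simp only [hF]
      rw [if_neg (fun h => hb h.symm)]
    · intro h2
      exact absurd (hfin.mem_toFinset.2 ⟨_, rfl⟩) h2

/-- Partial conjugacies used in the back-and-forth construction. -/
structure St (r r' : ℕ → X → X) (K : Set X) (h : X ≃ₜ X) (a b : X → X)
    (L : List ((X → X) × (X → X))) : Prop where
  fra : FR a
  frb : FR b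
  comm : ∀ x, h (a x) = b (h x)
  doma : ∃ k, Dom a (r k)
  domb : ∃ k, Dom b (r' k)
  ka : ∀ x ∈ K, a x = x
  kb : ∀ x ∈ K, b x = x
  kh : ∀ x ∈ K, h x = x
  cls : CP r h
  hist : ∀ p ∈ L, FR p.1 ∧ FR p.2 ∧ Dom p.1 a ∧ Dom p.2 b ∧
    ∀ x y, p.1 x = p.1 y ↔ p.2 (h x) = p.2 (h y)

variable {r' : ℕ → X → X} {K : Set X}

theorem St.symm (hr : RS r) (hB : ∀ f : X → ℤ, IsLocallyConstant f → (Null r f ↔ Null r' f))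
    {h : X ≃ₜ X} {a b : X → X} {L : List ((X → X) × (X → X))} (H : St r r' K h a b L) :
    St r' r K h.symm b a (L.map Prod.swap) := by
  refine ⟨H.frb, H.fra, fun x => ?_, H.domb, H.doma, H.kb, H.ka, fun x hx => ?_, ?_, ?_⟩
  · rw [Homeomorph.symm_apply_eq, H.comm, Homeomorph.apply_symm_apply]
  · rw [Homeomorph.symm_apply_eq, H.kh x hx]
  · intro f hf
    exact (hB _ ((lc_comp hf h.symm.continuous).sub hf)).1 (H.cls.symm hr f hf)
  · intro p hp
    obtain ⟨q, hq, rfl⟩ := List.mem_map.1 hp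
    obtain ⟨h1, h2, h3, h4, h5⟩ := H.hist q hq
    refine ⟨h2, h1, h4, h3, fun x y => ?_⟩
    have := h5 (h.symm x) (h.symm y)
    simpa using this.symm

/-- The cell shift `(a, b, c) ↦ (b, b, c)`. -/
def shift {α β : Type*} (d : α × α × β) : α × α × β := (d.2.1, d.2.1, d.2.2)

/-- A class preserving homeomorphism commuting with `b` and moving `q`-classes into
`r' n`-classes. -/
theorem exists_straighten [TotallyDisconnectedSpace X] (hr : RS r) (hr' : RS r')
    (hB : ∀ f : X → ℤ, IsLocallyConstant f → (Null r f ↔ Null r' f))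
    {b q : X → X} (hb : FR b) (hq : FR q) (hbq : Dom b q) {n₀ : ℕ} (hbn : Dom b (r' n₀))
    (hqCP : ∀ e : X ≃ₜ X, (∀ x, q (e x) = q x) → CP r e)
    {α : Type} {P : X → α} (hP : IsLocallyConstant P) :
    ∃ (g : X ≃ₜ X) (n : ℕ), CP r g ∧ (∀ x, b (g x) = g (b x)) ∧ (∀ x, P (g x) = P x) ∧
      (∀ x, b x = x → q x = x → g x = x) ∧ (∀ x, r' n (g x) = r' n (q x)) := by
  classical
  obtain ⟨Pq, hPq, hinj⟩ := hq.lab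
  set Ψ₁ : X → (ℕ × α) × (Prop × Prop) := fun x => ((Pq x, P x), (b x = x, q x = x)) with hΨ₁
  have c₁ : IsLocallyConstant Ψ₁ :=
    (hPq.prodMk hP).prodMk ((lc_mem hb.isClopen_fix).prodMk (lc_mem hq.isClopen_fix))
  set Ψ₀ := fun x => (Ψ₁ x, sig b Ψ₁ univ x) with hΨ₀
  have c₀ : IsLocallyConstant Ψ₀ := c₁.prodMk (hb.lc_sig c₁ isClopen_univ)
  set Ψ := fun x => (Ψ₀ x, Ψ₀ (q x), sig q Ψ₀ univ x) with hΨ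
  have c : IsLocallyConstant Ψ :=
    c₀.prodMk ((lc_comp c₀ hq.cont).prodMk (hq.lc_sig c₀ isClopen_univ))
  set D := fun d => {x | Ψ x = d} with hD
  have Dc : ∀ d, IsClopen (D d) := fun d => c.isClopen_fiber d
  have hΨq : ∀ x, Ψ (q x) = shift (Ψ x) := by
    intro x
    simp only [hΨ, shift, hq.idem, sig_congr Ψ₀ univ (hq.idem x)]
  have hΨinj : ∀ x y, Ψ x = Ψ y → q x = q y → x = y := fun x y h1 h2 =>
    hinj x y h2 (congrArg (fun d => d.1.1.1.1) h1)
  have hsurj : ∀ x e, Ψ e = shift (Ψ x) → ∃ y, Ψ y = Ψ x ∧ q y = e := by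
    intro x e he
    have h1 : Ψ₀ e = Ψ₀ (q x) := congrArg (fun d => d.1) he
    have h2 : sig q Ψ₀ univ e = sig q Ψ₀ univ x := congrArg (fun d => d.2.2) he
    have h3 : q e = e := by
      have : (q e = e) = (q (q x) = q x) := congrArg (fun d => d.1.2.2) h1
      rw [this]; exact hq.idem x
    have h4 : Ψ₀ x ∈ sig q Ψ₀ univ e := by rw [h2]; exact ⟨x, trivial, rfl, rfl⟩
    obtain ⟨y, -, hy1, hy2⟩ := h4
    have hy3 : q y = e := hy1.trans h3
    refine ⟨y, ?_, hy3⟩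
    simp only [hΨ, hy2, hy3, h1, ← h2, sig_congr Ψ₀ univ hy1]
  -- homeomorphisms agreeing with `q` on the cells
  have hε : ∀ d, ∃ ε : X ≃ₜ X, (∀ x, q (ε x) = q x) ∧ ∀ x ∈ D d, ε x = q x := fun d =>
    hq.exists_homeo_eqOn (Dc d) fun x hx y hy h => hΨinj x y (hx.trans hy.symm) h
  choose ε hε1 hε2 using hε
  have hnull : ∀ d, ∃ k, d ∈ range Ψ → ∀ x, tr (r' k) (ind (D d)) x = tr (r' k) (ind (D (shift d))) x := by
    intro d
    by_cases hd : d ∈ range Ψ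
    · obtain ⟨x₀, rfl⟩ := hd
      have h1 := hqCP (ε (Ψ x₀)) (hε1 _) _ (lc_ind (Dc (shift (Ψ x₀))))
      have h2 : (fun x => ind (D (shift (Ψ x₀))) (ε (Ψ x₀) x)) = ind (D (Ψ x₀)) := by
        funext x
        have : ε (Ψ x₀) x ∈ D (shift (Ψ x₀)) ↔ x ∈ D (Ψ x₀) := by
          constructor
          · intro h
            obtain ⟨y, hy, hy'⟩ := hsurj x₀ _ h
            rw [← hε2 (Ψ x₀) y hy] at hy'
            rw [← (ε (Ψ x₀)).injective hy']
            exact hy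
          · intro h
            rw [hε2 _ x h]
            simp only [hD, mem_ofPred_eq] at h ⊢
            rw [hΨq, h]
        simp only [ind_apply, this]
      rw [h2, hB _ ((lc_ind (Dc _)).sub (lc_ind (Dc _)))] at h1
      obtain ⟨k, hk⟩ := h1
      refine ⟨k, fun _ x => ?_⟩
      have := hk x
      rw [tr_sub (hr'.fr k)] at this
      omega
    · exact ⟨0, fun h => absurd h hd⟩
  choose k hk using hnull
  obtain ⟨n, hn⟩ : ∃ n, n₀ ≤ n ∧ ∀ d ∈ range Ψ, k d ≤ n := by
    refine ⟨n₀ + ∑ d ∈ c.range_finite.toFinset, k d, by omega, fun d hd => ?_⟩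
    have := Finset.single_le_sum (f := k) (fun _ _ => Nat.zero_le _)
      (c.range_finite.mem_toFinset.2 hd)
    omega
  have hδ : ∀ d, ∃ δ : X ≃ₜ X, d ∈ range Ψ → (∀ x, r' n (δ x) = r' n x) ∧
      (∀ x, δ x ∈ D d ↔ x ∈ D (shift d)) ∧ (shift d = d → ∀ x, δ x = x) := by
    intro d
    by_cases hd : d ∈ range Ψ
    · by_cases h : shift d = d
      · exact ⟨Homeomorph.refl X, fun _ => ⟨fun x => rfl, fun x => by rw [h]; rfl, fun _ x => rfl⟩⟩
      · have : ∀ x, tr (r' n) (ind (D (shift d))) x = tr (r' n) (ind (D d)) x := by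
          have := tr_dom_zero (hr'.fr _) (hr'.fr n) (hr'.mono (hn.2 d hd))
            (f := ind (D (shift d)) - ind (D d)) (fun x => by
              rw [tr_sub (hr'.fr _), hk d hd, sub_self])
          intro x
          have := this x
          rw [tr_sub (hr'.fr _)] at this
          omega
        obtain ⟨δ, h1, h2⟩ := (hr'.fr n).exists_swap (Dc (shift d)) (Dc d) this
        exact ⟨δ, fun _ => ⟨h1, h2, fun h' => absurd h' h⟩⟩
    · exact ⟨Homeomorph.refl X, fun h => absurd h hd⟩
  choose δ hδ using hδ
  have hδ1 : ∀ x y, r' n (δ (Ψ x) y) = r' n y := fun x => (hδ _ ⟨x, rfl⟩).1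
  have hδ2 : ∀ x y, Ψ (δ (Ψ x) y) = Ψ x ↔ Ψ y = shift (Ψ x) := fun x => (hδ _ ⟨x, rfl⟩).2.1
  have hδ3 : ∀ x, shift (Ψ x) = Ψ x → ∀ y, δ (Ψ x) y = y := fun x => (hδ _ ⟨x, rfl⟩).2.2
  set g₀ : X → X := fun x => δ (Ψ x) (q x) with hg₀
  have g₀Ψ : ∀ x, Ψ (g₀ x) = Ψ x := fun x => (hδ2 x _).2 (hΨq x)
  have g₀c : Continuous g₀ := by
    refine continuous_iff_continuousAt.2 fun x => ?_
    have h1 : ContinuousAt (fun y => δ (Ψ x) (q y)) x :=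
      ((δ (Ψ x)).continuous.comp hq.cont).continuousAt
    refine h1.congr ?_
    filter_upwards [(IsLocallyConstant.iff_eventually_eq _).1 c x] with y hy
    simp only [hg₀, hy]
  have g₀i : Function.Injective g₀ := by
    intro x y h
    have h1 : Ψ x = Ψ y := by rw [← g₀Ψ x, h, g₀Ψ]
    simp only [hg₀, h1] at h
    exact hΨinj x y h1 ((δ (Ψ y)).injective h)
  have g₀s : Function.Surjective g₀ := by
    intro z
    have h1 : Ψ ((δ (Ψ z)).symm z) = shift (Ψ z) := (hδ2 z _).1 (by simp)
    obtain ⟨y, hy1, hy2⟩ := hsurj z _ h1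
    refine ⟨y, ?_⟩
    simp only [hg₀, hy1, hy2, Homeomorph.apply_symm_apply]
  have g₀0 : ∀ x, Ψ₀ (g₀ x) = Ψ₀ x := fun x => congrArg (fun d => d.1) (g₀Ψ x)
  have g₀fix : ∀ x, q x = x → g₀ x = x := by
    intro x hx
    simp only [hg₀]
    rw [hδ3 x, hx]
    rw [← hΨq, hx]
  have g₀b : ∀ x, b (g₀ x) = g₀ x ↔ b x = x := fun x =>
    iff_of_eq (congrArg (fun d => d.1.2.1) (g₀0 x))
  -- lift `g₀` along `b`
  have lift : ∀ e e' x, Ψ₀ e' = Ψ₀ e → b x = e → ∃! x', b x' = e' ∧ Ψ₁ x' = Ψ₁ x := by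
    intro e e' x he hx
    have hbe : b e = e := by rw [← hx, hb.idem]
    have h1 : b e' = e' := by
      have : (b e' = e') = (b e = e) := congrArg (fun d => d.1.2.1) he
      rw [this]; exact hbe
    have h2 : Ψ₁ x ∈ sig b Ψ₁ univ e' := by
      have : sig b Ψ₁ univ e' = sig b Ψ₁ univ e := congrArg (fun d => d.2) he
      rw [this]
      exact ⟨x, trivial, hx.trans hbe.symm, rfl⟩
    obtain ⟨y, -, hy1, hy2⟩ := h2
    refine ⟨y, ⟨hy1.trans h1, hy2⟩, fun z hz => ?_⟩
    exact hinj _ _ (hbq _ _ (hz.1.trans (hy1.trans h1).symm))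
      (congrArg (fun d => d.1.1) (hz.2.trans hy2.symm))
  obtain ⟨g, hg⟩ := exists_homeo_of_closed_rel
    (fun x x' => b x' = g₀ (b x) ∧ Ψ₁ x' = Ψ₁ x) (by
      refine IsClosed.inter (isClosed_eq (hb.cont.comp continuous_snd)
        (g₀c.comp (hb.cont.comp continuous_fst))) ?_
      exact isClosed_rel c₁ (fun a a' => a' = a))
    (fun x => lift (b x) _ x (g₀0 _) rfl)
    (fun x' => by
      obtain ⟨e, he⟩ := g₀s (b x')
      have hbe : b e = e := (g₀b e).1 (by rw [he, hb.idem])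
      obtain ⟨x, hx, hu⟩ := lift (b x') e x' (by rw [← he, g₀0]) rfl
      refine ⟨x, ⟨by rw [hx.1, he], hx.2.symm⟩, fun z hz => hu z ⟨?_, hz.2.symm⟩⟩
      exact g₀i (by rw [← hz.1, he]))
  have hg1 : ∀ x, b (g x) = g₀ (b x) := fun x => ((hg x _).2 rfl).1
  have hg2 : ∀ x, Ψ₁ (g x) = Ψ₁ x := fun x => ((hg x _).2 rfl).2
  have hcomm : ∀ x, b (g x) = g (b x) := by
    intro x
    rw [hg1]
    refine ((hg _ _).1 ⟨?_, ?_⟩).symm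
    · rw [hb.idem, (g₀b _).2 (hb.idem x)]
    · exact congrArg (fun d => d.1) (g₀0 (b x))
  refine ⟨g, n, ?_, hcomm, fun x => congrArg (fun d => d.1.2) (hg2 x), ?_, ?_⟩
  · have binj : ∀ x y, Ψ₁ x = Ψ₁ y → b x = b y → x = y := fun x y h1 h2 =>
      hinj _ _ (hbq _ _ h2) (congrArg (fun d => d.1.1) h1)
    refine CP.glue hr ((lc_comp c hb.cont).prodMk c₁) g fun a => ?_
    by_cases ha : ∃ x₀, (Ψ (b x₀), Ψ₁ x₀) = a
    · obtain ⟨x₀, rfl⟩ := ha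
      obtain ⟨ς, h1, h2⟩ := hb.exists_homeo_eqOn (c₁.isClopen_fiber (Ψ₁ x₀))
        (fun x hx y hy h => binj x y (hx.trans hy.symm) h)
      have hς : CP r ς := hqCP ς fun x => hbq _ _ (h1 x)
      have hδc : CP r (δ (Ψ (b x₀))) := by
        intro f hf
        exact (hB _ ((lc_comp hf (δ _).continuous).sub hf)).2
          (CP.of_ret hr' n (hr'.fr n) (fun _ _ h => h) _ (hδ1 (b x₀)) f hf)
      refine ⟨((ς.trans (ε (Ψ (b x₀)))).trans (δ (Ψ (b x₀)))).trans ς.symm,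
        ((hς.trans hr (hqCP _ (hε1 _))).trans hr hδc).trans hr (hς.symm hr), ?_⟩
      intro x hx
      simp only [Prod.mk.injEq] at hx
      simp only [Homeomorph.trans_apply]
      rw [Homeomorph.eq_symm_apply, h2 _ ((hg2 x).trans hx.2), h2 x hx.2, hg1,
        hε2 _ (b x) hx.1]
      simp only [hg₀, hx.1]
    · exact ⟨Homeomorph.refl X, CP.of_ret hr 0 (hr.fr 0) (fun _ _ h => h) _ fun x => rfl,
        fun x hx => absurd ⟨x, hx⟩ ha⟩
  · intro x h1 h2
    refine (hg _ _).1 ⟨?_, rfl⟩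
    rw [h1, g₀fix x h2]
  · intro x
    have h1 : r' n (g x) = r' n (b (g x)) :=
      (hbn.trans (hr'.mono hn.1)) _ _ (hb.idem _).symm
    rw [h1, hg1]
    simp only [hg₀]
    rw [hδ1, hbq _ _ (hb.idem x)]

end Krieger

section Limit

variable {X : Type} [TopologicalSpace X] [CompactSpace X] [T2Space X] [TotallyDisconnectedSpace X]

/-- `U` enumerates the clopen subsets. -/
def EnumClopen (U : ℕ → Set X) : Prop := (∀ n, IsClopen (U n)) ∧ ∀ A, IsClopen A → ∃ n, U n = A

theorem exists_enumClopen [SecondCountableTopology X] : ∃ U : ℕ → Set X, EnumClopen U := by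
  have : Countable (TopologicalSpace.Clopens X) :=
    TopologicalSpace.Clopens.countable_iff_secondCountable.2 inferInstance
  obtain ⟨f, hf⟩ := exists_surjective_nat (TopologicalSpace.Clopens X)
  refine ⟨fun n => f n, fun n => (f n).isClopen, fun A hA => ?_⟩
  obtain ⟨n, hn⟩ := hf ⟨A, hA⟩
  exact ⟨n, congrArg (fun s : TopologicalSpace.Clopens X => (s : Set X)) hn⟩

theorem EnumClopen.tendsto {U : ℕ → Set X} (hU : EnumClopen U) {u : ℕ → X} {y : X}
    (h : ∀ n, ∀ i < n, (y ∈ U i ↔ u n ∈ U i)) : Tendsto u atTop (𝓝 y) := by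
  refine tendsto_nhds.2 fun V hV hy => ?_
  obtain ⟨W, hW, hyW, hWV⟩ := compact_exists_isClopen_in_isOpen hV hy
  obtain ⟨n, rfl⟩ := hU.2 W hW
  filter_upwards [eventually_gt_atTop n] with m hm
  exact hWV ((h m n hm).1 hyW)

theorem EnumClopen.ext {U : ℕ → Set X} (hU : EnumClopen U) {x y : X}
    (h : ∀ n, x ∈ U n → y ∈ U n) : x = y := by
  by_contra hne
  obtain ⟨W, hW, hx, hy⟩ := exists_isClopen_of_totally_separated hne
  obtain ⟨n, rfl⟩ := hU.2 W hW
  exact hy (h n hx)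

theorem exists_limit_point {U : ℕ → Set X} (hU : EnumClopen U) (u : ℕ → X)
    (h : ∀ n, ∀ i < n, (u (n + 1) ∈ U i ↔ u n ∈ U i)) :
    ∃ y, ∀ n, ∀ i < n, (y ∈ U i ↔ u n ∈ U i) := by
  have hc : ∀ n, IsClosed {y | ∀ i < n, (y ∈ U i ↔ u n ∈ U i)} := by
    intro n
    have : {y | ∀ i < n, (y ∈ U i ↔ u n ∈ U i)} = ⋂ i, ⋂ (_ : i < n), {y | y ∈ U i ↔ u n ∈ U i} := by
      ext; simp
    rw [this]
    exact isClosed_iInter fun i => isClosed_iInter fun _ =>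
      (isClopen_setOf_lc (lc_mem (hU.1 i)) (fun p => p ↔ u n ∈ U i)).isClosed
  obtain ⟨y, hy⟩ := IsCompact.nonempty_iInter_of_sequence_nonempty_isCompact_isClosed
    (fun n => {y | ∀ i < n, (y ∈ U i ↔ u n ∈ U i)})
    (fun n y hy i hi => (hy i (by omega)).trans (h n i hi)) (fun n => ⟨u n, fun i _ => Iff.rfl⟩)
    (hc 0).isCompact hc
  exact ⟨y, fun n => mem_iInter.1 hy n⟩

theorem eventually_stable {U : ℕ → Set X} {u : ℕ → X}
    (h : ∀ n, ∀ i < n, (u (n + 1) ∈ U i ↔ u n ∈ U i)) {n m : ℕ} (hnm : n ≤ m) :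
    ∀ i < n, (u m ∈ U i ↔ u n ∈ U i) := by
  induction m, hnm using Nat.le_induction with
  | base => exact fun i _ => Iff.rfl
  | succ m hm ih => exact fun i hi => (h m i (by omega)).trans (ih i hi)

/-- Two-sided limits of homeomorphisms. -/
theorem exists_limit_homeo {U : ℕ → Set X} (hU : EnumClopen U) (h : ℕ → X ≃ₜ X)
    (h1 : ∀ n x, ∀ i < n, (h (n + 1) x ∈ U i ↔ h n x ∈ U i))
    (h2 : ∀ n x, ∀ i < n, ((h (n + 1)).symm x ∈ U i ↔ (h n).symm x ∈ U i)) :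
    ∃ g : X ≃ₜ X, (∀ x, Tendsto (fun n => h n x) atTop (𝓝 (g x))) ∧
      ∀ x, Tendsto (fun n => (h n).symm x) atTop (𝓝 (g.symm x)) := by
  have key : ∀ (h : ℕ → X ≃ₜ X)
      (h1 : ∀ n x, ∀ i < n, (h (n + 1) x ∈ U i ↔ h n x ∈ U i))
      (h2 : ∀ n x, ∀ i < n, ((h (n + 1)).symm x ∈ U i ↔ (h n).symm x ∈ U i)) (x y : X),
      (∀ n, ∀ i < n, (y ∈ U i ↔ h n x ∈ U i)) → ∀ n, ∀ i < n, (x ∈ U i ↔ (h n).symm y ∈ U i) := by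
    intro h h1 h2 x y hy n i hi
    have ht := hU.tendsto hy
    have hV : IsOpen {z | (h n).symm z ∈ U i ↔ (h n).symm y ∈ U i} :=
      (isClopen_setOf_lc (lc_comp (lc_mem (hU.1 i)) (h n).symm.continuous)
        (fun p => p ↔ (h n).symm y ∈ U i)).isOpen
    obtain ⟨m, hm, hm'⟩ := ((ht.eventually_mem (hV.mem_nhds Iff.rfl)).and
      (eventually_ge_atTop n)).exists
    have hm : (h n).symm (h m x) ∈ U i ↔ (h n).symm y ∈ U i := hm
    rw [← hm, ← eventually_stable (u := fun n => (h n).symm (h m x)) (fun n => h2 n (h m x)) hm' i hi,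
      Homeomorph.symm_apply_apply]
  set R : X → X → Prop := fun x y => ∀ n, ∀ i < n, (y ∈ U i ↔ h n x ∈ U i) with hR
  have hR' : ∀ x y, R x y ↔ ∀ n, ∀ i < n, (x ∈ U i ↔ (h n).symm y ∈ U i) := fun x y =>
    ⟨key h h1 h2 x y, key (fun n => (h n).symm) h2 h1 y x⟩
  obtain ⟨g, hg⟩ := exists_homeo_of_closed_rel R (by
      have : {p : X × X | R p.1 p.2} =
          ⋂ n, ⋂ i, ⋂ (_ : i < n), {p : X × X | p.2 ∈ U i ↔ h n p.1 ∈ U i} := by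
        ext; simp [hR]
      rw [this]
      refine isClosed_iInter fun n => isClosed_iInter fun i => isClosed_iInter fun _ => ?_
      exact (isClopen_setOf_lc ((lc_comp (lc_mem (hU.1 i)) continuous_snd).prodMk
        (lc_comp (lc_mem (hU.1 i)) ((h n).continuous.comp continuous_fst)))
        (fun p => p.1 ↔ p.2)).isClosed)
    (fun x => by
      obtain ⟨y, hy⟩ := exists_limit_point hU (fun n => h n x) (fun n => h1 n x)
      exact ⟨y, hy, fun z hz => hU.ext fun n hn =>
        (hy (n + 1) n (by omega)).2 ((hz (n + 1) n (by omega)).1 hn)⟩)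
    (fun y => by
      obtain ⟨x, hx⟩ := exists_limit_point hU (fun n => (h n).symm y) (fun n => h2 n y)
      refine ⟨x, (hR' _ _).2 hx, fun z hz => hU.ext fun n hn =>
        (hx (n + 1) n (by omega)).2 (((hR' _ _).1 hz (n + 1) n (by omega)).1 hn)⟩)
  refine ⟨g, fun x => hU.tendsto ((hg x _).2 rfl), fun x => hU.tendsto ?_⟩
  exact (hR' _ _).1 ((hg _ _).2 (g.apply_symm_apply x))

end Limit

section Krieger

variable {X : Type} [TopologicalSpace X] [CompactSpace X] [T2Space X] [TotallyDisconnectedSpace X]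
variable {r r' : ℕ → X → X} {K : Set X}

theorem lc_list_map {ι α : Type*} (L : List ι) (F : ι → X → α)
    (h : ∀ i ∈ L, IsLocallyConstant (F i)) : IsLocallyConstant (fun x => L.map fun i => F i x) := by
  induction L with
  | nil => exact IsLocallyConstant.const _
  | cons i L ih =>
    exact (h i (by simp)).comp₂ (ih fun j hj => h j (by simp [hj])) List.cons

theorem St.advance (hr : RS r) (hr' : RS r')
    (hB : ∀ f : X → ℤ, IsLocallyConstant f → (Null r f ↔ Null r' f)) (hK : IsClosed K)
    (hrK : ∀ k, InjOn (r k) K) {h : X ≃ₜ X} {a b : X → X} {L : List ((X → X) × (X → X))}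
    (H : St r r' K h a b L) (k : ℕ) {α : Type} {P : X → α} (hP : IsLocallyConstant P) :
    ∃ (h' : X ≃ₜ X) (a' b' : X → X), St r r' K h' a' b' ((a, b) :: L) ∧ Dom (r k) a' ∧
      (∀ x, P (h' x) = P (h x)) ∧ ∀ x, P (h'.symm x) = P (h.symm x) := by
  obtain ⟨k₀, hk₀⟩ := H.doma
  obtain ⟨n₀, hn₀⟩ := H.domb
  set m := max k k₀ with hm
  obtain ⟨a', ha', hker, hfix⟩ := (hr.fr m).exists_base_change hK (hrK m)
  have hker' : ∀ x y, r m x = r m y → a' x = a' y := fun x y => (hker x y).2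
  have haa' : Dom a a' := (hk₀.trans (hr.mono (le_max_right _ _))).trans hker'
  set q : X → X := fun x => h (a' (h.symm x)) with hq
  have hqFR : FR q := ha'.conj h
  have hbq : Dom b q := by
    intro x y hxy
    have : a (h.symm x) = a (h.symm y) := h.injective (by rw [H.comm, H.comm]; simpa using hxy)
    simp only [hq, haa' _ _ this]
  have hH : ∀ p ∈ (a, b) :: L, FR p.1 ∧ FR p.2 ∧ Dom p.1 a ∧ Dom p.2 b ∧
      ∀ x y, p.1 x = p.1 y ↔ p.2 (h x) = p.2 (h y) := by
    intro p hp
    rcases List.mem_cons.1 hp with rfl | hp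
    · refine ⟨H.fra, H.frb, fun _ _ h => h, fun _ _ h => h, fun x y => ?_⟩
      simp only [← H.comm, EmbeddingLike.apply_eq_iff_eq]
    · exact H.hist p hp
  obtain ⟨Pb, hPb, hinj⟩ := H.frb.lab
  obtain ⟨g, n, g1, g2, g3, g4, g5⟩ := exists_straighten hr hr' hB H.frb hqFR hbq hn₀
    (by
      intro e he
      have h1 : CP r ((h.trans e).trans h.symm) := by
        refine CP.of_ret hr m ha' (fun x y => (hker x y).1) _ fun x => ?_
        have := he (h x)
        simp only [hq, Homeomorph.symm_apply_apply, EmbeddingLike.apply_eq_iff_eq] at this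
        simpa using this
      have h2 := ((H.cls.symm hr).trans hr h1).trans hr H.cls
      convert! h2 using 1
      ext x; simp)
    (P := fun x => ((P x, P (h.symm x)), (Pb x, ((a, b) :: L).map fun p => Pb (p.2 x))))
    ((hP.prodMk (lc_comp hP h.symm.continuous)).prodMk (hPb.prodMk
      (lc_list_map _ _ fun p hp => lc_comp hPb (hH p hp).2.1.cont)))
  have e1 : ∀ x, P (g x) = P x := fun x => congrArg (fun d => d.1.1) (g3 x)
  have e2 : ∀ x, P (h.symm (g x)) = P (h.symm x) := fun x => congrArg (fun d => d.1.2) (g3 x)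
  have e3 : ∀ x, Pb (g x) = Pb x := fun x => congrArg (fun d => d.2.1) (g3 x)
  have e4 : ∀ p ∈ (a, b) :: L, ∀ x, Pb (p.2 (g x)) = Pb (p.2 x) := by
    intro p hp x
    have : ((a, b) :: L).map (fun p => Pb (p.2 (g x))) = ((a, b) :: L).map (fun p => Pb (p.2 x)) :=
      congrArg (fun d => d.2.2) (g3 x)
    exact List.map_inj_left.1 this p hp
  have e5 : ∀ p ∈ (a, b) :: L, ∀ x, p.2 (g x) = g (p.2 x) := by
    intro p hp x
    obtain ⟨-, f1, -, f2, -⟩ := hH p hp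
    refine hinj _ _ ?_ ?_
    · rw [f2 _ _ (f1.idem (g x)), g2, g2, f2 _ _ (f1.idem x)]
    · rw [e4 p hp, e3]
  refine ⟨h.trans g, a', fun x => g (q (g.symm x)), ⟨ha', hqFR.conj g, fun x => ?_,
    ⟨m, fun x y => (hker x y).1⟩, ⟨n, ?_⟩, hfix, fun x hx => ?_, fun x hx => ?_,
    H.cls.trans hr g1, ?_⟩, ?_, fun x => e1 _, fun x => ?_⟩
  · simp [hq]
  · intro x y hxy
    have := g.injective hxy
    have h1 := g5 (g.symm x)
    have h2 := g5 (g.symm y)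
    rw [← this, ← h1] at h2
    simpa using h2.symm
  all_goals try have hgK : ∀ x ∈ K, g x = x := fun x hx => g4 x (H.kb x hx) (by
      have : h.symm x = x := by rw [Homeomorph.symm_apply_eq, H.kh x hx]
      simp only [hq, this, hfix x hx, H.kh x hx])
  · have h1 : g.symm x = x := by rw [Homeomorph.symm_apply_eq, hgK x hx]
    have h2 : h.symm x = x := by rw [Homeomorph.symm_apply_eq, H.kh x hx]
    simp only [hq, h1, h2, hfix x hx, H.kh x hx, hgK x hx]
  · simp only [Homeomorph.trans_apply, H.kh x hx, hgK x hx]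
  · intro p hp
    obtain ⟨f1, f2, f3, f4, f5⟩ := hH p hp
    refine ⟨f1, f2, f3.trans haa', f4.trans ?_, fun x y => ?_⟩
    · intro x y hxy
      have : b (g.symm x) = b (g.symm y) := g.injective (by
        rw [← g2, ← g2]; simpa using hxy)
      simp only [hbq _ _ this]
    · simp only [Homeomorph.trans_apply, e5 p hp, EmbeddingLike.apply_eq_iff_eq, f5]
  · exact (hr.mono (le_max_left _ _)).trans hker'
  · have := e2 (g.symm x)
    simpa using this.symm

theorem fr_id : FR (id : X → X) :=
  ⟨continuous_id, fun _ => rfl, ⟨fun _ => 0, IsLocallyConstant.const 0, fun _ _ h _ => h⟩,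
    fun A hA => by simpa using hA.isOpen⟩

/-- Krieger's theorem: sequences with the same null functions give rise to isomorphic
equivalence relations, via a homeomorphism fixing `K`. -/
theorem exists_homeo_of_null_eq [SecondCountableTopology X] (hr : RS r) (hr' : RS r')
    (hB : ∀ f : X → ℤ, IsLocallyConstant f → (Null r f ↔ Null r' f)) (hK : IsClosed K)
    (hrK : ∀ k, InjOn (r k) K) (hrK' : ∀ k, InjOn (r' k) K) :
    ∃ h : X ≃ₜ X, (∀ x ∈ K, h x = x) ∧
      ∀ x y, (∃ k, r k x = r k y) ↔ ∃ k, r' k (h x) = r' k (h y) := by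
  obtain ⟨U, hU⟩ := exists_enumClopen (X := X)
  have hU' : ∀ n, IsLocallyConstant (fun x => {i | i < n ∧ x ∈ U i}) := by
    intro n
    have := lc_list_map (List.range n) (fun i x => x ∈ U i) fun i _ => lc_mem (hU.1 i)
    refine lc_map this fun x y hxy => ?_
    ext i
    simp only [mem_ofPred_eq]
    refine and_congr_right fun hi => ?_
    exact iff_of_eq (List.map_inj_left.1 hxy i (List.mem_range.2 hi))
  let S := {s : (X ≃ₜ X) × (X → X) × (X → X) × List ((X → X) × (X → X)) //
    St r r' K s.1 s.2.1 s.2.2.1 s.2.2.2}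
  have step : ∀ (n : ℕ) (s : S), ∃ t : S, (∀ p ∈ s.1.2.2.2, p ∈ t.1.2.2.2) ∧
      (s.1.2.1, s.1.2.2.1) ∈ t.1.2.2.2 ∧ Dom (r n) t.1.2.1 ∧ Dom (r' n) t.1.2.2.1 ∧
      (∀ x, ∀ i < n, (t.1.1 x ∈ U i ↔ s.1.1 x ∈ U i)) ∧
      (∀ x, ∀ i < n, (t.1.1.symm x ∈ U i ↔ s.1.1.symm x ∈ U i)) := by
    rintro n ⟨⟨h, a, b, L⟩, H⟩
    obtain ⟨h₁, a₁, b₁, H₁, d₁, p₁, q₁⟩ := H.advance hr hr' hB hK hrK n (hU' n)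
    obtain ⟨h₂, a₂, b₂, H₂, d₂, p₂, q₂⟩ := (H₁.symm hr hB).advance hr' hr
      (fun f hf => (hB f hf).symm) hK hrK' n (hU' n)
    have H₃ := H₂.symm hr' (fun f hf => (hB f hf).symm)
    simp only [List.map_cons, Prod.swap_prod_mk, List.map_map, Prod.swap_swap_eq,
      List.map_id] at H₃
    refine ⟨⟨⟨h₂.symm, b₂, a₂, _⟩, H₃⟩, ?_, ?_, ?_, d₂, ?_, ?_⟩
    · intro p hp; simp only [List.mem_cons]; exact Or.inr (Or.inr hp)
    · simp
    · have := (H₂.hist (b₁, a₁) (by simp)).2.2.2.1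
      exact d₁.trans this
    · intro x i hi
      have e := (q₂ x).trans (p₁ x)
      have := Set.ext_iff.1 e i
      simpa [hi] using this
    · intro x i hi
      have e := (p₂ x).trans (q₁ x)
      have := Set.ext_iff.1 e i
      simpa [hi] using this
  choose F hF using step
  have s₀ : St r r' K (Homeomorph.refl X) id id [] :=
    ⟨fr_id, fr_id, fun _ => rfl, ⟨0, fun x y h => congrArg _ h⟩, ⟨0, fun x y h => congrArg _ h⟩,
      fun _ _ => rfl, fun _ _ => rfl, fun _ _ => rfl,
      CP.of_ret hr 0 (hr.fr 0) (fun _ _ h => h) _ fun _ => rfl, by simp⟩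
  let σ : ℕ → S := fun n => Nat.rec ⟨⟨Homeomorph.refl X, id, id, []⟩, s₀⟩ (fun n s => F n s) n
  have hσ : ∀ n, σ (n + 1) = F n (σ n) := fun n => rfl
  obtain ⟨g, hg1, hg2⟩ := exists_limit_homeo hU (fun n => (σ n).1.1)
    (fun n => by rw [hσ]; exact (hF n (σ n)).2.2.2.2.1)
    (fun n => by rw [hσ]; exact (hF n (σ n)).2.2.2.2.2)
  have hL : ∀ n m, n < m → ((σ n).1.2.1, (σ n).1.2.2.1) ∈ (σ m).1.2.2.2 := by
    intro n m hnm
    induction m, hnm using Nat.le_induction with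
    | base => rw [hσ]; exact (hF n (σ n)).2.1
    | succ m _ ih => rw [hσ]; exact (hF m (σ m)).1 _ ih
  have hker : ∀ n m, n < m → ∀ x y, (σ n).1.2.1 x = (σ n).1.2.1 y ↔
      (σ n).1.2.2.1 ((σ m).1.1 x) = (σ n).1.2.2.1 ((σ m).1.1 y) := fun n m h =>
    ((σ m).2.hist _ (hL n m h)).2.2.2.2
  have main : ∀ n x y, (σ n).1.2.1 x = (σ n).1.2.1 y ↔
      (σ n).1.2.2.1 (g x) = (σ n).1.2.2.1 (g y) := by
    intro n x y
    constructor
    · intro h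
      have hc := (σ n).2.frb.cont
      refine tendsto_nhds_unique_of_eventuallyEq ((hc.tendsto _).comp (hg1 x))
        ((hc.tendsto _).comp (hg1 y)) ?_
      filter_upwards [eventually_gt_atTop n] with m hm
      exact (hker n m hm x y).1 h
    · intro h
      have hc := (σ n).2.fra.cont
      have := tendsto_nhds_unique_of_eventuallyEq ((hc.tendsto _).comp (hg2 (g x)))
        ((hc.tendsto _).comp (hg2 (g y))) (by
          filter_upwards [eventually_gt_atTop n] with m hm
          refine (hker n m hm _ _).2 ?_
          simpa using h)
      simpa using this
  refine ⟨g, fun x hx => ?_, fun x y => ⟨?_, ?_⟩⟩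
  · refine tendsto_nhds_unique (hg1 x) ?_
    simp only [(σ _).2.kh x hx]
    exact tendsto_const_nhds
  · rintro ⟨k, hk⟩
    have h1 : (σ (k + 1)).1.2.1 x = (σ (k + 1)).1.2.1 y := by
      rw [hσ]; exact (hF k (σ k)).2.2.1 _ _ hk
    obtain ⟨l, hl⟩ := (σ (k + 1)).2.domb
    exact ⟨l, hl _ _ ((main (k + 1) x y).1 h1)⟩
  · rintro ⟨k, hk⟩
    have h1 : (σ (k + 1)).1.2.2.1 (g x) = (σ (k + 1)).1.2.2.1 (g y) := by
      rw [hσ]; exact (hF k (σ k)).2.2.2.1 _ _ hk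
    obtain ⟨l, hl⟩ := (σ (k + 1)).2.doma
    exact ⟨l, hl _ _ ((main (k + 1) x y).2 h1)⟩

end Krieger

section Tower

variable {X : Type} [TopologicalSpace X]

/-- Integer iterates of a homeomorphism. -/
def it (T : X ≃ₜ X) (n : ℤ) : X ≃ₜ X := T ^ n

variable {T : X ≃ₜ X} {E : Set X}

theorem it_zero (x : X) : it T 0 x = x := by simp [it]

theorem it_add (m n : ℤ) (x : X) : it T (m + n) x = it T m (it T n x) := by
  simp only [it, zpow_add]; rfl

theorem it_one (x : X) : it T 1 x = T x := by simp [it]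

theorem it_cont (n : ℤ) : Continuous (it T n) := (it T n).continuous

theorem it_eq_iff {m n : ℤ} {x y : X} : it T m x = it T n y ↔ x = it T (n - m) y := by
  constructor
  · intro h
    have := congrArg (it T (-m)) h
    rw [← it_add, ← it_add, neg_add_cancel, it_zero, neg_add_eq_sub] at this
    exact this
  · rintro rfl
    rw [← it_add, add_sub_cancel]

theorem it_neg_it (n : ℤ) (x : X) : it T (-n) (it T n x) = x := by
  rw [← it_add, neg_add_cancel, it_zero]

theorem it_it_neg (n : ℤ) (x : X) : it T n (it T (-n) x) = x := by
  rw [← it_add, add_neg_cancel, it_zero]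

/-- A clopen set visited by all orbits in both time directions. -/
structure Rec (T : X ≃ₜ X) (E : Set X) : Prop where
  clopen : IsClopen E
  fwd : ∀ x, ∃ j : ℕ, 0 < j ∧ it T j x ∈ E
  bwd : ∀ x, ∃ j : ℕ, it T (-j) x ∈ E

/-- Every orbit is dense. -/
def Minimal' (T : X ≃ₜ X) : Prop := ∀ x, Dense (range fun n : ℤ => it T n x)

theorem Minimal'.recur [CompactSpace X] (hT : Minimal' T) (hE : IsClopen E) (hne : E.Nonempty) :
    Rec T E := by
  have hex : ∀ x, ∃ n : ℤ, it T n x ∈ E := fun x => by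
    obtain ⟨_, hy, n, rfl⟩ := (hT x).inter_open_nonempty E hE.isOpen hne
    exact ⟨n, hy⟩
  obtain ⟨F, hF⟩ := isCompact_univ.elim_finite_subcover (fun n : ℤ => it T n ⁻¹' E)
    (fun n => hE.isOpen.preimage (it_cont n)) (fun x _ => mem_iUnion.2 (hex x))
  have hb : ∃ N : ℕ, ∀ n ∈ F, n.natAbs < N := by
    refine ⟨F.sup Int.natAbs + 1, fun n hn => Nat.lt_succ_of_le (Finset.le_sup hn)⟩
  obtain ⟨N, hN⟩ := hb
  have hb' : ∀ x, ∃ n : ℤ, n.natAbs < N ∧ it T n x ∈ E := fun x => by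
    have := hF (mem_univ x)
    simp only [mem_iUnion] at this
    obtain ⟨n, hn, h⟩ := this
    exact ⟨n, hN n hn, h⟩
  refine ⟨hE, fun x => ?_, fun x => ?_⟩
  · obtain ⟨n, hn, h⟩ := hb' (it T N x)
    refine ⟨(n + N).toNat, by omega, ?_⟩
    rw [Int.toNat_of_nonneg (by omega), it_add]; exact h
  · obtain ⟨n, hn, h⟩ := hb' (it T (-N) x)
    refine ⟨(N - n).toNat, ?_⟩
    rw [Int.toNat_of_nonneg (by omega), neg_sub, sub_eq_add_neg, it_add]; exact h

theorem Minimal'.aperiodic [T1Space X] [PerfectSpace X] (hT : Minimal' T) {n : ℤ} (hn : n ≠ 0)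
    (x : X) : it T n x ≠ x := by
  intro h
  have hper : ∀ (n : ℤ), it T n x = x → ∀ k : ℤ, it T (k * n) x = x := by
    intro n h k
    induction k using Int.induction_on with
    | zero => simp [it_zero]
    | succ i ih => rw [add_mul, one_mul, it_add, h, ih]
    | pred i ih =>
      have h' : it T (-n) x = x := by conv_lhs => rw [← h, it_neg_it]
      rw [sub_mul, one_mul, sub_eq_add_neg, it_add, h', ih]
  have hfin : (range fun m : ℤ => it T m x).Finite := by
    refine ((Set.finite_Ico (0 : ℤ) |n|).image fun m => it T m x).subset ?_
    rintro _ ⟨m, rfl⟩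
    refine ⟨m % n, ⟨Int.emod_nonneg _ hn, Int.emod_lt_abs _ hn⟩, ?_⟩
    conv_rhs => rw [← Int.emod_add_mul_ediv m n]
    simp only [it_add]
    rw [mul_comm, hper n h]
  have huniv : (univ : Set X).Finite := by
    rw [← (hT x).closure_eq, hfin.isClosed.closure_eq]; exact hfin
  have h2 : IsOpen ({x} : Set X) := by
    have : ({x} : Set X) = (univ \ {x})ᶜ := by ext; simp
    rw [this]
    exact (huniv.subset (subset_univ _)).isClosed.isOpen_compl
  have h3 : (𝓝[≠] x).NeBot := PerfectSpace.not_isolated x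
  rw [← mem_closure_iff_nhdsWithin_neBot, mem_closure_iff] at h3
  obtain ⟨y, hy, hy'⟩ := h3 _ h2 rfl
  exact hy' hy

theorem lc_sInf {p : ℕ → X → Prop} (hp : ∀ j, IsClopen {x | p j x}) (hex : ∀ x, ∃ j, p j x) :
    IsLocallyConstant fun x => sInf {j | p j x} := by
  refine (IsLocallyConstant.iff_eventually_eq _).2 fun x => ?_
  have h1 : ∀ᶠ y in 𝓝 x, ∀ j ∈ Finset.range (sInf {j | p j x} + 1), (p j y ↔ p j x) := by
    rw [Finset.eventually_all]
    intro j _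
    filter_upwards [(IsLocallyConstant.iff_eventually_eq _).1 (lc_mem (hp j)) x] with y hy
    exact iff_of_eq hy
  filter_upwards [h1] with y hy
  have hx : p (sInf {j | p j x}) x := Nat.sInf_mem (s := {j | p j x}) (hex x)
  have hy' : p (sInf {j | p j y}) y := Nat.sInf_mem (s := {j | p j y}) (hex y)
  have h2 : sInf {j | p j y} ≤ sInf {j | p j x} :=
    Nat.sInf_le ((hy _ (by simp)).2 hx)
  refine le_antisymm h2 (Nat.sInf_le ((hy _ ?_).1 hy'))
  simp only [Finset.mem_range]; omega

/-- Time since the last visit to `E`. -/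
noncomputable def bk (T : X ≃ₜ X) (E : Set X) (x : X) : ℕ := sInf {j : ℕ | it T (-j) x ∈ E}

/-- First return time to `E`. -/
noncomputable def ret (T : X ≃ₜ X) (E : Set X) (x : X) : ℕ := sInf {j : ℕ | 0 < j ∧ it T j x ∈ E}

/-- Last visit to `E`. -/
noncomputable def base (T : X ≃ₜ X) (E : Set X) (x : X) : X := it T (-(bk T E x)) x

namespace Rec

variable (h : Rec T E)
include h

theorem base_mem (x : X) : base T E x ∈ E := Nat.sInf_mem (s := {j : ℕ | it T (-j) x ∈ E}) (h.bwd x)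

theorem not_mem_of_lt {x : X} {j : ℕ} (hj : j < bk T E x) : it T (-j) x ∉ E :=
  Nat.notMem_of_lt_sInf hj

theorem ret_pos (x : X) : 0 < ret T E x :=
  (Nat.sInf_mem (s := {j : ℕ | 0 < j ∧ it T j x ∈ E}) (h.fwd x)).1

theorem ret_mem (x : X) : it T (ret T E x) x ∈ E :=
  (Nat.sInf_mem (s := {j : ℕ | 0 < j ∧ it T j x ∈ E}) (h.fwd x)).2

theorem not_mem_of_lt_ret {x : X} {j : ℕ} (h0 : 0 < j) (hj : j < ret T E x) : it T j x ∉ E :=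
  fun hm => Nat.notMem_of_lt_sInf hj ⟨h0, hm⟩

theorem ret_eq {x : X} {n : ℕ} (h0 : 0 < n) (hn : it T n x ∈ E)
    (hl : ∀ l : ℕ, 0 < l → l < n → it T l x ∉ E) : ret T E x = n := by
  refine le_antisymm (Nat.sInf_le ⟨h0, hn⟩) (not_lt.1 fun hlt => ?_)
  exact hl _ (h.ret_pos x) hlt (h.ret_mem x)

theorem bk_eq {x : X} {n : ℕ} (hn : it T (-n) x ∈ E)
    (hl : ∀ l : ℕ, l < n → it T (-l) x ∉ E) : bk T E x = n := by
  refine le_antisymm (Nat.sInf_le hn) (not_lt.1 fun hlt => ?_)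
  exact hl _ hlt (h.base_mem x)

theorem lc_bk : IsLocallyConstant (bk T E) :=
  lc_sInf (p := fun j x => it T (-j) x ∈ E)
    (fun j => h.clopen.preimage (it_cont _)) h.bwd

theorem lc_ret : IsLocallyConstant (ret T E) := by
  refine lc_sInf (p := fun j x => 0 < j ∧ it T j x ∈ E) (fun j => ?_) h.fwd
  by_cases hj : 0 < j
  · simp only [hj, true_and]; exact h.clopen.preimage (it_cont (T := T) j)
  · simp only [hj, false_and]; exact isClopen_empty

theorem bk_it {e : X} (he : e ∈ E) {j : ℕ} (hj : j < ret T E e) : bk T E (it T j e) = j := by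
  refine h.bk_eq (by rwa [it_neg_it]) fun l hl => ?_
  rw [← it_add, show -(l : ℤ) + j = ((j - l : ℕ) : ℤ) by omega]
  exact h.not_mem_of_lt_ret (by omega) (by omega)

theorem base_it {e : X} (he : e ∈ E) {j : ℕ} (hj : j < ret T E e) : base T E (it T j e) = e := by
  rw [base, h.bk_it he hj, it_neg_it]

theorem it_bk_base (x : X) : it T (bk T E x) (base T E x) = x := it_it_neg _ _

theorem bk_lt (x : X) : bk T E x < ret T E (base T E x) := by
  by_contra hlt
  rw [not_lt] at hlt
  have h1 := h.ret_mem (base T E x)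
  rw [base, ← it_add] at h1
  rw [← base] at h1
  have h2 := h.ret_pos (base T E x)
  refine h.not_mem_of_lt (x := x) (j := bk T E x - ret T E (base T E x)) (by omega) ?_
  rw [show -((bk T E x - ret T E (base T E x) : ℕ) : ℤ) =
    ret T E (base T E x) + -(bk T E x) by omega]
  exact h1

theorem base_self {e : X} (he : e ∈ E) : base T E e = e := by
  have := h.base_it he (h.ret_pos e)
  rwa [Nat.cast_zero, it_zero] at this

theorem base_eq_iff {x y : X} (hy : y ∈ E) :
    base T E x = y ↔ ∃ j < ret T E y, x = it T j y := by
  constructor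
  · rintro rfl
    exact ⟨_, h.bk_lt x, (h.it_bk_base x).symm⟩
  · rintro ⟨j, hj, rfl⟩
    exact h.base_it hy hj

theorem fr [CompactSpace X] : FR (base T E) := by
  refine ⟨?_, fun x => h.base_self (h.base_mem x), ⟨bk T E, h.lc_bk, fun x y h1 h2 => ?_⟩, ?_⟩
  · refine continuous_iff_continuousAt.2 fun x => ?_
    refine ((it_cont (T := T) (-(bk T E x))).continuousAt (x := x)).congr ?_
    filter_upwards [(IsLocallyConstant.iff_eventually_eq _).1 h.lc_bk x] with y hy
    rw [base, hy]
  · rw [← h.it_bk_base x, h1, h2, h.it_bk_base]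
  · intro A hA
    rw [isOpen_iff_mem_nhds]
    rintro x ⟨y, hyA, hy⟩
    have hyx : y = it T (bk T E y - bk T E x) x := by
      have := it_eq_iff.1 hy
      rw [neg_sub_neg] at this; exact this
    have c : Continuous (it T ((bk T E y : ℤ) - bk T E x)) := it_cont _
    filter_upwards [(IsLocallyConstant.iff_eventually_eq _).1 h.lc_bk x,
      (hA.isOpen.preimage c).mem_nhds (show x ∈ _ by rw [mem_preimage, ← hyx]; exact hyA),
      (IsLocallyConstant.iff_eventually_eq _).1 (lc_comp h.lc_bk c) x] with z h1 h2 h3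
    refine ⟨_, h2, ?_⟩
    rw [← hyx] at h3
    rw [base, h3, base, ← it_add, h1]
    congr 2; omega

theorem tr_base [CompactSpace X] (f : X → ℤ) {e : X} (he : e ∈ E) :
    tr (base T E) f e = ∑ j ∈ Finset.range (ret T E e), f (it T j e) := by
  have : {y | base T E y = base T E e} = (fun j : ℕ => it T j e) '' (Finset.range (ret T E e) : Set ℕ) := by
    ext y
    simp only [mem_ofPred_eq, h.base_self he, h.base_eq_iff he, Finset.coe_range, mem_image, mem_Iio]
    exact ⟨fun ⟨j, a, b⟩ => ⟨j, a, b.symm⟩, fun ⟨j, a, b⟩ => ⟨j, a, b.symm⟩⟩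
  rw [tr, this, finsum_mem_image, finsum_mem_coe_finset]
  intro i hi j hj hij
  have hi' : i < ret T E e := by simpa using hi
  have hj' : j < ret T E e := by simpa using hj
  rw [← h.bk_it he hi', ← h.bk_it he hj']
  exact congrArg _ hij

theorem tr_base' [CompactSpace X] (f : X → ℤ) {e : X} (he : e ∈ E) {n : ℕ} (h0 : 0 < n) (hn : it T n e ∈ E)
    (hl : ∀ l : ℕ, 0 < l → l < n → it T l e ∉ E) :
    tr (base T E) f e = ∑ j ∈ Finset.range n, f (it T j e) := by
  rw [h.tr_base f he, h.ret_eq h0 hn hl]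

theorem base_base {E' : Set X} (h' : Rec T E') (hE : E' ⊆ E) (x : X) :
    base T E' (base T E x) = base T E' x := by
  have hle : bk T E x ≤ bk T E' x := by
    by_contra hlt
    exact h.not_mem_of_lt (not_le.1 hlt) (hE (h'.base_mem x))
  have : bk T E' (base T E x) = bk T E' x - bk T E x := by
    refine h'.bk_eq ?_ fun l hl => ?_
    · rw [base, ← it_add, show -((bk T E' x - bk T E x : ℕ) : ℤ) + -(bk T E x) = -(bk T E' x) by omega]
      exact h'.base_mem x
    · rw [base, ← it_add, show -(l : ℤ) + -(bk T E x) = -((l + bk T E x : ℕ) : ℤ) by omega]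
      exact h'.not_mem_of_lt (by omega)
  rw [base, this, base, base, ← it_add]
  congr 2; omega

theorem base_T {x : X} (hx : T x ∉ E) : base T E (T x) = base T E x := by
  have : bk T E (T x) = bk T E x + 1 := by
    refine h.bk_eq ?_ fun l hl => ?_
    · rw [← it_one x, ← it_add, show -((bk T E x + 1 : ℕ) : ℤ) + 1 = -(bk T E x) by omega]
      exact h.base_mem x
    · rcases l with _ | l
      · simpa [it_zero] using hx
      · rw [← it_one x, ← it_add, show -((l + 1 : ℕ) : ℤ) + 1 = -(l : ℤ) by omega]
        exact h.not_mem_of_lt (by omega)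
  rw [base, this, base, ← it_one x, ← it_add]
  congr 2; omega

end Rec

end Tower

section Step

variable {X : Type} [TopologicalSpace X] [CompactSpace X] [T2Space X] [TotallyDisconnectedSpace X]
  [PerfectSpace X]
variable {T : X ≃ₜ X} {E : Set X}

theorem exists_mem_diff_countable {V S : Set X} (hV : IsOpen V) (hne : V.Nonempty)
    (hS : S.Countable) : ∃ x ∈ V, x ∉ S := by
  have : ∀ x : X, (𝓝[≠] x).NeBot := fun x => PerfectSpace.not_isolated x
  have hd : Dense (⋂ s ∈ S, ({s}ᶜ : Set X)) :=
    dense_biInter_of_isOpen (fun s _ => isOpen_compl_singleton) hS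
      (fun s _ => dense_compl_singleton s)
  obtain ⟨x, hx, hx'⟩ := hd.inter_open_nonempty V hV hne
  simp only [mem_iInter, mem_compl_iff, mem_singleton_iff] at hx'
  exact ⟨x, hx, fun h => hx' x h rfl⟩

/-- Points in prescribed open sets lying on pairwise distinct orbits. -/
theorem exists_indep (T : X ≃ₜ X) {V : ℕ → Set X} (hV : ∀ n, IsOpen (V n)) (hne : ∀ n, (V n).Nonempty)
    {Z : Set X} (hZ : Z.Countable) :
    ∃ u : ℕ → X, (∀ n, u n ∈ V n ∧ u n ∉ Z) ∧ ∀ m n, m ≠ n → ∀ z : ℤ, it T z (u m) ≠ u n := by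
  have key : ∀ (n : ℕ) (S : {S : Set X // S.Countable}), ∃ x ∈ V n, x ∉ S.1 := fun n S =>
    exists_mem_diff_countable (hV n) (hne n) S.2
  choose c hc hc' using key
  let S : ℕ → {S : Set X // S.Countable} := fun n => Nat.rec ⟨Z, hZ⟩ (fun n S =>
    ⟨S.1 ∪ range fun z : ℤ => it T z (c n S), S.2.union (countable_range _)⟩) n
  have hS : ∀ n, (S (n + 1)).1 = (S n).1 ∪ range fun z : ℤ => it T z (c n (S n)) := fun n => rfl
  have hmono : Monotone fun n => (S n).1 := monotone_nat_of_le_succ fun n => by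
    rw [hS]; exact subset_union_left
  have h1 : ∀ m n, m < n → ∀ z : ℤ, it T z (c m (S m)) ≠ c n (S n) := fun m n hmn z h =>
    hc' n (S n) (hmono hmn (by
      show _ ∈ (S (m + 1)).1
      rw [hS, ← h]; exact Or.inr ⟨z, rfl⟩))
  refine ⟨fun n => c n (S n), fun n => ⟨hc _ _, fun h => hc' n (S n) (hmono (Nat.zero_le n) h)⟩,
    fun m n hmn z h => ?_⟩
  rcases lt_or_gt_of_ne hmn with hlt | hlt
  · exact h1 m n hlt z h
  · refine h1 n m hlt (-z) ?_
    have h : it T z (c m (S m)) = c n (S n) := h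
    rw [← h, it_neg_it]

theorem exists_clopen_wander {K V : Set X} (hK : IsClosed K) (hV : IsClopen V) (hKV : K ⊆ V)
    (M : ℕ) (h : ∀ m : ℕ, 0 < m → m ≤ M → ∀ x ∈ K, it T m x ∉ K) :
    ∃ O, IsClopen O ∧ K ⊆ O ∧ O ⊆ V ∧ ∀ m : ℕ, 0 < m → m ≤ M → ∀ x ∈ O, it T m x ∉ O := by
  induction M with
  | zero => exact ⟨V, hV, hKV, subset_rfl, fun m h0 h1 => by omega⟩
  | succ M ih =>
    obtain ⟨O, hO, hKO, hOV, hw⟩ := ih fun m h0 h1 => h m h0 (by omega)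
    have hc : IsClosed (it T (M + 1 : ℕ) ⁻¹' K) := hK.preimage (it_cont _)
    obtain ⟨W, hW, hKW, hWK⟩ := exists_clopen_of_closed_subset_open hK hc.isOpen_compl
      (fun x hx => h (M + 1) (by omega) le_rfl x hx)
    have hW2 : IsClopen (it T (M + 1 : ℕ) '' W) := by
      rw [Homeomorph.image_eq_preimage_symm]
      exact hW.preimage (it T _).symm.continuous
    refine ⟨O ∩ (W \ it T (M + 1 : ℕ) '' W), hO.inter (hW.diff hW2), fun x hx => ⟨hKO hx, hKW hx, ?_⟩,
      fun x hx => hOV hx.1, fun m h0 h1 x hx hx' => ?_⟩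
    · rintro ⟨y, hy, rfl⟩
      exact hWK hy hx
    · rcases Nat.lt_or_ge M m with hm | hm
      · obtain rfl : m = M + 1 := by omega
        exact hx'.2.2 ⟨x, hx.2.1, rfl⟩
      · exact hw m h0 hm x hx.1 hx'.1

theorem Rec.image_ret (h : Rec T E) {N : Set X} (hN : N ⊆ E) (x : X) :
    (∃ o ∈ N, it T (ret T E o) o = x) ↔ x ∈ E ∧ base T E (it T (-1) x) ∈ N := by
  constructor
  · rintro ⟨o, ho, rfl⟩
    refine ⟨h.ret_mem o, ?_⟩
    have hp := h.ret_pos o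
    rw [← it_add, show (-1 : ℤ) + ret T E o = (ret T E o - 1 : ℕ) by omega,
      h.base_it (hN ho) (by omega)]
    exact ho
  · rintro ⟨hx, hb⟩
    refine ⟨_, hb, ?_⟩
    have hlt := h.bk_lt (it T (-1) x)
    have h1 := h.it_bk_base (it T (-1) x)
    have h2 : it T (bk T E (it T (-1) x) + 1 : ℕ) (base T E (it T (-1) x)) = x := by
      rw [Nat.cast_add, Nat.cast_one, add_comm, it_add, h1, it_it_neg]
    rw [h.ret_eq (n := bk T E (it T (-1) x) + 1) (by omega) (by rw [h2]; exact hx)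
      (fun l h0 hl => h.not_mem_of_lt_ret h0 (by omega)), h2]

theorem Rec.image_ret_clopen (h : Rec T E) {N : Set X} (hN : N ⊆ E) (hc : IsClopen N) :
    IsClopen {x | ∃ o ∈ N, it T (ret T E o) o = x} := by
  simp only [h.image_ret hN]
  exact h.clopen.inter (hc.preimage (h.fr.cont.comp (it_cont _)))

/-- The word of labels read along a tower. -/
noncomputable def word {α : Type*} (T : X ≃ₜ X) (E : Set X) (B : X → α) (z : X) : List α :=
  (List.range (ret T E z)).map fun l : ℕ => B (it T l z)

theorem Rec.lc_word (h : Rec T E) {α : Type*} {B : X → α} (hB : IsLocallyConstant B) :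
    IsLocallyConstant (word T E B) := by
  refine (IsLocallyConstant.iff_eventually_eq _).2 fun x => ?_
  have h1 := lc_list_map (List.range (ret T E x)) (fun l : ℕ => fun z => B (it T l z))
    fun l _ => lc_comp hB (it_cont _)
  filter_upwards [(IsLocallyConstant.iff_eventually_eq _).1 h.lc_ret x,
    (IsLocallyConstant.iff_eventually_eq _).1 h1 x] with y hy hy'
  simp only [word, hy]
  exact hy'

theorem word_eq_iff {α : Type*} {B : X → α} {z w : X} : word T E B z = word T E B w ↔
    ret T E z = ret T E w ∧ ∀ l < ret T E z, B (it T l z) = B (it T l w) := by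
  constructor
  · intro h
    have h1 : ret T E z = ret T E w := by
      have := congrArg List.length h
      simpa [word] using this
    refine ⟨h1, fun l hl => ?_⟩
    rw [word, word, ← h1] at h
    exact List.map_inj_left.1 h l (List.mem_range.2 hl)
  · rintro ⟨h1, h2⟩
    rw [word, word, ← h1]
    exact List.map_inj_left.2 fun l hl => h2 l (List.mem_range.1 hl)

theorem Rec.tr_eq_of_word (h : Rec T E) {α : Type*} {B : X → α} {z w : X} (hz : z ∈ E) (hw : w ∈ E)
    (hword : word T E B z = word T E B w) {f : X → ℤ} (hf : ∀ x y, B x = B y → f x = f y) :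
    tr (base T E) f z = tr (base T E) f w := by
  obtain ⟨h1, h2⟩ := word_eq_iff.1 hword
  rw [h.tr_base f hz, h.tr_base f hw, ← h1]
  exact Finset.sum_congr rfl fun l hl => hf _ _ (h2 l (Finset.mem_range.1 hl))

theorem lc_encode {α : Type*} {L : X → α} (hL : IsLocallyConstant L) :
    ∃ I : X → ℕ, IsLocallyConstant I ∧ ∀ x y, I x = I y ↔ L x = L y := by
  have hc : Countable (range L) := hL.range_finite.countable
  obtain ⟨e, he⟩ := exists_injective_nat (range L)
  have h : ∀ x y, e ⟨L x, mem_range_self x⟩ = e ⟨L y, mem_range_self y⟩ ↔ L x = L y := fun x y => by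
    rw [he.eq_iff, Subtype.mk.injEq]
  exact ⟨fun x => e ⟨L x, mem_range_self x⟩, lc_map hL fun x y hxy => (h x y).2 hxy, h⟩

/-- Functions supported on `E` and depending on the label only. -/
noncomputable def cellFun (E : Set X) (I : X → ℕ) (φ : ℕ → ℤ) (z : X) : ℤ := ind E z * φ (I z)

/-- The coboundary of the indicator of `U`. -/
noncomputable def cob (T : X ≃ₜ X) (U : Set X) (x : X) : ℤ := ind U x - ind U (T x)

theorem exists_label [Nonempty X] (hT : Minimal' T) (hE : Rec T E) {I : X → ℕ} (hI : IsLocallyConstant I)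
    {α : Type*} {A : X → α} (hA : IsLocallyConstant A) (n : ℕ) {E' : Set X} (hE' : Rec T E')
    (hb : ∀ x ∈ E, ∃ y ∈ E', I y = I x) : ∃ (I' : X → ℕ) (U : ℕ → Set X),
      IsLocallyConstant I' ∧ (∀ j, IsClopen (U j)) ∧ (∀ x y, I' x = I' y → A x = A y ∧ I x = I y) ∧
      (∀ x ∈ E, ∃ y ∈ E', ∃ y' ∈ E', I y = I x ∧ I y' = I x ∧ I' y ≠ I' y') ∧
      (∀ f : X → ℤ, ((∃ ψ : α → ℤ, f = fun x => ψ (A x)) ∨ (∃ φ, f = cellFun E I φ) ∨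
          ∃ j < n, f = cob T (U j)) → ∀ z ∈ E', ∀ w ∈ E', I' z = I' w →
          tr (base T E') f z = tr (base T E') f w) ∧
      ∃ x : ℕ → X, (∀ i, x i ∈ E') ∧
        (∀ φ i, tr (base T E') (cellFun E I φ) (x i) = tr (base T E') (cellFun E I φ) (x n)) ∧
        ∀ j < n, ∀ i ≤ n, tr (base T E') (cob T (U j)) (x i) = if i = j then 1 else 0 := by
  classical
  obtain ⟨e, he⟩ : E'.Nonempty := ⟨_, hE'.base_mem (Classical.arbitrary X)⟩
  have hEI : IsLocallyConstant fun x => (x ∈ E, I x) := (lc_mem hE.clopen).prodMk hI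
  have hcell : ∀ φ x y, (x ∈ E, I x) = (y ∈ E, I y) → cellFun E I φ x = cellFun E I φ y := by
    intro φ x y h
    rw [Prod.mk.injEq] at h
    simp only [cellFun, ind_apply, h.1, h.2]
  set Q : Set X := E' ∩ {z | word T E' (fun x => (x ∈ E, I x)) z = word T E' (fun x => (x ∈ E, I x)) e}
    with hQ
  have hQc : IsClopen Q := hE'.clopen.inter ((hE'.lc_word hEI).isClopen_fiber _)
  obtain ⟨x, hx, hx'⟩ := exists_indep T (V := fun _ => Q) (fun _ => hQc.isOpen)
    (fun _ => ⟨e, he, rfl⟩) countable_empty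
  have hU : ∀ j, ∃ U, IsClopen U ∧ x j ∈ U ∧ (∀ i ≤ n, i ≠ j → x i ∉ U) ∧
      ∀ i ≤ n, it T (ret T E' (x i)) (x i) ∉ U := by
    intro j
    set F : Set X := (x '' {i | i ≤ n ∧ i ≠ j}) ∪
      ((fun i => it T (ret T E' (x i)) (x i)) '' {i | i ≤ n}) with hF
    have hFf : F.Finite := (((finite_le_nat n).subset fun i hi => hi.1).image _).union
      ((finite_le_nat n).image _)
    have hjF : x j ∈ Fᶜ := by
      rintro (⟨i, hi, h⟩ | ⟨i, hi, h⟩)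
      · refine hx' i j hi.2 0 ?_
        rw [it_zero, h]
      · by_cases hij : i = j
        · subst hij
          have := hE'.ret_pos (x i)
          exact hT.aperiodic (n := ret T E' (x i)) (by omega) _ h
        · exact hx' i j hij _ h
    obtain ⟨U, hU, hjU, hUF⟩ := compact_exists_isClopen_in_isOpen hFf.isClosed.isOpen_compl hjF
    refine ⟨U, hU, hjU, fun i hi hij h => hUF h (Or.inl ⟨i, ⟨hi, hij⟩, rfl⟩), fun i hi h =>
      hUF h (Or.inr ⟨i, hi, rfl⟩)⟩
  choose U hU1 hU2 hU3 hU4 using hU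
  have hW : ∀ i, ∃ W : Set X, IsClopen W ∧ ∀ y ∈ E', I y = i →
      ∃ z ∈ E', ∃ z' ∈ E', I z = i ∧ I z' = i ∧ z ∈ W ∧ z' ∉ W := by
    intro i
    by_cases h : ∃ y ∈ E', I y = i
    · obtain ⟨y, hy, hyi⟩ := h
      obtain ⟨y', ⟨hy', hyi'⟩, hne⟩ := exists_mem_diff_countable (V := E' ∩ {y | I y = i}) (S := {y})
        (hE'.clopen.inter (hI.isClopen_fiber i)).isOpen ⟨y, hy, hyi⟩ (countable_singleton y)
      obtain ⟨W, hW, h1, h2⟩ := exists_isClopen_of_totally_separated (Ne.symm hne)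
      exact ⟨W, hW, fun _ _ _ => ⟨y, hy, y', hy', hyi, hyi', h1, h2⟩⟩
    · exact ⟨∅, isClopen_empty, fun y hy hyi => absurd ⟨y, hy, hyi⟩ h⟩
  choose W hW1 hW2 using hW
  have hWl : IsLocallyConstant fun x => x ∈ W (I x) := by
    refine (IsLocallyConstant.iff_eventually_eq _).2 fun x => ?_
    filter_upwards [(IsLocallyConstant.iff_eventually_eq _).1 hI x,
      (IsLocallyConstant.iff_eventually_eq _).1 (lc_mem (hW1 (I x))) x] with y h1 h2
    rw [h1, h2]
  set B : X → _ := fun x => ((A x, (x ∈ E, I x)), (x ∈ W (I x),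
    (List.range n).map fun j => (x ∈ U j, T x ∈ U j))) with hB
  have hBl : IsLocallyConstant B := (hA.prodMk hEI).prodMk (hWl.prodMk
    (lc_list_map _ _ fun j _ => (lc_mem (hU1 j)).prodMk (lc_comp (lc_mem (hU1 j)) T.continuous)))
  obtain ⟨I', hI', hI''⟩ := lc_encode (hE'.lc_word hBl)
  refine ⟨I', U, hI', hU1, fun x y h => ?_, fun x hx => ?_, ?_, x, fun i => (hx i).1.1, fun φ i => ?_, fun j hj i hi => ?_⟩
  · have := (word_eq_iff.1 ((hI'' _ _).1 h)).2 0 (hE'.ret_pos _)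
    simp only [Nat.cast_zero, it_zero] at this
    exact ⟨congrArg (fun d => d.1.1) this, congrArg (fun d => d.1.2.2) this⟩
  · obtain ⟨y, hy, hyx⟩ := hb x hx
    obtain ⟨z, hz, z', hz', h1, h2, h3, h4⟩ := hW2 _ y hy hyx
    refine ⟨z, hz, z', hz', h1, h2, fun h => ?_⟩
    have := (word_eq_iff.1 ((hI'' _ _).1 h)).2 0 (hE'.ret_pos _)
    simp only [Nat.cast_zero, it_zero] at this
    have h5 : (z ∈ W (I z)) = (z' ∈ W (I z')) := congrArg (fun d => d.2.1) this
    rw [h1, h2] at h5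
    exact h4 (h5 ▸ h3)
  · intro f hf z hz w hw hzw
    refine hE'.tr_eq_of_word hz hw ((hI'' _ _).1 hzw) fun a b hab => ?_
    rcases hf with ⟨ψ, rfl⟩ | ⟨φ, rfl⟩ | ⟨j, hj, rfl⟩
    · exact congrArg ψ (congrArg (fun d => d.1.1) hab)
    · exact hcell φ a b (congrArg (fun d => d.1.2) hab)
    · have h1 : (List.range n).map (fun j => (a ∈ U j, T a ∈ U j)) =
        (List.range n).map (fun j => (b ∈ U j, T b ∈ U j)) := congrArg (fun d => d.2.2) hab
      have h2 := List.map_inj_left.1 h1 j (List.mem_range.2 hj)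
      rw [Prod.mk.injEq] at h2
      simp only [cob, ind_apply, h2.1, h2.2]
  · exact hE'.tr_eq_of_word (hx i).1.1 (hx n).1.1 ((hx i).1.2.trans (hx n).1.2.symm) (hcell φ)
  · rw [hE'.tr_base _ (hx i).1.1]
    have : ∀ l : ℕ, cob T (U j) (it T l (x i)) =
        ind (U j) (it T l (x i)) - ind (U j) (it T (l + 1 : ℕ) (x i)) := by
      intro l
      rw [cob, Nat.cast_add, add_comm, Nat.cast_one, it_add, it_one]
    simp only [this]
    rw [Finset.sum_range_sub' (fun l : ℕ => ind (U j) (it T l (x i)))]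
    simp only [Nat.cast_zero, it_zero, ind_apply, hU4 j i hi, if_false, sub_zero]
    by_cases hij : i = j
    · subst hij; simp [hU2 i]
    · simp [hij, hU3 j i hi hij]

end Step

section Sparse

variable {X : Type} [TopologicalSpace X] [CompactSpace X] [T2Space X] [TotallyDisconnectedSpace X]
  [PerfectSpace X]
variable {T : X ≃ₜ X} {E : Set X}

theorem exists_sparse [Nonempty X] (hT : Minimal' T) (hE : Rec T E) {I : X → ℕ}
    (hI : IsLocallyConstant I) (J : ℕ) : ∃ E' ⊆ E, Rec T E' ∧
      (∀ x ∈ E', ∀ j : ℕ, 0 < j → j ≤ J → it T j x ∉ E') ∧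
      (∀ x ∈ E, ∃ y ∈ E', I y = I x) ∧
      ∀ x ∈ E, ∃ y ∈ E', ∃ y' ∈ E', ∀ φ, tr (base T E') (cellFun E I φ) y -
        tr (base T E') (cellFun E I φ) y' = φ (I x) := by
  classical
  obtain ⟨N, hN⟩ : ∃ N, ∀ x, I x < N := by
    obtain ⟨N, hN⟩ := hI.range_finite.bddAbove
    exact ⟨N + 1, fun x => Nat.lt_succ_of_le (hN ⟨x, rfl⟩)⟩
  obtain ⟨H, hH⟩ : ∃ H, ∀ x, ret T E x ≤ H := by
    obtain ⟨H, hH⟩ := hE.lc_ret.range_finite.bddAbove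
    exact ⟨H, fun x => hH ⟨x, rfl⟩⟩
  have hEne : E.Nonempty := ⟨_, hE.base_mem (Classical.arbitrary X)⟩
  have hV : ∀ i, ∃ V ⊆ E, IsOpen V ∧ V.Nonempty ∧ ∀ x ∈ E, I x = i → ∀ y ∈ V, I y = i := by
    intro i
    by_cases h : (E ∩ {x | I x = i}).Nonempty
    · exact ⟨_, inter_subset_left, (hE.clopen.inter (hI.isClopen_fiber i)).isOpen, h,
        fun _ _ _ y hy => hy.2⟩
    · exact ⟨E, subset_rfl, hE.clopen.isOpen, hEne, fun x hx hi => absurd ⟨x, hx, hi⟩ h⟩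
  choose V hV1 hV2 hV3 hV4 using hV
  obtain ⟨u, hu, hu'⟩ := exists_indep T hV2 hV3 countable_empty
  have huE : ∀ i, u i ∈ E := fun i => hV1 i (hu i).1
  have huI : ∀ x ∈ E, I (u (I x)) = I x := fun x hx => hV4 _ x hx rfl _ (hu _).1
  set K : Set X := u '' {i | i < N} with hK
  have hKf : K.Finite := (finite_lt_nat N).image _
  have hKE : K ⊆ E := by rintro _ ⟨i, _, rfl⟩; exact huE i
  have hind : ∀ z : ℤ, z ≠ 0 → ∀ i j, it T z (u i) ≠ u j := by
    intro z hz i j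
    by_cases hij : i = j
    · subst hij; exact hT.aperiodic hz _
    · exact hu' i j hij z
  obtain ⟨O, hO, hKO, hOE, hw⟩ := exists_clopen_wander (T := T) hKf.isClosed hE.clopen hKE (J + H)
    (by
      rintro m h0 h1 _ ⟨i, hi, rfl⟩ ⟨j, hj, hij⟩
      exact hind m (by omega) i j hij.symm)
  have hRO : Rec T O := hT.recur hO ⟨u (I (Classical.arbitrary X)), hKO ⟨_, hN _, rfl⟩⟩
  have huO : ∀ i < N, u i ∈ O := fun i hi => hKO ⟨i, hi, rfl⟩
  have hEI : IsLocallyConstant fun x => (x ∈ E, I x) := (lc_mem hE.clopen).prodMk hI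
  have hcell : ∀ φ x y, (x ∈ E, I x) = (y ∈ E, I y) → cellFun E I φ x = cellFun E I φ y := by
    intro φ x y h
    rw [Prod.mk.injEq] at h
    simp only [cellFun, ind_apply, h.1, h.2]
  have hQ : ∀ i, ∃ Q : Set X, IsOpen Q ∧ Q.Nonempty ∧ (i < N → ∀ y ∈ Q, y ∈ O ∧ I y = I (u i) ∧
      word T O (fun x => (x ∈ E, I x)) y = word T O (fun x => (x ∈ E, I x)) (u i)) := by
    intro i
    by_cases hi : i < N
    · exact ⟨O ∩ ({y | I y = I (u i)} ∩ {y | word T O (fun x => (x ∈ E, I x)) y =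
        word T O (fun x => (x ∈ E, I x)) (u i)}), (hO.inter ((hI.isClopen_fiber _).inter
        ((hRO.lc_word hEI).isClopen_fiber _))).isOpen, ⟨u i, huO i hi, rfl, rfl⟩, fun _ y hy => hy⟩
    · exact ⟨univ, isOpen_univ, univ_nonempty, fun h => absurd h hi⟩
  choose Q hQ1 hQ2 hQ3 using hQ
  obtain ⟨y, hy, -⟩ := exists_indep T hQ1 hQ2 (Z := ⋃ j : ℕ, range fun z : ℤ => it T z (u j))
    (countable_iUnion fun j => countable_range _)
  have hyu : ∀ (z z' : ℤ) i j, it T z (y i) ≠ it T z' (u j) := by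
    intro z z' i j h
    refine (hy i).2 (mem_iUnion.2 ⟨j, z' - z, ?_⟩)
    exact (it_eq_iff.1 h).symm
  set F : Set X := y '' {i | i < N} ∪ ((fun i => it T (ret T O (u i)) (u i)) '' {i | i < N} ∪
    (fun i => it T (ret T O (y i)) (y i)) '' {i | i < N}) with hF
  have hFf : F.Finite := ((finite_lt_nat N).image _).union (((finite_lt_nat N).image _).union
    ((finite_lt_nat N).image _))
  have hKF : K ⊆ O ∩ Fᶜ := by
    rintro _ ⟨i, hi, rfl⟩
    refine ⟨huO i hi, ?_⟩
    rintro (⟨j, hj, h⟩ | ⟨j, hj, h⟩ | ⟨j, hj, h⟩)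
    · refine hyu 0 0 j i ?_
      rw [it_zero, it_zero, h]
    · have := hRO.ret_pos (u j)
      exact hind _ (by omega) _ _ h
    · refine hyu _ 0 j i (h.trans (it_zero _).symm)
  obtain ⟨M, hM, hKM, hMO⟩ := exists_clopen_of_closed_subset_open hKf.isClosed
    (hO.isOpen.inter hFf.isClosed.isOpen_compl) hKF
  have hMO' : M ⊆ O := fun x hx => (hMO hx).1
  have hME : M ⊆ E := hMO'.trans hOE
  have hMy : ∀ i < N, y i ∉ M := fun i hi h => (hMO h).2 (Or.inl ⟨i, hi, rfl⟩)
  have hMu : ∀ i < N, it T (ret T O (u i)) (u i) ∉ M := fun i hi h =>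
    (hMO h).2 (Or.inr (Or.inl ⟨i, hi, rfl⟩))
  have hMy' : ∀ i < N, it T (ret T O (y i)) (y i) ∉ M := fun i hi h =>
    (hMO h).2 (Or.inr (Or.inr ⟨i, hi, rfl⟩))
  have huM : ∀ i < N, u i ∈ M := fun i hi => hKM ⟨i, hi, rfl⟩
  set E' : Set X := (O \ M) ∪ {x | ∃ o ∈ M, it T (ret T E o) o = x} with hE'
  have hE'c : IsClopen E' := (hO.diff hM).union (hE.image_ret_clopen hME hM)
  have hE'E : E' ⊆ E := by
    rintro x (hx | ⟨o, ho, rfl⟩)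
    · exact hOE hx.1
    · exact hE.ret_mem o
  have hyE' : ∀ i < N, y i ∈ E' := fun i hi => Or.inl ⟨(hQ3 i hi _ (hy i).1).1, hMy i hi⟩
  have hRE' : Rec T E' := hT.recur hE'c ⟨_, hyE' (I (Classical.arbitrary X)) (hN _)⟩
  have hwz : ∀ o ∈ O, ∀ o' ∈ O, ∀ d : ℤ, o' = it T d o → |d| ≤ J + H → d = 0 := by
    rintro o ho _ ho' d rfl hd
    rw [abs_le] at hd
    rcases lt_trichotomy d 0 with h | h | h
    · refine absurd ?_ (hw d.natAbs (by omega) (by omega) _ ho')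
      rw [← it_add, show (d.natAbs : ℤ) + d = 0 by omega, it_zero]
      exact ho
    · exact h
    · refine absurd ho' ?_
      have := hw d.natAbs (by omega) (by omega) _ ho
      rwa [show (d.natAbs : ℤ) = d by omega] at this
  have hrep : ∀ x ∈ E', ∃ o ∈ O, ∃ a : ℕ, x = it T a o ∧ a ≤ H ∧
      ((a = 0 ∧ o ∉ M) ∨ (a = ret T E o ∧ o ∈ M)) := by
    rintro x (hx | ⟨o, ho, rfl⟩)
    · exact ⟨x, hx.1, 0, by rw [Nat.cast_zero, it_zero], Nat.zero_le _, Or.inl ⟨rfl, hx.2⟩⟩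
    · exact ⟨o, hMO' ho, _, rfl, hH o, Or.inr ⟨rfl, ho⟩⟩
  have hmid : ∀ z ∈ O, ∀ l : ℕ, 0 < l → l < ret T O z → it T l z ∈ E' → z ∈ M ∧ l = ret T E z := by
    rintro z hz l h0 hl (hx | ⟨o, ho, h⟩)
    · exact absurd hx.1 (hRO.not_mem_of_lt_ret h0 hl)
    · have h' := it_eq_iff.1 h
      rcases lt_trichotomy l (ret T E o) with hlt | heq | hgt
      · have h2 : it T (ret T E o - l : ℕ) o = z := by
          rw [it_eq_iff.1 h.symm]; congr 2; omega
        exact absurd (by rw [h2]; exact hOE hz)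
          (hE.not_mem_of_lt_ret (x := o) (j := ret T E o - l) (by omega) (by omega))
      · rw [← heq, sub_self, it_zero] at h'
        subst h'
        exact ⟨ho, heq⟩
      · rw [show (l : ℤ) - ret T E o = (l - ret T E o : ℕ) by omega] at h'
        have h1 := hRO.not_mem_of_lt_ret (x := z) (j := l - ret T E o)
          (by omega) (by omega)
        rw [← h'] at h1
        exact absurd (hMO' ho) h1
  refine ⟨E', hE'E, hRE', ?_, ?_, ?_⟩
  · intro x hx j h0 hj hx'
    obtain ⟨o, ho, a, rfl, ha, hc⟩ := hrep x hx
    obtain ⟨o', ho', a', h', ha', hc'⟩ := hrep _ hx'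
    rw [← it_add] at h'
    have h1 := it_eq_iff.1 h'.symm
    have hd := hwz o ho o' ho' _ h1 (by rw [abs_le]; omega)
    rw [hd, it_zero] at h1
    subst h1
    rcases hc with ⟨rfl, hc⟩ | ⟨rfl, hc⟩
    · rcases hc' with ⟨rfl, hc'⟩ | ⟨rfl, hc'⟩
      · omega
      · exact hc hc'
    · rcases hc' with ⟨rfl, hc'⟩ | ⟨rfl, hc'⟩ <;> omega
  · intro x hx
    exact ⟨y (I x), hyE' _ (hN x), (hQ3 _ (hN x) _ (hy _).1).2.1.trans (huI x hx)⟩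
  · intro x hx
    set i := I x with hi
    have hiN : i < N := hN x
    have hui : I (u i) = i := huI x hx
    set a := ret T E (u i) with ha
    have ha0 : 0 < a := hE.ret_pos _
    have hxE' : it T a (u i) ∈ E' := Or.inr ⟨u i, huM i hiN, rfl⟩
    obtain ⟨hyO, hyI, hyw⟩ := hQ3 i hiN _ (hy i).1
    refine ⟨y i, hyE' i hiN, _, hxE', fun φ => ?_⟩
    have e1 : tr (base T E') (cellFun E I φ) (y i) = tr (base T O) (cellFun E I φ) (u i) := by
      rw [hRE'.tr_base' _ (hyE' i hiN) (hRO.ret_pos (y i)) (Or.inl ⟨hRO.ret_mem _, hMy' i hiN⟩)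
        (fun l h0 hl h => hMy i hiN (hmid _ hyO l h0 hl h).1), ← hRO.tr_base _ hyO]
      exact hRO.tr_eq_of_word hyO (huO i hiN) hyw (hcell φ)
    have hlt : a < ret T O (u i) := by
      refine lt_of_le_of_ne (not_lt.1 fun h => ?_) fun h => ?_
      · exact hE.not_mem_of_lt_ret (hRO.ret_pos _) h (hOE (hRO.ret_mem _))
      · refine hw a ha0 ((hH _).trans (Nat.le_add_left _ _)) _ (huO i hiN) ?_
        rw [h]; exact hRO.ret_mem _
    have e2 : tr (base T E') (cellFun E I φ) (it T a (u i)) =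
        ∑ l ∈ Finset.range (ret T O (u i) - a), cellFun E I φ (it T (a + l : ℕ) (u i)) := by
      have hs : ∀ l : ℕ, it T l (it T a (u i)) = it T (a + l : ℕ) (u i) := fun l => by
        rw [← it_add, Nat.cast_add, add_comm]
      rw [hRE'.tr_base' (n := ret T O (u i) - a) _ hxE' (by omega) (by
        rw [hs, Nat.add_sub_cancel' hlt.le]
        exact Or.inl ⟨hRO.ret_mem _, hMu i hiN⟩) (fun l h0 hl h => by
          rw [hs] at h
          have := (hmid _ (huO i hiN) (a + l) (by omega) (by omega) h).2
          omega)]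
      exact Finset.sum_congr rfl fun l _ => by rw [hs]
    have e3 : ∑ l ∈ Finset.range a, cellFun E I φ (it T l (u i)) = φ i := by
      rw [Finset.sum_eq_single_of_mem 0 (by simpa using ha0)]
      · simp [it_zero, cellFun, ind_apply, huE i, hui]
      · intro l hl hl0
        have := hE.not_mem_of_lt_ret (x := u i) (j := l) (by omega) (by simpa using hl)
        simp [cellFun, ind_apply, this]
    rw [e1, e2, hRO.tr_base _ (huO i hiN)]
    conv_lhs => rw [← Nat.add_sub_cancel' hlt.le, Finset.sum_range_add, e3, Nat.add_sub_cancel_left]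
    ring

end Sparse

/-- An increasing sequence of submodules over `B`, as produced by a sequence of towers. -/
structure Alg {C : Type} [AddCommGroup C] (e : C) (N B : Submodule ℤ C) (D : ℕ → Submodule ℤ C) :
    Prop where
  mono : Monotone D
  pure : ∀ k (d : ℤ) g, d ≠ 0 → d • g ∈ D k → g ∈ D k
  fg : ∀ k, ∃ S : Set C, S.Finite ∧ D k ≤ B ⊔ Submodule.span ℤ S
  ab : ∀ k n, ∃ ι : Fin n → C, (∀ j, ι j ∈ N ∧ ∃ l, ι j ∈ D l) ∧ ∀ p ∈ D k, ∀ (a : Fin n → ℤ) (d : ℤ) g,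
    p + ∑ j, a j • ι j - d • g ∈ B → ∀ j, d ∣ a j
  zero : ∀ f ∈ D 0, ∃ c : ℤ, f - c • e ∈ B
  e_mem : e ∈ D 0
  e_ne : ∀ c : ℤ, c • e ∈ B → c = 0
  B_le : B ≤ N
  B_le_D : B ≤ D 0

section Sys

variable {X : Type} [TopologicalSpace X] [CompactSpace X] [T2Space X] [TotallyDisconnectedSpace X]
  [PerfectSpace X]
variable {T : X ≃ₜ X}

/-- A refining sequence of towers. -/
structure Sys (T : X ≃ₜ X) (V : ℕ → Set X) (E : ℕ → Set X) (I : ℕ → X → ℕ) (U : ℕ → ℕ → Set X) :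
    Prop where
  recu : ∀ k, Rec T (E k)
  lcI : ∀ k, IsLocallyConstant (I k)
  U_clopen : ∀ k j, IsClopen (U k j)
  E_zero : E 0 = univ
  I_zero : ∀ x, I 0 x = 0
  anti : ∀ k, E (k + 1) ⊆ E k
  sparse : ∀ k, ∀ x ∈ E (k + 1), ∀ j : ℕ, 0 < j → j ≤ k + 1 → it T j x ∉ E (k + 1)
  refines : ∀ k x y, I (k + 1) x = I (k + 1) y → (∀ i < k, (x ∈ V i ↔ y ∈ V i)) ∧ I k x = I k y
  split : ∀ k, ∀ x ∈ E k, ∃ y ∈ E (k + 1), ∃ y' ∈ E (k + 1), I k y = I k x ∧ I k y' = I k x ∧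
    I (k + 1) y ≠ I (k + 1) y'
  span : ∀ k, ∀ x ∈ E k, ∃ y ∈ E (k + 1), ∃ y' ∈ E (k + 1), ∀ φ,
    tr (base T (E (k + 1))) (cellFun (E k) (I k) φ) y -
      tr (base T (E (k + 1))) (cellFun (E k) (I k) φ) y' = φ (I k x)
  adapt : ∀ k (f : X → ℤ), ((∀ x y, (∀ i < k, (x ∈ V i ↔ y ∈ V i)) → f x = f y) ∨
    (∃ φ, f = cellFun (E k) (I k) φ) ∨ ∃ j < k, f = cob T (U k j)) →
    ∀ z ∈ E (k + 1), ∀ w ∈ E (k + 1), I (k + 1) z = I (k + 1) w →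
          tr (base T (E (k + 1))) f z = tr (base T (E (k + 1))) f w
  ab : ∀ k, ∃ x : ℕ → X, (∀ i, x i ∈ E (k + 1)) ∧
        (∀ φ i, tr (base T (E (k + 1))) (cellFun (E k) (I k) φ) (x i) =
          tr (base T (E (k + 1))) (cellFun (E k) (I k) φ) (x k)) ∧
        ∀ j < k, ∀ i ≤ k, tr (base T (E (k + 1))) (cob T (U k j)) (x i) = if i = j then 1 else 0

theorem exists_sys [Nonempty X] (hT : Minimal' T) {V : ℕ → Set X} (hV : EnumClopen V) :
    ∃ E I U, Sys T V E I U := by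
  let S := {p : Set X × (X → ℕ) // Rec T p.1 ∧ IsLocallyConstant p.2}
  have step : ∀ (k : ℕ) (s : S), ∃ (t : S) (U : ℕ → Set X), (∀ j, IsClopen (U j)) ∧
      t.1.1 ⊆ s.1.1 ∧ (∀ x ∈ t.1.1, ∀ j : ℕ, 0 < j → j ≤ k + 1 → it T j x ∉ t.1.1) ∧
      (∀ x y, t.1.2 x = t.1.2 y → (∀ i < k, (x ∈ V i ↔ y ∈ V i)) ∧ s.1.2 x = s.1.2 y) ∧
      (∀ x ∈ s.1.1, ∃ y ∈ t.1.1, ∃ y' ∈ t.1.1, s.1.2 y = s.1.2 x ∧ s.1.2 y' = s.1.2 x ∧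
        t.1.2 y ≠ t.1.2 y') ∧
      (∀ x ∈ s.1.1, ∃ y ∈ t.1.1, ∃ y' ∈ t.1.1, ∀ φ, tr (base T t.1.1) (cellFun s.1.1 s.1.2 φ) y -
        tr (base T t.1.1) (cellFun s.1.1 s.1.2 φ) y' = φ (s.1.2 x)) ∧
      (∀ (f : X → ℤ), ((∀ x y, (∀ i < k, (x ∈ V i ↔ y ∈ V i)) → f x = f y) ∨
        (∃ φ, f = cellFun s.1.1 s.1.2 φ) ∨ ∃ j < k, f = cob T (U j)) →
        ∀ z ∈ t.1.1, ∀ w ∈ t.1.1, t.1.2 z = t.1.2 w →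
          tr (base T t.1.1) f z = tr (base T t.1.1) f w) ∧
      ∃ x : ℕ → X, (∀ i, x i ∈ t.1.1) ∧
        (∀ φ i, tr (base T t.1.1) (cellFun s.1.1 s.1.2 φ) (x i) =
          tr (base T t.1.1) (cellFun s.1.1 s.1.2 φ) (x k)) ∧
        ∀ j < k, ∀ i ≤ k, tr (base T t.1.1) (cob T (U j)) (x i) = if i = j then 1 else 0 := by
    rintro k ⟨⟨E, I⟩, hE, hI⟩
    obtain ⟨E', h1, h2, h3, h4, h5⟩ := exists_sparse hT hE hI (k + 1)
    have hA : IsLocallyConstant fun x => (List.range k).map fun i => x ∈ V i :=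
      lc_list_map _ _ fun i _ => lc_mem (hV.1 i)
    obtain ⟨I', U, g1, g2, g0, g3, g4, g5⟩ := exists_label hT hE hI hA k h2 h4
    refine ⟨⟨(E', I'), h2, g1⟩, U, g2, h1, h3, fun x y h => ⟨fun i hi => iff_of_eq
      (List.map_inj_left.1 (g0 x y h).1 i (List.mem_range.2 hi)), (g0 x y h).2⟩,
      g3, h5, fun f hf => g4 f ?_, g5⟩
    refine hf.imp_left fun hf => ?_
    have : Function.FactorsThrough f fun x => (List.range k).map fun i => x ∈ V i := by
      intro x y hxy
      refine hf x y fun i hi => iff_of_eq ?_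
      exact List.map_inj_left.1 hxy i (List.mem_range.2 hi)
    exact ⟨_, funext fun x => (this.extend_apply 0 x).symm⟩
  choose F U hF using step
  have s₀ : Rec T (univ : Set X) := hT.recur isClopen_univ univ_nonempty
  let σ : ℕ → S := fun n => Nat.rec ⟨(univ, fun _ => 0), s₀, IsLocallyConstant.const 0⟩
    (fun n s => F n s) n
  have hσ : ∀ n, σ (n + 1) = F n (σ n) := fun n => rfl
  refine ⟨fun k => (σ k).1.1, fun k => (σ k).1.2, fun k => U k (σ k), fun k => (σ k).2.1,
    fun k => (σ k).2.2, fun k => (hF k (σ k)).1, rfl, fun _ => rfl, ?_, ?_, ?_, ?_, ?_, ?_, ?_⟩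
  · intro k; exact (hF k (σ k)).2.1
  · intro k; exact (hF k (σ k)).2.2.1
  · intro k; exact (hF k (σ k)).2.2.2.1
  · intro k; exact (hF k (σ k)).2.2.2.2.1
  · intro k; exact (hF k (σ k)).2.2.2.2.2.1
  · intro k; exact (hF k (σ k)).2.2.2.2.2.2.1
  · intro k; exact (hF k (σ k)).2.2.2.2.2.2.2

theorem lc_depends {V : ℕ → Set X} (hV : EnumClopen V) {f : X → ℤ} (hf : IsLocallyConstant f) :
    ∃ k, ∀ x y, (∀ i < k, (x ∈ V i ↔ y ∈ V i)) → f x = f y := by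
  choose n hn using fun v : ℤ => hV.2 _ (hf.isClopen_fiber v)
  obtain ⟨b, hb⟩ := (hf.range_finite.image n).bddAbove
  refine ⟨b + 1, fun x y h => ?_⟩
  have := (h (n (f x)) (Nat.lt_succ_of_le (hb ⟨f x, ⟨x, rfl⟩, rfl⟩))).1 (by rw [hn]; rfl)
  rw [hn] at this
  exact this.symm

theorem Rec.tr_cell {E : Set X} (h : Rec T E) (I : X → ℕ) (φ : ℕ → ℤ) {z : X} (hz : z ∈ E) :
    tr (base T E) (cellFun E I φ) z = φ (I z) := by
  classical
  rw [h.tr_base _ hz, Finset.sum_eq_single_of_mem 0 (by simpa using h.ret_pos z)]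
  · simp [it_zero, cellFun, ind_apply, hz]
  · intro l hl hl0
    have := h.not_mem_of_lt_ret (x := z) (j := l) (by omega) (by simpa using hl)
    simp [cellFun, ind_apply, this]

theorem Rec.tr_eq_zero {E : Set X} (h : Rec T E) {f : X → ℤ} (hf : ∀ z ∈ E, tr (base T E) f z = 0)
    (x : X) : tr (base T E) f x = 0 := by
  rw [← hf _ (h.base_mem x)]
  exact tr_congr_ret f (h.base_self (h.base_mem x)).symm

theorem Rec.exists_cellFun {E : Set X} (h : Rec T E) {I : X → ℕ} {f : X → ℤ}
    (hf : ∀ z ∈ E, ∀ w ∈ E, I z = I w → tr (base T E) f z = tr (base T E) f w) :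
    ∃ φ, ∀ x, tr (base T E) (f - cellFun E I φ) x = 0 := by
  classical
  refine ⟨fun i => if h : ∃ z ∈ E, I z = i then tr (base T E) f h.choose else 0,
    h.tr_eq_zero fun z hz => ?_⟩
  have hex : ∃ w ∈ E, I w = I z := ⟨z, hz, rfl⟩
  rw [tr_sub h.fr, h.tr_cell _ _ hz, dif_pos hex, sub_eq_zero]
  exact hf _ hz _ hex.choose_spec.1 hex.choose_spec.2.symm

theorem lc_cellFun {E : Set X} (hE : IsClopen E) {I : X → ℕ} (hI : IsLocallyConstant I)
    (φ : ℕ → ℤ) : IsLocallyConstant (cellFun E I φ) :=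
  (lc_ind hE).comp₂ hI fun a b => a * φ b

theorem lc_cob {U : Set X} (hU : IsClopen U) (T : X ≃ₜ X) : IsLocallyConstant (cob T U) :=
  (lc_ind hU).comp₂ (lc_comp (lc_ind hU) T.continuous) fun a b => a - b

/-- The locally constant integer functions. -/
def lcSub (X : Type) [TopologicalSpace X] : Submodule ℤ (X → ℤ) where
  carrier := {f | IsLocallyConstant f}
  add_mem' := fun hf hg => hf.comp₂ hg (· + ·)
  zero_mem' := IsLocallyConstant.const 0
  smul_mem' := fun c _ hf => hf.comp (c * ·)

theorem null_smul {r : ℕ → X → X} (hr : RS r) (c : ℤ) {f : X → ℤ} (hf : Null r f) :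
    Null r (c • f) := by
  obtain ⟨k, hk⟩ := hf
  exact ⟨k, fun x => by rw [tr_zsmul (hr.fr k), hk, mul_zero]⟩

/-- The locally constant functions with eventually vanishing traces. -/
def nullSub {r : ℕ → X → X} (hr : RS r) : Submodule ℤ (X → ℤ) where
  carrier := {f | IsLocallyConstant f ∧ Null r f}
  add_mem' := fun hf hg => ⟨(lcSub X).add_mem hf.1 hg.1, hr.null_add hf.2 hg.2⟩
  zero_mem' := ⟨(lcSub X).zero_mem, hr.null_zero⟩
  smul_mem' := fun c _ hf => ⟨(lcSub X).smul_mem c hf.1, null_smul hr c hf.2⟩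

end Sys

section Sys

variable {X : Type} [TopologicalSpace X] [CompactSpace X] [T2Space X] [TotallyDisconnectedSpace X]
  [PerfectSpace X]
variable {T : X ≃ₜ X} {V : ℕ → Set X} {E : ℕ → Set X} {I : ℕ → X → ℕ} {U : ℕ → ℕ → Set X}

theorem cellFun_add (E : Set X) (I : X → ℕ) (φ ψ : ℕ → ℤ) :
    cellFun E I (φ + ψ) = cellFun E I φ + cellFun E I ψ := by
  ext x; simp [cellFun, mul_add]

theorem cellFun_smul (E : Set X) (I : X → ℕ) (c : ℤ) (φ : ℕ → ℤ) :
    cellFun E I (c • φ) = c • cellFun E I φ := by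
  ext x; simp only [cellFun, Pi.smul_apply, smul_eq_mul]; ring

theorem tr_one_pos {r : X → X} (hr : FR r) (x : X) : 0 < tr r (1 : X → ℤ) x := by
  have h1 : (1 : X → ℤ) = ind univ := by ext; simp [ind_apply]
  rw [h1, tr_ind hr]
  have hf : {y | y ∈ univ ∧ r y = r x}.Finite := (hr.fin x).subset fun y hy => hy.2
  exact_mod_cast (ncard_pos hf).2 ⟨x, mem_univ x, rfl⟩

namespace Sys

variable (s : Sys T V E I U)
include s

theorem rs : RS fun k => base T (E k) :=
  ⟨fun k => (s.recu k).fr, fun k x y h => by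
    change base T (E k) x = base T (E k) y at h
    rw [← (s.recu k).base_base (s.recu (k + 1)) (s.anti k) x, h,
      (s.recu k).base_base (s.recu (k + 1)) (s.anti k) y]⟩

theorem adapt_cell (k : ℕ) (φ : ℕ → ℤ) : ∃ φ', ∀ x, tr (base T (E (k + 1)))
    (cellFun (E k) (I k) φ - cellFun (E (k + 1)) (I (k + 1)) φ') x = 0 :=
  (s.recu (k + 1)).exists_cellFun (s.adapt k _ (Or.inr (Or.inl ⟨φ, rfl⟩)))

theorem down (n : ℕ) : ∀ k (φ : ℕ → ℤ) (d : ℤ),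
    (∀ x, d ∣ tr (base T (E (k + n))) (cellFun (E k) (I k) φ) x) → ∀ x ∈ E k, d ∣ φ (I k x) := by
  induction n with
  | zero =>
    intro k φ d h x hx
    rw [← (s.recu k).tr_cell (I k) φ hx]
    exact h x
  | succ n ih =>
    intro k φ d h x hx
    obtain ⟨φ', hφ'⟩ := s.adapt_cell k φ
    have h1 : ∀ x, d ∣ tr (base T (E (k + 1 + n))) (cellFun (E (k + 1)) (I (k + 1)) φ') x := by
      intro x
      have h0 := tr_dom_zero (s.rs.fr (k + 1)) (s.rs.fr (k + 1 + n))
        (s.rs.mono (Nat.le_add_right _ _)) hφ' x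
      rw [tr_sub (s.rs.fr _), sub_eq_zero] at h0
      rw [← h0, show k + 1 + n = k + (n + 1) by omega]
      exact h x
    have h2 := ih (k + 1) φ' d h1
    have val : ∀ z ∈ E (k + 1), tr (base T (E (k + 1))) (cellFun (E k) (I k) φ) z =
        φ' (I (k + 1) z) := by
      intro z hz
      have := hφ' z
      rwa [tr_sub (s.recu (k + 1)).fr, (s.recu (k + 1)).tr_cell _ _ hz, sub_eq_zero] at this
    obtain ⟨y, hy, y', hy', hs⟩ := s.span k x hx
    rw [← hs φ, val y hy, val y' hy']
    exact dvd_sub (h2 y hy) (h2 y' hy')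

theorem dvd_of_null {k : ℕ} {φ : ℕ → ℤ} {d : ℤ} {g : X → ℤ}
    (h : Null (fun k => base T (E k)) (d • g - cellFun (E k) (I k) φ)) {x : X} (hx : x ∈ E k) :
    d ∣ φ (I k x) := by
  obtain ⟨m, hm, h0⟩ := (s.rs.null_iff _ k).1 h
  obtain ⟨n, rfl⟩ := Nat.exists_eq_add_of_le hm
  refine s.down n k φ d (fun x => ?_) x hx
  have := h0 x
  rw [tr_sub (s.rs.fr _), tr_zsmul (s.rs.fr _), sub_eq_zero] at this
  rw [← this]
  exact dvd_mul_right _ _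

/-- The functions that are eventually equivalent to a function on the cells of the `k`-th tower. -/
def cellSub (k : ℕ) : Submodule ℤ (X → ℤ) where
  carrier := {f | IsLocallyConstant f ∧
    ∃ φ, Null (fun k => base T (E k)) (f - cellFun (E k) (I k) φ)}
  add_mem' := by
    rintro f g ⟨hf, φ, h⟩ ⟨hg, ψ, h'⟩
    refine ⟨(lcSub X).add_mem hf hg, φ + ψ, ?_⟩
    rw [cellFun_add, add_sub_add_comm]
    exact s.rs.null_add h h'
  zero_mem' := ⟨(lcSub X).zero_mem, 0, by
    have : cellFun (E k) (I k) 0 = 0 := by ext x; simp [cellFun]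
    rw [this, sub_zero]; exact s.rs.null_zero⟩
  smul_mem' := by
    rintro c f ⟨hf, φ, h⟩
    refine ⟨(lcSub X).smul_mem c hf, c • φ, ?_⟩
    rw [cellFun_smul, ← smul_sub]
    exact null_smul s.rs c h

theorem exists_mem_cellSub (hV : EnumClopen V) {f : X → ℤ} (hf : IsLocallyConstant f) :
    ∃ k, f ∈ s.cellSub k := by
  obtain ⟨k, hk⟩ := lc_depends hV hf
  obtain ⟨φ, hφ⟩ := (s.recu (k + 1)).exists_cellFun (s.adapt k f (Or.inl hk))
  exact ⟨k + 1, hf, φ, k + 1, hφ⟩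

theorem cellSub_mono : Monotone s.cellSub := by
  refine monotone_nat_of_le_succ fun k => ?_
  rintro f ⟨hf, φ, h⟩
  obtain ⟨φ', h'⟩ := s.adapt_cell k φ
  refine ⟨hf, φ', ?_⟩
  have := s.rs.null_add h ⟨k + 1, h'⟩
  rwa [sub_add_sub_cancel] at this

theorem alg (hV : EnumClopen V) {N : Submodule ℤ (X → ℤ)} (hN : ∀ A, IsClopen A → cob T A ∈ N)
    (hB : nullSub s.rs ≤ N) [Nonempty X] : Alg (1 : X → ℤ) N (nullSub s.rs) s.cellSub := by
  refine ⟨s.cellSub_mono, ?_, ?_, ?_, ?_, ?_, ?_, hB, ?_⟩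
  · rintro k d g hd ⟨hg, φ, h⟩
    have hdv : ∀ x ∈ E k, d ∣ φ (I k x) := fun x hx => s.dvd_of_null h hx
    have he : cellFun (E k) (I k) φ = d • cellFun (E k) (I k) (fun i => φ i / d) := by
      ext x
      by_cases hx : x ∈ E k
      · simp [cellFun, ind_apply, hx, Int.mul_ediv_cancel' (hdv x hx)]
      · simp [cellFun, ind_apply, hx]
    refine ⟨lc_map hg fun x y hxy => mul_left_cancel₀ hd hxy, fun i => φ i / d, ?_⟩
    rw [he, ← smul_sub] at h
    obtain ⟨m, hm⟩ := h
    refine ⟨m, fun x => ?_⟩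
    have := hm x
    rw [tr_zsmul (s.rs.fr m)] at this
    exact (mul_eq_zero.1 this).resolve_left hd
  · intro k
    obtain ⟨b, hb⟩ := (s.lcI k).range_finite.bddAbove
    refine ⟨(fun i => cellFun (E k) (I k) (Pi.single i 1)) '' (Finset.range (b + 1) : Set ℕ),
      (Finset.finite_toSet _).image _, ?_⟩
    rintro f ⟨hf, φ, h⟩
    have hc := lc_cellFun (s.recu k).clopen (s.lcI k) φ
    rw [← sub_add_cancel f (cellFun (E k) (I k) φ)]
    refine Submodule.add_mem_sup ⟨(lcSub X).sub_mem hf hc, h⟩ ?_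
    have : cellFun (E k) (I k) φ =
        ∑ i ∈ Finset.range (b + 1), φ i • cellFun (E k) (I k) (Pi.single i 1) := by
      ext x
      have hI : I k x ∈ Finset.range (b + 1) :=
        Finset.mem_range.2 (Nat.lt_succ_of_le (hb (mem_range_self x)))
      rw [Finset.sum_apply, Finset.sum_eq_single_of_mem _ hI]
      · simp [cellFun, mul_comm]
      · intro i _ hi
        simp [cellFun, hi.symm]
    rw [this]
    exact Submodule.sum_mem _ fun i hi =>
      Submodule.smul_mem _ _ (Submodule.subset_span ⟨i, hi, rfl⟩)
  · intro k n
    set m := max k n with hm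
    have hU : ∀ j, IsLocallyConstant (cob T (U m j)) := fun j => lc_cob (s.U_clopen m j) T
    refine ⟨fun j => cob T (U m j), fun j => ⟨hN _ (s.U_clopen m j),
      s.exists_mem_cellSub hV (hU j)⟩, fun p hp a d g h => ?_⟩
    obtain ⟨hpl, φ, hφ⟩ := s.cellSub_mono (le_max_left k n) hp
    set q := cellFun (E m) (I m) φ + ∑ j : Fin n, a j • cob T (U m j) with hq
    have hR := s.recu (m + 1)
    have htq : ∀ z, tr (base T (E (m + 1))) q z = tr (base T (E (m + 1))) (cellFun (E m) (I m) φ) z +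
        ∑ j : Fin n, a j * tr (base T (E (m + 1))) (cob T (U m j)) z := by
      intro z
      rw [hq, tr_add hR.fr, tr_sum hR.fr]
      simp only [tr_zsmul hR.fr]
    have hjm : ∀ j : Fin n, (j : ℕ) < m := fun j => j.2.trans_le (le_max_right k n)
    obtain ⟨ψ, hψ⟩ := hR.exists_cellFun (I := I (m + 1)) (f := q) (by
      intro z hz w hw hzw
      rw [htq, htq, s.adapt m _ (Or.inr (Or.inl ⟨φ, rfl⟩)) z hz w hw hzw]
      congr 1
      refine Finset.sum_congr rfl fun j _ => ?_
      rw [s.adapt m _ (Or.inr (Or.inr ⟨j, hjm j, rfl⟩)) z hz w hw hzw])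
    have hnull : Null (fun k => base T (E k)) (d • g - cellFun (E (m + 1)) (I (m + 1)) ψ) := by
      have h1 := s.rs.null_sub (s.rs.null_sub ⟨m + 1, hψ⟩ (s.rs.null_neg hφ)) h.2
      convert! h1 using 1
      rw [hq]; abel
    have hdv : ∀ z ∈ E (m + 1), d ∣ tr (base T (E (m + 1))) q z := by
      intro z hz
      have h1 := hψ z
      rw [tr_sub hR.fr, hR.tr_cell _ _ hz, sub_eq_zero] at h1
      rw [h1]
      exact s.dvd_of_null hnull hz
    obtain ⟨x, hx, hx1, hx2⟩ := s.ab m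
    intro i
    have key : tr (base T (E (m + 1))) q (x i) - tr (base T (E (m + 1))) q (x m) = a i := by
      rw [htq, htq, hx1 φ i]
      have e1 : ∑ j : Fin n, a j * tr (base T (E (m + 1))) (cob T (U m j)) (x i) = a i := by
        rw [Finset.sum_eq_single i]
        · rw [hx2 i (hjm i) i (hjm i).le]; simp
        · intro j _ hj
          rw [hx2 j (hjm j) i (hjm i).le, if_neg (fun h => hj (Fin.ext h.symm)), mul_zero]
        · simp
      have e2 : ∑ j : Fin n, a j * tr (base T (E (m + 1))) (cob T (U m j)) (x m) = 0 := by
        refine Finset.sum_eq_zero fun j _ => ?_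
        rw [hx2 j (hjm j) m le_rfl, if_neg (hjm j).ne', mul_zero]
      rw [e1, e2]; ring
    rw [← key]
    exact dvd_sub (hdv _ (hx i)) (hdv _ (hx m))
  · rintro f ⟨hf, φ, h⟩
    have : cellFun (E 0) (I 0) φ = φ 0 • 1 := by
      ext x; simp [cellFun, ind_apply, s.E_zero, s.I_zero]
    rw [this] at h
    exact ⟨φ 0, (lcSub X).sub_mem hf ((lcSub X).smul_mem (φ 0)
      (show (1 : X → ℤ) ∈ lcSub X from IsLocallyConstant.const 1)), h⟩
  · refine ⟨IsLocallyConstant.const 1, 1, ?_⟩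
    have : cellFun (E 0) (I 0) 1 = 1 := by
      ext x; simp [cellFun, ind_apply, s.E_zero]
    rw [this, sub_self]
    exact s.rs.null_zero
  · rintro c ⟨-, k, hk⟩
    obtain ⟨x⟩ := ‹Nonempty X›
    have := hk x
    rw [tr_zsmul (s.rs.fr k)] at this
    exact (mul_eq_zero.1 this).resolve_right (tr_one_pos (s.rs.fr k) x).ne'
  · rintro f ⟨hf, h⟩
    refine ⟨hf, 0, ?_⟩
    have : cellFun (E 0) (I 0) 0 = 0 := by ext x; simp [cellFun]
    rwa [this, sub_zero]

end Sys
end Sys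

section Core

variable {X : Type} [TopologicalSpace X] [CompactSpace X] [T2Space X] [TotallyDisconnectedSpace X]
  [PerfectSpace X]
variable {T : X ≃ₜ X} {V : ℕ → Set X} {E : ℕ → Set X} {I : ℕ → X → ℕ} {U : ℕ → ℕ → Set X}

/-- The intersection of the bases of a sequence of towers. -/
def core (E : ℕ → Set X) : Set X := ⋂ k, E k

namespace Sys

variable (s : Sys T V E I U)
include s

theorem antitone : Antitone E := antitone_nat_of_succ_le s.anti

theorem isClosed_core : IsClosed (core E) := isClosed_iInter fun k => (s.recu k).clopen.isClosed

theorem exists_core {m : ℕ} {y : X} (hy : y ∈ E m) : ∃ c ∈ core E, I m c = I m y := by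
  have step : ∀ n, ∀ z : E (m + n), ∃ z' : E (m + n + 1), I (m + n) z' = I (m + n) z := by
    rintro n ⟨z, hz⟩
    obtain ⟨z', hz', -, -, h, -⟩ := s.split _ z hz
    exact ⟨⟨z', hz'⟩, h⟩
  choose F hF using step
  let y' : ∀ n, E (m + n) := fun n => Nat.rec ⟨y, hy⟩ (fun n z => F n z) n
  have hy' : ∀ n, I (m + n) (y' (n + 1)).1 = I (m + n) (y' n).1 := fun n => hF n (y' n)
  have hc : ∀ n, IsClosed {z | z ∈ E (m + n) ∧ I (m + n) z = I (m + n) (y' n).1} := fun n =>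
    ((s.recu (m + n)).clopen.inter ((s.lcI (m + n)).isClopen_fiber _)).isClosed
  obtain ⟨c, hc⟩ := IsCompact.nonempty_iInter_of_sequence_nonempty_isCompact_isClosed
    (fun n => {z | z ∈ E (m + n) ∧ I (m + n) z = I (m + n) (y' n).1})
    (fun n z hz => ⟨s.anti _ hz.1, ((s.refines _ _ _ hz.2).2).trans (hy' n)⟩)
    (fun n => ⟨(y' n).1, (y' n).2, rfl⟩) (hc 0).isCompact hc
  rw [mem_iInter] at hc
  exact ⟨c, mem_iInter.2 fun k => s.antitone (Nat.le_add_left k m) (hc k).1, (hc 0).2⟩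

theorem core_nonempty [Nonempty X] : (core E).Nonempty := by
  obtain ⟨c, hc, -⟩ := s.exists_core ((s.recu 0).base_mem (Classical.arbitrary X))
  exact ⟨c, hc⟩

theorem core_perfect (hV : EnumClopen V) {x : X} (hx : x ∈ core E) {W : Set X} (hW : IsOpen W)
    (hxW : x ∈ W) : ∃ y ∈ core E, y ∈ W ∧ y ≠ x := by
  obtain ⟨A, hA, hxA, hAW⟩ := compact_exists_isClopen_in_isOpen hW hxW
  obtain ⟨i, rfl⟩ := hV.2 A hA
  obtain ⟨y, hy, y', hy', h1, h2, h3⟩ := s.split (i + 2) x (mem_iInter.1 hx _)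
  have key : ∀ z ∈ E (i + 3), I (i + 2) z = I (i + 2) x → I (i + 3) z ≠ I (i + 3) x →
      ∃ c ∈ core E, c ∈ W ∧ c ≠ x := by
    intro z hz hzx hne
    obtain ⟨c, hc, hcz⟩ := s.exists_core hz
    refine ⟨c, hc, hAW ?_, ?_⟩
    · have := (s.refines _ _ _ hcz).2.trans hzx
      exact ((s.refines _ _ _ this).1 i (by omega)).2 hxA
    · rintro rfl
      exact hne hcz.symm
  by_cases h : I (i + 3) y = I (i + 3) x
  · exact key y' hy' h2 fun h' => h3 (h.trans h'.symm)
  · exact key y hy h1 h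

theorem core_it {x : X} (hx : x ∈ core E) {j : ℤ} (hj : j ≠ 0) : it T j x ∉ core E := by
  have key : ∀ x ∈ core E, ∀ j : ℕ, 0 < j → it T j x ∉ core E := fun x hx j hj h =>
    s.sparse j x (mem_iInter.1 hx _) j hj (by omega) (mem_iInter.1 h _)
  intro h
  rcases lt_or_gt_of_ne hj with hj | hj
  · refine key _ h j.natAbs (by omega) ?_
    rw [← it_add, show (j.natAbs : ℤ) + j = 0 by omega, it_zero]
    exact hx
  · refine key x hx j.natAbs (by omega) ?_
    rwa [show (j.natAbs : ℤ) = j by omega]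

theorem base_orbit (k : ℕ) {x y : X} (h : base T (E k) x = base T (E k) y) : ∃ j : ℤ, y = it T j x := by
  rw [base, base, it_eq_iff] at h
  refine ⟨(bk T (E k) y : ℤ) - bk T (E k) x, ?_⟩
  have h2 := congrArg (it T ((bk T (E k) y : ℤ) - bk T (E k) x)) h
  rw [← it_add, show (bk T (E k) y : ℤ) - bk T (E k) x + (-(bk T (E k) y) - -(bk T (E k) x)) = 0 by omega,
    it_zero] at h2
  exact h2.symm

theorem related {x : X} (hx : T x ∉ core E) : ∃ k, base T (E k) (T x) = base T (E k) x := by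
  simp only [core, mem_iInter, not_forall] at hx
  obtain ⟨k, hk⟩ := hx
  exact ⟨k, (s.recu k).base_T hk⟩

theorem injOn (k : ℕ) : InjOn (base T (E k)) (core E ∪ T ⁻¹' core E) := by
  have top : ∀ x, T x ∈ core E → ∀ y, base T (E k) x = base T (E k) y → bk T (E k) y ≤ bk T (E k) x := by
    intro x hx y h
    by_contra hlt
    rw [not_le] at hlt
    have h1 := (s.recu k).bk_lt y
    refine (s.recu k).not_mem_of_lt_ret (x := base T (E k) y) (j := bk T (E k) x + 1) (by omega)
      (by omega) ?_
    rw [Nat.cast_add, add_comm, it_add, ← h, (s.recu k).it_bk_base, Nat.cast_one, it_one]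
    exact mem_iInter.1 hx k
  have bot : ∀ x, x ∈ core E → base T (E k) x = x := fun x hx =>
    (s.recu k).base_self (mem_iInter.1 hx k)
  have mixed : ∀ x ∈ core E, ∀ y, T y ∈ core E → base T (E k) x = base T (E k) y → x = y := by
    intro x hx y hy h
    obtain ⟨j, rfl⟩ := s.base_orbit k h
    by_cases hj : j + 1 = 0
    · rw [bot x hx, base, show j = -1 by omega, ← it_add] at h
      by_contra hne
      refine s.core_it hx (j := -((bk T (E k) (it T (-1) x) : ℤ)) + -1) (by omega) ?_
      rwa [← h]
    · rw [← it_one (it T j x), ← it_add] at hy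
      exact absurd hy (s.core_it hx (by omega))
  rintro x (hx | hx) y (hy | hy) h
  · rwa [bot x hx, bot y hy] at h
  · exact mixed x hx y hy h
  · exact (mixed y hy x hx h.symm).symm
  · have hb := le_antisymm (top y hy x h.symm) (top x hx y h)
    rw [← (s.recu k).it_bk_base x, ← (s.recu k).it_bk_base y, h, hb]

end Sys
end Core

section Measures

variable {X : Type} [TopologicalSpace X] [CompactSpace X] [T2Space X] [MeasurableSpace X]
  [BorelSpace X] [TotallyDisconnectedSpace X] [PerfectSpace X]
variable {T : X ≃ₜ X} {E : Set X}

/-- The invariant probability measures. -/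
def Inv (T : X ≃ₜ X) : Set (Measure X) := {μ | IsProbabilityMeasure μ ∧ μ.map T = μ}

theorem lc_real {f : X → ℤ} (hf : IsLocallyConstant f) : Continuous fun x => (f x : ℝ) :=
  (hf.comp (fun n : ℤ => (n : ℝ))).continuous

theorem lc_integrable {f : X → ℤ} (hf : IsLocallyConstant f) (μ : Measure X) [IsProbabilityMeasure μ] :
    Integrable (fun x => (f x : ℝ)) μ :=
  (lc_real hf).integrable_of_hasCompactSupport (HasCompactSupport.of_compactSpace _)

/-- The integral of an integer-valued function. -/
noncomputable def mint (μ : Measure X) (f : X → ℤ) : ℝ := ∫ x, (f x : ℝ) ∂μ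

section
variable {μ : Measure X} [IsProbabilityMeasure μ] {f g : X → ℤ}

theorem mint_add (hf : IsLocallyConstant f) (hg : IsLocallyConstant g) :
    mint μ (f + g) = mint μ f + mint μ g := by
  simp only [mint, Pi.add_apply, Int.cast_add]
  exact integral_add (lc_integrable hf μ) (lc_integrable hg μ)

theorem mint_sub (hf : IsLocallyConstant f) (hg : IsLocallyConstant g) :
    mint μ (f - g) = mint μ f - mint μ g := by
  simp only [mint, Pi.sub_apply, Int.cast_sub]
  exact integral_sub (lc_integrable hf μ) (lc_integrable hg μ)

theorem mint_smul (c : ℤ) : mint μ (c • f) = c * mint μ f := by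
  simp only [mint, Pi.smul_apply, smul_eq_mul, Int.cast_mul]
  exact integral_const_mul _ _

theorem mint_comp (hμ : μ.map T = μ) (hf : IsLocallyConstant f) : mint μ (fun x => f (T x)) = mint μ f := by
  have := integral_map (μ := μ) (φ := T) T.continuous.measurable.aemeasurable (f := fun x => (f x : ℝ))
    (lc_real hf).aestronglyMeasurable
  rw [hμ] at this
  exact this.symm

end

/-- The locally constant functions of zero integral for all measures in `M`. -/
noncomputable def nullInt (M : Set (Measure X)) : Submodule ℤ (X → ℤ) where
  carrier := {f | IsLocallyConstant f ∧ ∀ μ ∈ M, IsProbabilityMeasure μ → mint μ f = 0}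
  add_mem' := fun hf hg => ⟨(lcSub X).add_mem hf.1 hg.1, fun μ hμ _ => by
    rw [mint_add hf.1 hg.1, hf.2 μ hμ ‹_›, hg.2 μ hμ ‹_›, add_zero]⟩
  zero_mem' := ⟨(lcSub X).zero_mem, fun μ _ _ => by simp [mint]⟩
  smul_mem' := fun c f hf => ⟨(lcSub X).smul_mem c hf.1, fun μ hμ _ => by
    rw [mint_smul, hf.2 μ hμ ‹_›, mul_zero]⟩

theorem cob_mem_nullInt {A : Set X} (hA : IsClopen A) : cob T A ∈ nullInt (Inv T) := by
  refine ⟨lc_cob hA T, fun μ hμ _ => ?_⟩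
  have : cob T A = ind A - fun x => ind A (T x) := rfl
  rw [this, mint_sub (lc_ind hA) (lc_comp (lc_ind hA) T.continuous), mint_comp hμ.2 (lc_ind hA), sub_self]

theorem Rec.exists_transfer (h : Rec T E) {f : X → ℤ} (hf : IsLocallyConstant f)
    (h0 : ∀ x, tr (base T E) f x = 0) :
    ∃ G : X → ℤ, IsLocallyConstant G ∧ ∀ x, f x = G (T x) - G x := by
  refine ⟨fun x => ∑ j ∈ Finset.range (bk T E x), f (it T j (base T E x)), ?_, fun x => ?_⟩
  · refine (IsLocallyConstant.iff_eventually_eq _).2 fun x => ?_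
    have h1 : ∀ᶠ y in 𝓝 x, ∀ j ∈ Finset.range (bk T E x),
        f (it T j (base T E y)) = f (it T j (base T E x)) := by
      rw [Finset.eventually_all]
      intro j _
      exact (IsLocallyConstant.iff_eventually_eq _).1
        (lc_comp hf ((it_cont (T := T) j).comp h.fr.cont)) x
    filter_upwards [(IsLocallyConstant.iff_eventually_eq _).1 h.lc_bk x, h1] with y hy hy'
    rw [hy]
    exact Finset.sum_congr rfl hy'
  · by_cases hx : T x ∈ E
    · have hb : bk T E (T x) = 0 := h.bk_eq (by simpa [it_zero] using hx) (by simp)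
      have hr : ret T E (base T E x) = bk T E x + 1 := by
        have h1 := h.bk_lt x
        by_contra hne
        refine h.not_mem_of_lt_ret (x := base T E x) (j := bk T E x + 1) (by omega) (by omega) ?_
        rwa [Nat.cast_add, add_comm, it_add, h.it_bk_base, Nat.cast_one, it_one]
      have h2 := h0 (base T E x)
      rw [h.tr_base f (h.base_mem x), hr, Finset.sum_range_succ, h.it_bk_base] at h2
      simp only [hb, Finset.range_zero, Finset.sum_empty]
      linarith
    · have hb : bk T E (T x) = bk T E x + 1 := by
        refine h.bk_eq ?_ fun l hl => ?_
        · rw [← it_one x, ← it_add, show -((bk T E x + 1 : ℕ) : ℤ) + 1 = -(bk T E x) by omega]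
          exact h.base_mem x
        · rcases l with _ | l
          · simpa [it_zero] using hx
          · rw [← it_one x, ← it_add, show -((l + 1 : ℕ) : ℤ) + 1 = -l by omega]
            exact h.not_mem_of_lt (by omega)
      simp only [hb, h.base_T hx, Finset.sum_range_succ, h.it_bk_base]
      ring

theorem nullSub_le {V : ℕ → Set X} {E : ℕ → Set X} {I : ℕ → X → ℕ} {U : ℕ → ℕ → Set X}
    (s : Sys T V E I U) : nullSub s.rs ≤ nullInt (Inv T) := by
  rintro f ⟨hf, k, hk⟩
  obtain ⟨G, hG, hfG⟩ := (s.recu k).exists_transfer hf hk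
  refine ⟨hf, fun μ hμ _ => ?_⟩
  have : f = (fun x => G (T x)) - G := funext hfG
  rw [this, mint_sub (lc_comp hG T.continuous) hG, mint_comp hμ.2 hG, sub_self]

/-- Average over an orbit segment. -/
noncomputable def orbAvg (T : X ≃ₜ X) (n : ℕ) (x : X) : Measure X :=
  (n : ENNReal)⁻¹ • ∑ j ∈ Finset.range n, Measure.dirac (it T j x)

theorem isProbabilityMeasure_orbAvg {n : ℕ} (hn : 0 < n) (x : X) :
    IsProbabilityMeasure (orbAvg T n x) := by
  constructor
  simp only [orbAvg, Measure.smul_apply, Measure.finsetSum_apply, measure_univ, Finset.sum_const,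
    Finset.card_range, nsmul_eq_mul, mul_one, smul_eq_mul]
  exact ENNReal.inv_mul_cancel (by exact_mod_cast hn.ne') (by simp)

theorem integral_orbAvg {n : ℕ} {g : X → ℝ} (hg : Continuous g) (x : X) :
    ∫ y, g y ∂(orbAvg T n x) = (n : ℝ)⁻¹ * ∑ j ∈ Finset.range n, g (it T j x) := by
  rw [orbAvg, integral_smul_measure, integral_finsetSum_measure]
  · simp
  · intro i _
    exact integrable_dirac (by simp)

theorem exists_inv_limit [TopologicalSpace.MetrizableSpace X] {n : ℕ → ℕ} (hn : ∀ k, k < n k) (x : ℕ → X) :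
    ∃ μ ∈ Inv T, ∀ f : X → ℤ, IsLocallyConstant f →
      (∀ k, ∑ j ∈ Finset.range (n k), f (it T j (x k)) ≤ 0) → mint μ f ≤ 0 := by
  have hp : ∀ k, IsProbabilityMeasure (orbAvg T (n k) (x k)) := fun k =>
    isProbabilityMeasure_orbAvg (by have := hn k; omega) _
  let m : ℕ → ProbabilityMeasure X := fun k => ⟨orbAvg T (n k) (x k), hp k⟩
  let F : Ultrafilter ℕ := Ultrafilter.of atTop
  have hF : (F : Filter ℕ) ≤ atTop := Ultrafilter.of_le _
  obtain ⟨μ, -, hμ⟩ := isCompact_univ.ultrafilter_le_nhds (F.map m) (by simp)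
  have hlim : ∀ g : X → ℝ, Continuous g → Tendsto (fun k => (n k : ℝ)⁻¹ *
      ∑ j ∈ Finset.range (n k), g (it T j (x k))) F (𝓝 (∫ y, g y ∂(μ : Measure X))) := by
    intro g hg
    have h1 := (ProbabilityMeasure.tendsto_iff_forall_integral_tendsto (F := (F : Filter ℕ)) (μs := m)
      (μ := μ)).1 hμ (BoundedContinuousFunction.mkOfCompact ⟨g, hg⟩)
    refine h1.congr fun k => ?_
    exact integral_orbAvg hg _
  refine ⟨μ, ⟨inferInstance, ?_⟩, fun f hf h0 => ?_⟩
  · have : IsProbabilityMeasure ((μ : Measure X).map T) :=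
      Measure.isProbabilityMeasure_map T.continuous.measurable.aemeasurable
    refine ext_of_forall_integral_eq_of_IsFiniteMeasure fun g => ?_
    rw [integral_map T.continuous.measurable.aemeasurable g.continuous.aestronglyMeasurable]
    have h1 := (hlim _ (g.continuous.comp T.continuous)).sub (hlim _ g.continuous)
    rw [← sub_eq_zero]
    refine tendsto_nhds_unique h1 ?_
    have h2 : Tendsto (fun k : ℕ => (2 * ‖g‖) / (k : ℝ)) F (𝓝 0) :=
      (tendsto_const_div_atTop_nhds_zero_nat _).mono_left hF
    refine squeeze_zero_norm' ?_ h2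
    have hpos : ∀ᶠ k : ℕ in (F : Filter ℕ), 0 < k := hF (eventually_gt_atTop 0)
    filter_upwards [hpos] with k hk
    have h3 : ∀ j : ℕ, (g ∘ T) (it T j (x k)) = g (it T (j + 1 : ℕ) (x k)) := by
      intro j
      rw [Nat.cast_add, add_comm, it_add, Nat.cast_one, it_one]; rfl
    simp only [h3]
    rw [← mul_sub, ← Finset.sum_sub_distrib, Finset.sum_range_sub (fun j : ℕ => g (it T j (x k)))]
    rw [norm_mul, norm_inv, Real.norm_natCast, div_eq_inv_mul]
    have hkn : (k : ℝ) ≤ n k := by exact_mod_cast (hn k).le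
    have hk0 : (0 : ℝ) < k := by exact_mod_cast hk
    have h5 : ∀ y, ‖g y‖ ≤ ‖g‖ := g.norm_coe_le_norm
    have h4 : ‖g (it T (n k) (x k)) - g (it T (0 : ℕ) (x k))‖ ≤ 2 * ‖g‖ := by
      refine (norm_sub_le _ _).trans ?_
      rw [two_mul]
      exact add_le_add (h5 _) (h5 _)
    gcongr
  · refine le_of_tendsto (hlim _ (lc_real hf)) (Eventually.of_forall fun k => ?_)
    refine mul_nonpos_of_nonneg_of_nonpos (by positivity) ?_
    exact_mod_cast h0 k

variable [TopologicalSpace.MetrizableSpace X]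

theorem Sys.exists_tr_pos {V : ℕ → Set X} {E : ℕ → Set X} {I : ℕ → X → ℕ} {U : ℕ → ℕ → Set X}
    (s : Sys T V E I U) {f : X → ℤ} (hf : IsLocallyConstant f) (hpos : ∀ μ ∈ Inv T, 0 < mint μ f) :
    ∃ k, ∀ x, 0 < tr (base T (E k)) f x := by
  by_contra! hcon
  choose x hx using fun k => hcon (k + 1)
  have hn : ∀ k, k < ret T (E (k + 1)) (base T (E (k + 1)) (x k)) := by
    intro k
    by_contra hlt
    rw [not_lt] at hlt
    exact s.sparse k _ ((s.recu (k + 1)).base_mem (x k)) _ ((s.recu (k + 1)).ret_pos _) (by omega)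
      ((s.recu (k + 1)).ret_mem _)
  obtain ⟨μ, hμ, h⟩ := exists_inv_limit (T := T) hn (fun k => base T (E (k + 1)) (x k))
  refine absurd (hpos μ hμ) (not_lt.2 (h f hf fun k => ?_))
  rw [← (s.recu (k + 1)).tr_base f ((s.recu (k + 1)).base_mem (x k))]
  rw [tr_congr_ret f (s.rs.fr (k + 1) |>.idem (x k))]
  exact hx k

end Measures

section Algebra

variable {C : Type} [AddCommGroup C]

theorem exists_complement {P D : Submodule ℤ C} (hP : ∀ (d : ℤ) f, d ≠ 0 → d • f ∈ P → f ∈ P)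
    {S : Set C} (hS : S.Finite) (hD : D ≤ P ⊔ Submodule.span ℤ S) :
    ∃ (n : ℕ) (q : Fin n → C), (∀ i, q i ∈ D) ∧ (∀ f ∈ D, ∃ c : Fin n → ℤ, f - ∑ i, c i • q i ∈ P) ∧
      ∀ c : Fin n → ℤ, ∑ i, c i • q i ∈ P → c = 0 := by
  have htf : Module.IsTorsionFree ℤ (C ⧸ P) := by
    refine .of_smul_eq_zero fun d m h => ?_
    obtain ⟨f, rfl⟩ := P.mkQ_surjective m
    by_cases hd : d = 0
    · exact Or.inl hd
    · right
      rw [← map_smul, Submodule.mkQ_apply, Submodule.Quotient.mk_eq_zero] at h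
      rw [Submodule.mkQ_apply, Submodule.Quotient.mk_eq_zero]
      exact hP d f hd h
  set R := D.map P.mkQ with hR
  have hRS : R ≤ Submodule.span ℤ (P.mkQ '' S) := by
    rw [hR, Submodule.map_le_iff_le_comap]
    refine hD.trans (sup_le ?_ ?_)
    · intro f hf
      have : P.mkQ f = 0 := by simpa using hf
      rw [Submodule.mem_comap, this]
      exact Submodule.zero_mem _
    · rw [Submodule.span_le]
      intro f hf
      exact Submodule.subset_span ⟨f, hf, rfl⟩
  have hfin : Module.Finite ℤ R := by
    have h1 : (Submodule.span ℤ (P.mkQ '' S)).FG := Submodule.fg_span (hS.image _)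
    have h2 : IsNoetherian ℤ (Submodule.span ℤ (P.mkQ '' S)) := isNoetherian_of_fg_of_noetherian _ h1
    exact Module.Finite.iff_fg.2 (h1.of_le hRS)
  have hfree : Module.Free ℤ R := Module.free_of_finite_type_torsion_free'
  let b := Module.finBasis ℤ R
  choose q hq hqb using fun i => (b i).2
  have hsum : ∀ c : Fin (Module.finrank ℤ R) → ℤ, P.mkQ (∑ i, c i • q i) = (∑ i, c i • b i : R) := by
    intro c
    simp only [map_sum, map_smul, hqb, Submodule.coe_sum, Submodule.coe_smul]
  refine ⟨_, q, hq, fun f hf => ?_, fun c hc => ?_⟩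
  · refine ⟨b.repr ⟨P.mkQ f, f, hf, rfl⟩, ?_⟩
    rw [← Submodule.Quotient.mk_eq_zero, ← Submodule.mkQ_apply, map_sub, hsum, b.sum_repr, sub_self]
  · rw [← Submodule.Quotient.mk_eq_zero, ← Submodule.mkQ_apply, hsum] at hc
    have h1 : ∑ i, c i • b i = 0 := Subtype.ext hc
    exact funext (Fintype.linearIndependent_iff.1 b.linearIndependent c h1)

/-- A partial correspondence between the two quotients. -/
structure Good (N B B' : Submodule ℤ C) (D D' : ℕ → Submodule ℤ C) (G : Submodule ℤ (C × C)) :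
    Prop where
  prod_le : B.prod B' ≤ G
  diff : ∀ p ∈ G, p.1 - p.2 ∈ N
  iff : ∀ p ∈ G, (p.1 ∈ B ↔ p.2 ∈ B')
  pure₁ : ∀ (d : ℤ) f, d ≠ 0 → (∃ g, (d • f, g) ∈ G) → ∃ g, (f, g) ∈ G
  pure₂ : ∀ (d : ℤ) g, d ≠ 0 → (∃ f, (f, d • g) ∈ G) → ∃ f, (f, g) ∈ G
  bdd₁ : ∃ k, ∀ p ∈ G, p.1 ∈ D k
  bdd₂ : ∃ k, ∀ p ∈ G, p.2 ∈ D' k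

variable {e : C} {N B B' : Submodule ℤ C} {D D' : ℕ → Submodule ℤ C}

/-- The transposed relation. -/
def flip (G : Submodule ℤ (C × C)) : Submodule ℤ (C × C) :=
  G.comap (LinearEquiv.prodComm ℤ C C : C × C →ₗ[ℤ] C × C)

theorem Good.flip {G : Submodule ℤ (C × C)} (h : Good N B B' D D' G) :
    Good N B' B D' D (flip G) := by
  refine ⟨?_, ?_, ?_, h.pure₂, h.pure₁, ?_, ?_⟩
  · rintro ⟨f, g⟩ ⟨h1, h2⟩
    exact h.prod_le ⟨h2, h1⟩
  · rintro ⟨f, g⟩ hfg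
    have := N.neg_mem (h.diff (g, f) hfg)
    rwa [neg_sub] at this
  · rintro ⟨f, g⟩ hfg
    exact (h.iff (g, f) hfg).symm
  · obtain ⟨k, hk⟩ := h.bdd₂
    exact ⟨k, fun ⟨f, g⟩ hfg => hk (g, f) hfg⟩
  · obtain ⟨k, hk⟩ := h.bdd₁
    exact ⟨k, fun ⟨f, g⟩ hfg => hk (g, f) hfg⟩

theorem exists_good (A : Alg e N B D) (A' : Alg e N B' D') :
    ∃ G, Good N B B' D D' G ∧ (e, e) ∈ G := by
  let G : Submodule ℤ (C × C) := B.prod B' ⊔ Submodule.span ℤ {(e, e)}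
  have hG : ∀ p, p ∈ G ↔ ∃ c : ℤ, p.1 - c • e ∈ B ∧ p.2 - c • e ∈ B' := by
    intro p
    constructor
    · intro hp
      obtain ⟨y, hy, z, hz, rfl⟩ := Submodule.mem_sup.1 hp
      obtain ⟨c, rfl⟩ := Submodule.mem_span_singleton.1 hz
      exact ⟨c, by simpa using hy.1, by simpa using hy.2⟩
    · rintro ⟨c, h1, h2⟩
      exact Submodule.mem_sup.2 ⟨(p.1 - c • e, p.2 - c • e), ⟨h1, h2⟩, c • (e, e),
        Submodule.mem_span_singleton.2 ⟨c, rfl⟩, by ext <;> simp⟩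
  have key : ∀ {B : Submodule ℤ C} {D : ℕ → Submodule ℤ C} (A : Alg e N B D) f,
      (∃ c : ℤ, f - c • e ∈ B) ↔ f ∈ D 0 := by
    intro B D A f
    refine ⟨fun ⟨c, h⟩ => ?_, A.zero f⟩
    rw [← sub_add_cancel f (c • e)]
    exact (D 0).add_mem (A.B_le_D h) ((D 0).smul_mem _ A.e_mem)
  refine ⟨G, ⟨le_sup_left, ?_, ?_, ?_, ?_, ?_, ?_⟩,
    (hG _).2 ⟨1, by simp, by simp⟩⟩
  · intro p hp
    obtain ⟨c, h1, h2⟩ := (hG p).1 hp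
    have := N.sub_mem (A.B_le h1) (A'.B_le h2)
    rwa [sub_sub_sub_cancel_right] at this
  · intro p hp
    obtain ⟨c, h1, h2⟩ := (hG p).1 hp
    constructor
    · intro h
      have h0 : c = 0 := A.e_ne c (by simpa using B.sub_mem h h1)
      simpa [h0] using h2
    · intro h
      have h0 : c = 0 := A'.e_ne c (by simpa using B'.sub_mem h h2)
      simpa [h0] using h1
  · rintro d f hd ⟨g, hg⟩
    obtain ⟨c, h1, h2⟩ := (hG _).1 hg
    obtain ⟨c', h⟩ := A.zero f (A.pure 0 d f hd ((key A _).1 ⟨c, h1⟩))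
    exact ⟨c' • e, (hG _).2 ⟨c', h, by simp⟩⟩
  · rintro d f hd ⟨g, hg⟩
    obtain ⟨c, h1, h2⟩ := (hG _).1 hg
    obtain ⟨c', h⟩ := A'.zero f (A'.pure 0 d f hd ((key A' _).1 ⟨c, h2⟩))
    exact ⟨c' • e, (hG _).2 ⟨c', by simp, h⟩⟩
  · exact ⟨0, fun p hp => (key A _).1 (((hG p).1 hp).imp fun c h => h.1)⟩
  · exact ⟨0, fun p hp => (key A' _).1 (((hG p).1 hp).imp fun c h => h.2)⟩

theorem Good.exists_extend (A : Alg e N B D) (A' : Alg e N B' D')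
    (hDD : ∀ k, ∀ f ∈ D k, ∃ l, f ∈ D' l) {G : Submodule ℤ (C × C)} (h : Good N B B' D D' G)
    {f₀ : C} (hf₀ : ∃ k, f₀ ∈ D k) : ∃ G', Good N B B' D D' G' ∧ G ≤ G' ∧ ∃ g, (f₀, g) ∈ G' := by
  obtain ⟨k, hk, hfk⟩ : ∃ k, (∀ p ∈ G, p.1 ∈ D k) ∧ f₀ ∈ D k := by
    obtain ⟨k, hk⟩ := h.bdd₁
    obtain ⟨l, hl⟩ := hf₀
    exact ⟨max k l, fun p hp => A.mono (le_max_left k l) (hk p hp), A.mono (le_max_right k l) hl⟩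
  set P := G.map (LinearMap.fst ℤ C C) with hP
  have hPm : ∀ f, f ∈ P ↔ ∃ g, (f, g) ∈ G := by
    intro f
    simp [hP, Submodule.mem_map]
  obtain ⟨S, hS, hDS⟩ := A.fg k
  have hBP : B ≤ P := fun b hb => (hPm b).2 ⟨0, h.prod_le ⟨hb, B'.zero_mem⟩⟩
  obtain ⟨n, q, hq, hq1, hq2⟩ := exists_complement (P := P) (D := D k)
    (fun d f hd hf => (hPm f).2 (h.pure₁ d f hd ((hPm _).1 hf))) hS (hDS.trans (sup_le_sup_right hBP _))
  obtain ⟨k', hk', hqk'⟩ : ∃ k', (∀ p ∈ G, p.2 ∈ D' k') ∧ ∀ i, q i ∈ D' k' := by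
    obtain ⟨k', hk'⟩ := h.bdd₂
    choose l hl using fun i => hDD k (q i) (hq i)
    refine ⟨k' + ∑ i, l i, fun p hp => A'.mono (Nat.le_add_right _ _) (hk' p hp), fun i =>
      A'.mono ((Finset.single_le_sum (fun _ _ => Nat.zero_le _) (Finset.mem_univ i)).trans
        (Nat.le_add_left _ _)) (hl i)⟩
  obtain ⟨ι, hι, hab⟩ := A'.ab k' n
  choose hιN l hl using hι
  let Φ : (Fin n → ℤ) →ₗ[ℤ] C × C :=
    Fintype.linearCombination ℤ fun i => (q i, q i + ι i)
  have hΦ1 : ∀ c, (Φ c).1 = ∑ i, c i • q i := by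
    intro c; simp [Φ, Fintype.linearCombination_apply, Prod.fst_sum]
  have hΦ2 : ∀ c, (Φ c).2 = ∑ i, c i • q i + ∑ i, c i • ι i := by
    intro c; simp [Φ, Fintype.linearCombination_apply, Prod.snd_sum, Finset.sum_add_distrib]
  let G' := G ⊔ LinearMap.range Φ
  have hG' : ∀ p, p ∈ G' ↔ ∃ c, p - Φ c ∈ G := by
    intro p
    constructor
    · intro hp
      obtain ⟨y, hy, _, ⟨c, rfl⟩, rfl⟩ := Submodule.mem_sup.1 hp
      exact ⟨c, by simpa using hy⟩
    · rintro ⟨c, hc⟩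
      exact Submodule.mem_sup.2 ⟨_, hc, _, ⟨c, rfl⟩, sub_add_cancel _ _⟩
  have hfst : ∀ f, (∃ g, (f, g) ∈ G') ↔ f ∈ D k := by
    intro f
    constructor
    · rintro ⟨g, hg⟩
      obtain ⟨c, hc⟩ := (hG' _).1 hg
      have h1 := hk _ hc
      rw [Prod.fst_sub, hΦ1] at h1
      rw [← sub_add_cancel f (∑ i, c i • q i)]
      exact (D k).add_mem h1 (Submodule.sum_mem _ fun i _ => Submodule.smul_mem _ _ (hq i))
    · intro hf
      obtain ⟨c, hc⟩ := hq1 f hf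
      obtain ⟨g, hg⟩ := (hPm _).1 hc
      refine ⟨g + (Φ c).2, (hG' _).2 ⟨c, ?_⟩⟩
      convert! hg using 1
      ext
      · simp [hΦ1]
      · simp
  have hdvd : ∀ p c, p - Φ c ∈ G → ∀ (d : ℤ) g, p.2 - d • g ∈ B' → ∀ j, d ∣ c j := by
    intro p c hc d g hg
    refine hab ((p - Φ c).2 + ∑ i, c i • q i) ((D' k').add_mem (hk' _ hc)
      (Submodule.sum_mem _ fun i _ => Submodule.smul_mem _ _ (hqk' i))) c d g ?_
    convert! hg using 1
    rw [Prod.snd_sub, hΦ2]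
    abel
  refine ⟨G', ⟨h.prod_le.trans le_sup_left, ?_, ?_, ?_, ?_, ⟨k, fun p hp => (hfst _).1 ⟨p.2, hp⟩⟩, ?_⟩,
    le_sup_left, (hfst f₀).2 hfk⟩
  · intro p hp
    obtain ⟨c, hc⟩ := (hG' p).1 hp
    have h1 := N.sub_mem (h.diff _ hc) (Submodule.sum_mem N (t := Finset.univ)
      (f := fun i => c i • ι i) fun i _ => N.smul_mem _ (hιN i))
    convert! h1 using 1
    rw [Prod.snd_sub, Prod.fst_sub, hΦ2, hΦ1]
    abel
  · intro p hp
    obtain ⟨c, hc⟩ := (hG' p).1 hp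
    constructor
    · intro hpB
      have h0 : c = 0 := by
        refine hq2 c ?_
        rw [← hΦ1]
        have h1 : (p - Φ c).1 ∈ P := (hPm _).2 ⟨_, hc⟩
        have := P.sub_mem (hBP hpB) h1
        rwa [Prod.fst_sub, sub_sub_cancel] at this
      rw [h0, map_zero, sub_zero] at hc
      exact (h.iff p hc).1 hpB
    · intro hpB
      have h0 : c = 0 := funext fun j =>
        zero_dvd_iff.1 (hdvd p c hc 0 0 (by simpa using hpB) j)
      rw [h0, map_zero, sub_zero] at hc
      exact (h.iff p hc).2 hpB
  · intro d f hd hf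
    exact (hfst f).2 (A.pure k d f hd ((hfst _).1 hf))
  · rintro d g hd ⟨f, hf⟩
    obtain ⟨c, hc⟩ := (hG' _).1 hf
    have h1 := hdvd _ c hc d g (by simp)
    choose c' hc' using h1
    have hcc : Φ c = d • Φ c' := by
      rw [← map_smul]
      exact congrArg Φ (funext hc')
    obtain ⟨f', hf'⟩ := h.pure₂ d (g - (Φ c').2) hd ⟨(f, d • g).1 - (Φ c).1, by
      convert! hc using 1
      ext
      · simp
      · simp [hcc, smul_sub]⟩
    refine ⟨f' + (Φ c').1, (hG' _).2 ⟨c', ?_⟩⟩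
    convert! hf' using 1
    ext
    · simp
    · simp
  · refine ⟨k' + ∑ i, l i, fun p hp => ?_⟩
    obtain ⟨c, hc⟩ := (hG' p).1 hp
    have h1 : p.2 = (p - Φ c).2 + (∑ i, c i • q i + ∑ i, c i • ι i) := by
      rw [Prod.snd_sub, hΦ2, sub_add_cancel]
    rw [h1]
    refine Submodule.add_mem _ (A'.mono (Nat.le_add_right _ _) (hk' _ hc)) (Submodule.add_mem _
      (Submodule.sum_mem _ fun i _ => Submodule.smul_mem _ _ (A'.mono (Nat.le_add_right _ _) (hqk' i)))
      (Submodule.sum_mem _ fun i _ => Submodule.smul_mem _ _ (A'.mono ?_ (hl i))))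
    exact (Finset.single_le_sum (fun _ _ => Nat.zero_le _) (Finset.mem_univ i)).trans
        (Nat.le_add_left _ _)

theorem exists_total (A : Alg e N B D) (A' : Alg e N B' D')
    (hDD : ∀ k, ∀ f ∈ D k, ∃ l, f ∈ D' l) (hDD' : ∀ k, ∀ f ∈ D' k, ∃ l, f ∈ D l)
    (F : ℕ → C) (hF : ∀ n, ∃ k, F n ∈ D k) :
    ∃ G : Submodule ℤ (C × C), (e, e) ∈ G ∧ B.prod B' ≤ G ∧ (∀ p ∈ G, p.1 - p.2 ∈ N) ∧
      (∀ p ∈ G, (p.1 ∈ B ↔ p.2 ∈ B')) ∧ (∀ n, ∃ g, (F n, g) ∈ G) ∧ (∀ n, ∃ f, (f, F n) ∈ G) ∧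
      ∀ p ∈ G, (∃ k, p.1 ∈ D k) ∧ ∃ k, p.2 ∈ D' k := by
  have step : ∀ (n : ℕ) (G : {G // Good N B B' D D' G}), ∃ G' : {G // Good N B B' D D' G},
      G.1 ≤ G'.1 ∧ (∃ g, (F n, g) ∈ G'.1) ∧ ∃ f, (f, F n) ∈ G'.1 := by
    rintro n ⟨G, hG⟩
    obtain ⟨G₁, h₁, hle₁, hf₁⟩ := hG.exists_extend A A' hDD (hF n)
    obtain ⟨k, hk⟩ := hF n
    obtain ⟨G₂, h₂, hle₂, hf₂⟩ := h₁.flip.exists_extend A' A hDD' (hDD k _ hk)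
    refine ⟨⟨CantorOE.flip G₂, h₂.flip⟩, fun p hp => hle₂ (hle₁ hp), ?_, ?_⟩
    · obtain ⟨g, hg⟩ := hf₁
      exact ⟨g, hle₂ hg⟩
    · obtain ⟨f, hf⟩ := hf₂
      exact ⟨f, hf⟩
  choose Φ h1 h2 h3 using step
  obtain ⟨G₀, hG₀, he⟩ := exists_good A A'
  let G : ℕ → {G // Good N B B' D D' G} := fun n => Nat.rec ⟨G₀, hG₀⟩ (fun n G => Φ n G) n
  have hmono : Monotone fun n => (G n).1 := monotone_nat_of_le_succ fun n => h1 n (G n)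
  have hmem : ∀ p, p ∈ (⨆ n, (G n).1) ↔ ∃ n, p ∈ (G n).1 := fun p =>
    Submodule.mem_iSup_of_directed _ hmono.directed_le
  refine ⟨⨆ n, (G n).1, (hmem _).2 ⟨0, he⟩, fun p hp => (hmem _).2 ⟨0, hG₀.prod_le hp⟩, ?_, ?_,
    fun n => ?_, fun n => ?_, ?_⟩
  · intro p hp
    obtain ⟨n, hn⟩ := (hmem _).1 hp
    exact (G n).2.diff p hn
  · intro p hp
    obtain ⟨n, hn⟩ := (hmem _).1 hp
    exact (G n).2.iff p hn
  · obtain ⟨g, hg⟩ := h2 n (G n)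
    exact ⟨g, (hmem _).2 ⟨n + 1, hg⟩⟩
  · obtain ⟨g, hg⟩ := h3 n (G n)
    exact ⟨g, (hmem _).2 ⟨n + 1, hg⟩⟩
  · intro p hp
    obtain ⟨n, hn⟩ := (hmem _).1 hp
    exact ⟨(G n).2.bdd₁.imp fun k hk => hk p hn, (G n).2.bdd₂.imp fun k hk => hk p hn⟩

end Algebra

section BackForth

variable {X Y : Type} [TopologicalSpace X] [CompactSpace X] [T2Space X] [TotallyDisconnectedSpace X]
  [TopologicalSpace Y] [CompactSpace Y] [T2Space Y] [TotallyDisconnectedSpace Y]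

/-- A relation between clopen sets along which partitions can be refined. -/
structure Matching (Rel : Set X → Set Y → Prop) : Prop where
  clopen : ∀ A B, Rel A B → IsClopen A ∧ IsClopen B
  univ : Rel univ univ
  empty : Rel ∅ ∅
  iff : ∀ A B, Rel A B → (A = ∅ ↔ B = ∅)
  union : ∀ A B A' B', Rel A B → Rel A' B' → Disjoint A A' → Disjoint B B' → Rel (A ∪ A') (B ∪ B')
  forth : ∀ A B, Rel A B → ∀ U, IsClopen U →
    ∃ B₁ ⊆ B, Rel (A ∩ U) B₁ ∧ Rel (A \ (A ∩ U)) (B \ B₁)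
  back : ∀ A B, Rel A B → ∀ V, IsClopen V →
    ∃ A₁ ⊆ A, Rel A₁ (B ∩ V) ∧ Rel (A \ A₁) (B \ (B ∩ V))

/-- `c` codes a dyadic scheme of partitions. -/
structure Scheme (c : List Bool → Set X) : Prop where
  nil : c [] = Set.univ
  cons : ∀ b l, c (b :: l) ⊆ c l
  not : ∀ l, c (false :: l) = c l \ c (true :: l)

namespace Scheme

variable {c : List Bool → Set X} (h : Scheme c)
include h

theorem existsUnique (n : ℕ) (x : X) : ∃! l : List Bool, l.length = n ∧ x ∈ c l := by
  classical
  induction n with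
  | zero => exact ⟨[], ⟨rfl, h.nil ▸ mem_univ x⟩, fun l hl => List.length_eq_zero_iff.1 hl.1⟩
  | succ n ih =>
    obtain ⟨l, ⟨hl, hx⟩, hu⟩ := ih
    have key : ∀ b, x ∈ c (b :: l) ↔ b = decide (x ∈ c (true :: l)) := by
      rintro (_ | _)
      · rw [h.not]; simp [hx]
      · simp
    refine ⟨decide (x ∈ c (true :: l)) :: l, ⟨by simp [hl], (key _).2 rfl⟩, ?_⟩
    rintro (_ | ⟨b, m⟩) ⟨h1, h2⟩
    · simp at h1
    · obtain rfl := hu m ⟨by simpa using h1, h.cons _ _ h2⟩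
      rw [(key b).1 h2]

theorem eq {l m : List Bool} (hl : l.length = m.length) {x : X} (h1 : x ∈ c l) (h2 : x ∈ c m) : l = m :=
  (h.existsUnique _ x).unique ⟨hl, h1⟩ ⟨rfl, h2⟩

end Scheme

theorem exists_scheme_point {c : List Bool → Set X} {d : List Bool → Set Y} (hc : Scheme c)
    (hd : Scheme d) (hdc : ∀ l, IsClopen (d l)) (hne : ∀ l, c l = ∅ ↔ d l = ∅)
    (hsep : ∀ y y', (∀ l, y ∈ d l ↔ y' ∈ d l) → y = y') (x : X) : ∃! y, ∀ l, x ∈ c l ↔ y ∈ d l := by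
  set Z : ℕ → Set Y := fun n => {y | ∃ l : List Bool, l.length = n ∧ x ∈ c l ∧ y ∈ d l} with hZ
  have hZl : ∀ l, x ∈ c l → Z l.length = d l := by
    intro l hl
    ext y
    constructor
    · rintro ⟨m, hm, h1, h2⟩
      rwa [← hc.eq hm h1 hl]
    · exact fun h => ⟨l, rfl, hl, h⟩
  have hex : ∀ n, ∃ l : List Bool, l.length = n ∧ x ∈ c l := fun n => (hc.existsUnique n x).exists
  have hcl : ∀ n, IsClosed (Z n) := by
    intro n
    obtain ⟨l, rfl, hl⟩ := hex n
    exact hZl l hl ▸ (hdc l).isClosed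
  have hnonempty : ∀ n, (Z n).Nonempty := by
    intro n
    obtain ⟨l, rfl, hl⟩ := hex n
    rw [hZl l hl, nonempty_iff_ne_empty, Ne, ← hne]
    exact fun h => (h ▸ hl : x ∈ (∅ : Set X))
  obtain ⟨y, hy⟩ := IsCompact.nonempty_iInter_of_sequence_nonempty_isCompact_isClosed Z (fun n => by
    rintro y ⟨_ | ⟨b, m⟩, h1, h2, h3⟩
    · simp at h1
    · exact ⟨m, by simpa using h1, hc.cons _ _ h2, hd.cons _ _ h3⟩) hnonempty (hcl 0).isCompact hcl
  have hyd : ∀ l, x ∈ c l ↔ y ∈ d l := by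
    intro l
    obtain ⟨m, h1, h2, h3⟩ := mem_iInter.1 hy l.length
    exact ⟨fun h => hc.eq h1 h2 h ▸ h3, fun h => hd.eq h1 h3 h ▸ h2⟩
  exact ⟨y, hyd, fun y' hy' => hsep _ _ fun l => (hy' l).symm.trans (hyd l)⟩

theorem Matching.exists_homeo [SecondCountableTopology X] [SecondCountableTopology Y]
    {Rel : Set X → Set Y → Prop} (h : Matching Rel) :
    ∃ f : X ≃ₜ Y, ∀ A, IsClopen A → Rel A (f '' A) := by
  obtain ⟨U, hU⟩ := exists_enumClopen (X := X)
  obtain ⟨V, hV⟩ := exists_enumClopen (X := Y)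
  have step : ∀ (n : ℕ) (p : {p : Set X × Set Y // Rel p.1 p.2}), ∃ q : {p : Set X × Set Y // Rel p.1 p.2},
      q.1.1 ⊆ p.1.1 ∧ q.1.2 ⊆ p.1.2 ∧ Rel (p.1.1 \ q.1.1) (p.1.2 \ q.1.2) ∧
      (n % 2 = 0 → q.1.1 = p.1.1 ∩ U (n / 2)) ∧ (n % 2 = 1 → q.1.2 = p.1.2 ∩ V (n / 2)) := by
    rintro n ⟨⟨A, B⟩, hp⟩
    rcases Nat.mod_two_eq_zero_or_one n with hn | hn
    · obtain ⟨B₁, h1, h2, h3⟩ := h.forth A B hp _ (hU.1 (n / 2))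
      exact ⟨⟨(_, B₁), h2⟩, inter_subset_left, h1, h3, fun _ => rfl, fun h => by omega⟩
    · obtain ⟨A₁, h1, h2, h3⟩ := h.back A B hp _ (hV.1 (n / 2))
      exact ⟨⟨(A₁, _), h2⟩, h1, inter_subset_left, h3, fun h => by omega, fun _ => rfl⟩
  choose q hq1 hq2 hq3 hq4 hq5 using step
  let cell : List Bool → {p : Set X × Set Y // Rel p.1 p.2} := fun l =>
    List.rec ⟨(Set.univ, Set.univ), h.univ⟩ (fun b l p => if b then q l.length p else
      ⟨(p.1.1 \ (q l.length p).1.1, p.1.2 \ (q l.length p).1.2), hq3 l.length p⟩) l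
  have cell_true : ∀ l, cell (true :: l) = q l.length (cell l) := fun l => rfl
  have cell_false : ∀ l, (cell (false :: l)).1 = ((cell l).1.1 \ (cell (true :: l)).1.1,
    (cell l).1.2 \ (cell (true :: l)).1.2) := fun l => rfl
  set c : List Bool → Set X := fun l => (cell l).1.1 with hc
  set d : List Bool → Set Y := fun l => (cell l).1.2 with hd
  have hrel : ∀ l, Rel (c l) (d l) := fun l => (cell l).2
  have hcs : Scheme c := by
    refine ⟨rfl, ?_, fun l => by simp only [hc, cell_false]⟩
    rintro (_ | _) l
    · simp only [hc, cell_false]; exact sdiff_subset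
    · simp only [hc, cell_true]; exact hq1 _ _
  have hds : Scheme d := by
    refine ⟨rfl, ?_, fun l => by simp only [hd, cell_false]⟩
    rintro (_ | _) l
    · simp only [hd, cell_false]; exact sdiff_subset
    · simp only [hd, cell_true]; exact hq2 _ _
  have hcU : ∀ n (l : List Bool), l.length = 2 * n → c (true :: l) = c l ∩ U n := by
    intro n l hl
    simp only [hc, cell_true]
    rw [hq4 _ _ (by omega), hl, show 2 * n / 2 = n by omega]
  have hdV : ∀ n (l : List Bool), l.length = 2 * n + 1 → d (true :: l) = d l ∩ V n := by
    intro n l hl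
    simp only [hd, cell_true]
    rw [hq5 _ _ (by omega), hl, show (2 * n + 1) / 2 = n by omega]
  have sepc : ∀ x x', (∀ l, x ∈ c l ↔ x' ∈ c l) → x = x' := by
    intro x x' hx
    refine hU.ext fun n hn => ?_
    obtain ⟨l, hl, hxl⟩ := (hcs.existsUnique (2 * n) x).exists
    have := (hx (true :: l)).1 (hcU n l hl ▸ ⟨hxl, hn⟩)
    rw [hcU n l hl] at this
    exact this.2
  have sepd : ∀ x x', (∀ l, x ∈ d l ↔ x' ∈ d l) → x = x' := by
    intro x x' hx
    refine hV.ext fun n hn => ?_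
    obtain ⟨l, hl, hxl⟩ := (hds.existsUnique (2 * n + 1) x).exists
    have := (hx (true :: l)).1 (hdV n l hl ▸ ⟨hxl, hn⟩)
    rw [hdV n l hl] at this
    exact this.2
  have hcc : ∀ l, IsClopen (c l) := fun l => (h.clopen _ _ (hrel l)).1
  have hdc : ∀ l, IsClopen (d l) := fun l => (h.clopen _ _ (hrel l)).2
  have hne : ∀ l, c l = ∅ ↔ d l = ∅ := fun l => h.iff _ _ (hrel l)
  have hclosed : IsClosed {p : X × Y | ∀ l, p.1 ∈ c l ↔ p.2 ∈ d l} := by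
    have : {p : X × Y | ∀ l, p.1 ∈ c l ↔ p.2 ∈ d l} = ⋂ l, {p : X × Y | p.1 ∈ c l ↔ p.2 ∈ d l} := by
      ext; simp
    rw [this]
    refine isClosed_iInter fun l => ?_
    have h1 : IsLocallyConstant fun p : X × Y => (p.1 ∈ c l, p.2 ∈ d l) :=
      ((lc_mem (hcc l)).comp_continuous continuous_fst).prodMk
        ((lc_mem (hdc l)).comp_continuous continuous_snd)
    exact (isClopen_setOf_lc h1 fun p => p.1 ↔ p.2).isClosed
  choose f hf hf' using exists_scheme_point hcs hds hdc hne sepd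
  choose g hg hg' using exists_scheme_point hds hcs hcc (fun l => (hne l).symm) sepc
  have hR : ∀ x y, (∀ l, x ∈ c l ↔ y ∈ d l) ↔ f x = y := fun x y =>
    ⟨fun h => (hf' x y h).symm, fun h => h ▸ hf x⟩
  have hR' : ∀ y x, (∀ l, x ∈ c l ↔ y ∈ d l) ↔ g y = x := fun y x =>
    ⟨fun h => (hg' y x fun l => (h l).symm).symm, fun h => h ▸ fun l => (hg y l).symm⟩
  let F : X ≃ₜ Y := ⟨⟨f, g, fun x => (hR' _ _).1 (hf x), fun y => (hR _ _).1 fun l => (hg y l).symm⟩,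
    continuous_of_closed_rel f (fun x y => ∀ l, x ∈ c l ↔ y ∈ d l) hclosed hR,
    continuous_of_closed_rel g (fun y x => ∀ l, x ∈ c l ↔ y ∈ d l)
      (hclosed.preimage continuous_swap) hR'⟩
  refine ⟨F, fun A hA => ?_⟩
  obtain ⟨n, rfl⟩ := hU.2 A hA
  have himg : ∀ l, F '' c l = d l := by
    intro l
    ext y
    constructor
    · rintro ⟨x, hx, rfl⟩
      exact (hf x l).1 hx
    · intro hy
      exact ⟨g y, (hg y l).1 hy, F.apply_symm_apply y⟩
  have huni : ∀ s : Finset (List Bool), (∀ l ∈ s, l.length = 2 * n + 1) →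
      Rel (⋃ l ∈ s, c l) (⋃ l ∈ s, d l) := by
    classical
    intro s
    induction s using Finset.induction_on with
    | empty => intro _; simpa using h.empty
    | insert a s ha ih =>
      intro hs
      rw [Finset.set_biUnion_insert, Finset.set_biUnion_insert]
      refine h.union _ _ _ _ (hrel a) (ih fun l hl => hs l (Finset.mem_insert_of_mem hl)) ?_ ?_
      · rw [disjoint_left]
        intro x hx hx'
        obtain ⟨l, hl, hxl⟩ := mem_iUnion₂.1 hx'
        exact ha (hcs.eq (by rw [hs a (Finset.mem_insert_self _ _), hs l (Finset.mem_insert_of_mem hl)])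
          hx hxl ▸ hl)
      · rw [disjoint_left]
        intro x hx hx'
        obtain ⟨l, hl, hxl⟩ := mem_iUnion₂.1 hx'
        exact ha (hds.eq (by rw [hs a (Finset.mem_insert_self _ _), hs l (Finset.mem_insert_of_mem hl)])
          hx hxl ▸ hl)
  have hfin : {l : List Bool | l.length = 2 * n}.Finite := List.finite_length_eq Bool (2 * n)
  set s : Finset (List Bool) := hfin.toFinset.map ⟨List.cons true, List.cons_injective⟩ with hs
  have hUs : U n = ⋃ l ∈ s, c l := by
    ext x
    simp only [hs, Finset.mem_map, Finite.mem_toFinset, mem_iUnion, exists_prop,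
      Function.Embedding.coeFn_mk]
    constructor
    · intro hx
      obtain ⟨l, hl, hxl⟩ := (hcs.existsUnique (2 * n) x).exists
      exact ⟨_, ⟨l, hl, rfl⟩, hcU n l hl ▸ ⟨hxl, hx⟩⟩
    · rintro ⟨_, ⟨l, hl, rfl⟩, hx⟩
      rw [hcU n l hl] at hx
      exact hx.2
  rw [hUs, image_iUnion₂]
  simp only [himg]
  refine huni s fun l hl => ?_
  simp only [hs, Finset.mem_map, Finite.mem_toFinset, Function.Embedding.coeFn_mk] at hl
  obtain ⟨m, hm, rfl⟩ := hl
  rw [List.length_cons, hm]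

/-- Cantor spaces are homeomorphic. -/
theorem exists_homeo_cantor [SecondCountableTopology X] [SecondCountableTopology Y] [Nonempty X]
    [Nonempty Y] (hX : ∀ (x : X) (W : Set X), IsOpen W → x ∈ W → ∃ y ∈ W, y ≠ x)
    (hY : ∀ (x : Y) (W : Set Y), IsOpen W → x ∈ W → ∃ y ∈ W, y ≠ x) : Nonempty (X ≃ₜ Y) := by
  have split : ∀ {X Y : Type} [TopologicalSpace X] [TopologicalSpace Y] [T2Space Y] [CompactSpace Y]
      [TotallyDisconnectedSpace Y] (hY : ∀ (x : Y) (W : Set Y), IsOpen W → x ∈ W → ∃ y ∈ W, y ≠ x)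
      (A : Set X) (B : Set Y), IsClopen A → IsClopen B → (A = ∅ ↔ B = ∅) → ∀ U, IsClopen U →
      ∃ B₁ ⊆ B, IsClopen B₁ ∧ (A ∩ U = ∅ ↔ B₁ = ∅) ∧ (A \ (A ∩ U) = ∅ ↔ B \ B₁ = ∅) := by
    intro X Y _ _ _ _ _ hY A B hA hB hAB U hU
    by_cases h1 : A ∩ U = ∅
    · exact ⟨∅, empty_subset _, isClopen_empty, by simp [h1], by simpa [h1] using hAB⟩
    by_cases h2 : A \ (A ∩ U) = ∅
    · refine ⟨B, subset_rfl, hB, ?_, by simp [h2]⟩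
      rw [← hAB]
      refine ⟨fun h => absurd h h1, fun h => by simp [h]⟩
    have hBne : B.Nonempty := by
      rw [nonempty_iff_ne_empty, Ne, ← hAB]
      rintro rfl
      simp at h1
    obtain ⟨x, hx⟩ := hBne
    obtain ⟨y, hy, hyx⟩ := hY x B hB.isOpen hx
    obtain ⟨W, hW, hyW, hxW⟩ := exists_isClopen_of_totally_separated hyx
    refine ⟨B ∩ W, inter_subset_left, hB.inter hW, ?_, ?_⟩
    · exact ⟨fun h => absurd h h1, fun h => absurd h (Nonempty.ne_empty ⟨y, hy, hyW⟩)⟩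
    · exact ⟨fun h => absurd h h2, fun h => absurd h (Nonempty.ne_empty ⟨x, hx, fun h => hxW h.2⟩)⟩
  have : Matching fun (A : Set X) (B : Set Y) => IsClopen A ∧ IsClopen B ∧ (A = ∅ ↔ B = ∅) := by
    refine ⟨fun A B h => ⟨h.1, h.2.1⟩, ⟨isClopen_univ, isClopen_univ, by simp⟩,
      ⟨isClopen_empty, isClopen_empty, by simp⟩, fun A B h => h.2.2, ?_, ?_, ?_⟩
    · rintro A B A' B' ⟨h1, h2, h3⟩ ⟨h1', h2', h3'⟩ - -
      exact ⟨h1.union h1', h2.union h2', by rw [union_empty_iff, union_empty_iff, h3, h3']⟩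
    · rintro A B ⟨h1, h2, h3⟩ U hU
      obtain ⟨B₁, h4, h5, h6, h7⟩ := split hY A B h1 h2 h3 U hU
      exact ⟨B₁, h4, ⟨h1.inter hU, h5, h6⟩, h1.diff (h1.inter hU), h2.diff h5, h7⟩
    · rintro A B ⟨h1, h2, h3⟩ U hU
      obtain ⟨B₁, h4, h5, h6, h7⟩ := split hX B A h2 h1 h3.symm U hU
      exact ⟨B₁, h4, ⟨h5, h2.inter hU, h6.symm⟩, h1.diff h5, h2.diff (h2.inter hU), h7.symm⟩
  obtain ⟨f, -⟩ := this.exists_homeo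
  exact ⟨f⟩

end BackForth

section Extend

variable {X : Type} [TopologicalSpace X] [CompactSpace X] [T2Space X] [MeasurableSpace X]
  [BorelSpace X] [TotallyDisconnectedSpace X] [PerfectSpace X]

theorem ind_diff {A B : Set X} (h : B ⊆ A) : ind (A \ B) = ind A - ind B := by
  classical
  ext x
  simp only [ind_apply, Pi.sub_apply, Set.mem_sdiff]
  by_cases h1 : x ∈ A <;> by_cases h2 : x ∈ B <;> simp [h1, h2]
  exact absurd (h h2) h1

theorem ind_union {A B : Set X} (h : Disjoint A B) : ind (A ∪ B) = ind A + ind B := by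
  classical
  ext x
  have h0 : x ∈ A → x ∉ B := fun h1 h2 => disjoint_left.1 h h1 h2
  simp only [ind_apply, Pi.add_apply, mem_union]
  by_cases h1 : x ∈ A <;> by_cases h2 : x ∈ B <;> simp_all

/-- One half of the data used to build a homeomorphism realising the correspondence `G` and
extending the partial homeomorphism `i z ↦ i' z`. -/
structure Half (M : Set (Measure X)) (r' : ℕ → X → X) {Z : Type} [TopologicalSpace Z] (i i' : Z → X)
    (G : Submodule ℤ ((X → ℤ) × (X → ℤ))) : Prop where
  prob : ∀ μ ∈ M, IsProbabilityMeasure μ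
  pos : ∀ μ ∈ M, ∀ A : Set X, IsClopen A → A.Nonempty → 0 < mint μ (ind A)
  rs : RS r'
  tr_pos : ∀ f : X → ℤ, IsLocallyConstant f → (∀ μ ∈ M, 0 < mint μ f) → ∃ k, ∀ x, 0 < tr (r' k) f x
  cont : Continuous i
  cont' : Continuous i'
  inj' : Function.Injective i'
  injOn : ∀ k, InjOn (r' k) (range i')
  lc : ∀ p ∈ G, IsLocallyConstant p.1 ∧ IsLocallyConstant p.2
  mint_eq : ∀ p ∈ G, ∀ μ ∈ M, mint μ p.1 = mint μ p.2
  null : ∀ b : X → ℤ, IsLocallyConstant b → Null r' b → (0, b) ∈ G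
  one : (ind univ, ind univ) ∈ G
  total : ∀ A : Set X, IsClopen A → ∃ g, (ind A, g) ∈ G

theorem Half.exists_split {M : Set (Measure X)} {r' : ℕ → X → X} {Z : Type} [TopologicalSpace Z]
    [CompactSpace Z] {i i' : Z → X} {G : Submodule ℤ ((X → ℤ) × (X → ℤ))} (h : Half M r' i i' G)
    {A B : Set X} (hA : IsClopen A) (hB : IsClopen B) (hAB : (ind A, ind B) ∈ G)
    (hZ : ∀ z, i z ∈ A ↔ i' z ∈ B) {U : Set X} (hU : IsClopen U) :
    ∃ B₁ ⊆ B, IsClopen B₁ ∧ (ind (A ∩ U), ind B₁) ∈ G ∧ ∀ z, i z ∈ A ∩ U ↔ i' z ∈ B₁ := by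
  have hAU := hA.inter hU
  rcases (A ∩ U).eq_empty_or_nonempty with h1 | h1
  · refine ⟨∅, empty_subset _, isClopen_empty, ?_, fun z => by simp [h1]⟩
    rw [h1]
    convert! G.zero_mem using 1
    ext x <;> simp [ind]
  rcases (A \ (A ∩ U)).eq_empty_or_nonempty with h2 | h2
  · have h3 : A ∩ U = A := inter_subset_left.antisymm (sdiff_eq_empty.1 h2)
    exact ⟨B, subset_rfl, hB, by rwa [h3], fun z => by rw [h3, hZ]⟩
  obtain ⟨g, hg⟩ := h.total _ hAU
  have hgl : IsLocallyConstant g := (h.lc _ hg).2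
  have hsub := G.sub_mem hAB hg
  rw [Prod.mk_sub_mk, ← ind_diff inter_subset_left] at hsub
  obtain ⟨k₁, hk₁⟩ := h.tr_pos g hgl fun μ hμ => by
    rw [← h.mint_eq _ hg μ hμ]; exact h.pos μ hμ _ hAU h1
  obtain ⟨k₂, hk₂⟩ := h.tr_pos (ind B - g) ((h.lc _ hsub).2) fun μ hμ => by
    rw [← h.mint_eq _ hsub μ hμ]; exact h.pos μ hμ _ (hA.diff hAU) h2
  set k := max k₁ k₂ with hk
  have hr := h.rs.fr k
  have t1 := tr_dom_pos (h.rs.fr _) hr (h.rs.mono (le_max_left k₁ k₂)) hk₁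
  have t2 := tr_dom_pos (h.rs.fr _) hr (h.rs.mono (le_max_right k₁ k₂)) hk₂
  set K₁ := i' '' (i ⁻¹' (A ∩ U)) with hK₁
  set K₂ := i' '' (i ⁻¹' (A \ (A ∩ U))) with hK₂
  have c1 : IsClosed K₁ := ((hAU.isClosed.preimage h.cont).isCompact.image h.cont').isClosed
  have c2 : IsClosed K₂ := (((hA.diff hAU).isClosed.preimage h.cont).isCompact.image h.cont').isClosed
  have hd : Disjoint K₁ K₂ := by
    rw [disjoint_left]
    rintro _ ⟨z, hz, rfl⟩ ⟨w, hw, hwz⟩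
    rw [h.inj' hwz] at hw
    exact hw.2 hz
  have s1 : K₁ ⊆ B := by
    rintro _ ⟨z, hz, rfl⟩
    exact (hZ z).1 hz.1
  have s2 : K₂ ⊆ B := by
    rintro _ ⟨z, hz, rfl⟩
    exact (hZ z).1 hz.1
  obtain ⟨N₁, n1, n2, n3, n4⟩ := hr.exists_injOn_nhd c1 ((h.injOn k).mono (image_subset_range _ _))
    (hB.isOpen.inter c2.isOpen_compl) (subset_inter s1 (disjoint_left.1 hd))
  obtain ⟨N₂, m1, m2, m3, m4⟩ := hr.exists_injOn_nhd c2 ((h.injOn k).mono (image_subset_range _ _))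
    (hB.isOpen.inter n1.compl.isOpen) (subset_inter s2 fun x hx hx' => (n3 hx').2 hx)
  obtain ⟨C, e1, e2, e3, e4, e5⟩ := hr.exists_alloc hB n1 m1 (n3.trans inter_subset_left)
    (m3.trans inter_subset_left) (disjoint_left.2 fun x hx hx' => (m3 hx').2 hx) n4 m4
    (hr.lc_tr hgl) (fun x y hxy => tr_congr_ret g hxy) (fun x => t1 x) (fun x => by
      have := t2 x
      rw [tr_sub hr] at this
      omega)
  refine ⟨C, e3, e1, ?_, ?_⟩
  · have := G.add_mem hg (h.null (ind C - g) ?_ ⟨k, fun x => by rw [tr_sub hr, e5, sub_self]⟩)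
    · simpa using this
    · exact (lcSub X).sub_mem (lc_ind e1) hgl
  · intro z
    constructor
    · exact fun hz => e2 (n2 ⟨z, hz, rfl⟩)
    · intro hz
      by_contra hn
      exact disjoint_left.1 e4 hz (m2 ⟨z, ⟨(hZ z).2 (e3 hz), hn⟩, rfl⟩)

theorem exists_realizing_homeo [SecondCountableTopology X] {M : Set (Measure X)} (hM : M.Nonempty)
    {r r' : ℕ → X → X} {Z : Type} [TopologicalSpace Z]
    [CompactSpace Z] {i i' : Z → X} {G : Submodule ℤ ((X → ℤ) × (X → ℤ))} (h : Half M r' i i' G)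
    (h' : Half M r i' i (G.comap (LinearEquiv.prodComm ℤ (X → ℤ) (X → ℤ)).toLinearMap)) :
    ∃ f : X ≃ₜ X, (∀ z, f (i z) = i' z) ∧ ∀ A, IsClopen A → (ind A, ind (f '' A)) ∈ G := by
  obtain ⟨μ, hμ⟩ := hM
  have hind : ∀ A : Set X, IsClopen A → (A = ∅ ↔ mint μ (ind A) = 0) := by
    intro A hA
    constructor
    · rintro rfl
      simp [mint, ind]
    · intro h0
      by_contra hne
      exact (h.pos μ hμ A hA (nonempty_iff_ne_empty.2 hne)).ne' h0
  have key : Matching fun A B : Set X => IsClopen A ∧ IsClopen B ∧ (ind A, ind B) ∈ G ∧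
      ∀ z, i z ∈ A ↔ i' z ∈ B := by
    refine ⟨fun A B h => ⟨h.1, h.2.1⟩, ⟨isClopen_univ, isClopen_univ, h.one, by simp⟩,
      ⟨isClopen_empty, isClopen_empty, ?_, by simp⟩, ?_, ?_, ?_, ?_⟩
    · convert! G.zero_mem using 1
      ext x <;> simp [ind]
    · rintro A B ⟨h1, h2, h3, h4⟩
      rw [hind A h1, hind B h2, h.mint_eq _ h3 μ hμ]
    · rintro A B A' B' ⟨h1, h2, h3, h4⟩ ⟨h1', h2', h3', h4'⟩ hd hd'
      refine ⟨h1.union h1', h2.union h2', ?_, fun z => by rw [mem_union, mem_union, h4, h4']⟩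
      rw [ind_union hd, ind_union hd']
      exact G.add_mem h3 h3'
    · rintro A B ⟨h1, h2, h3, h4⟩ U hU
      obtain ⟨B₁, a1, a2, a3, a4⟩ := h.exists_split h1 h2 h3 h4 hU
      refine ⟨B₁, a1, ⟨h1.inter hU, a2, a3, a4⟩, h1.diff (h1.inter hU), h2.diff a2, ?_, fun z => by
        rw [Set.mem_sdiff, Set.mem_sdiff, h4, a4]⟩
      rw [ind_diff inter_subset_left, ind_diff a1]
      exact G.sub_mem h3 a3
    · rintro A B ⟨h1, h2, h3, h4⟩ U hU
      obtain ⟨A₁, a1, a2, a3, a4⟩ := h'.exists_split h2 h1 h3 (fun z => (h4 z).symm) hU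
      have a3' : (ind A₁, ind (B ∩ U)) ∈ G := a3
      refine ⟨A₁, a1, ⟨a2, h2.inter hU, a3', fun z => (a4 z).symm⟩, h1.diff a2,
        h2.diff (h2.inter hU), ?_, fun z => by rw [Set.mem_sdiff, Set.mem_sdiff, h4, a4]⟩
      rw [ind_diff inter_subset_left, ind_diff a1]
      exact G.sub_mem h3 a3'
  obtain ⟨f, hf⟩ := key.exists_homeo
  refine ⟨f, fun z => ?_, fun A hA => (hf A hA).2.2.1⟩
  by_contra hne
  obtain ⟨W, hW, h1, h2⟩ := exists_isClopen_of_totally_separated hne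
  refine h2 ?_
  have := (hf _ (hW.preimage f.continuous)).2.2.2 z
  rw [f.image_preimage] at this
  exact this.1 h1

end Extend

section Conj

variable {X : Type} [TopologicalSpace X] [CompactSpace X] [T2Space X]

theorem RS.conj {r : ℕ → X → X} (hr : RS r) (e : X ≃ₜ X) : RS fun k x => e (r k (e.symm x)) :=
  ⟨fun k => (hr.fr k).conj e, fun k x y h => congrArg e (hr.step k _ _ (e.injective h))⟩

theorem tr_conj (r : X → X) (e : X ≃ₜ X) (f : X → ℤ) (x : X) :
    tr (fun x => e (r (e.symm x))) f x = tr r (fun y => f (e y)) (e.symm x) := by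
  refine finsum_mem_eq_of_bijOn e.symm ⟨?_, e.symm.injective.injOn, ?_⟩ fun y _ => by simp
  · intro y hy
    exact e.injective hy
  · intro y hy
    refine ⟨e y, ?_, by simp⟩
    simp only [mem_ofPred_eq, e.symm_apply_apply] at hy ⊢
    rw [hy]

theorem null_conj {r : ℕ → X → X} (e : X ≃ₜ X) (f : X → ℤ) :
    Null (fun k x => e (r k (e.symm x))) f ↔ Null r fun y => f (e y) := by
  refine exists_congr fun k => ⟨fun h x => ?_, fun h x => ?_⟩
  · have := h (e x)
    rwa [tr_conj, e.symm_apply_apply] at this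
  · rw [tr_conj, h]

theorem comp_mem_of_ind {G : Submodule ℤ ((X → ℤ) × (X → ℤ))} {f : X ≃ₜ X}
    (h : ∀ A, IsClopen A → (ind A, ind (f '' A)) ∈ G) {g : X → ℤ} (hg : IsLocallyConstant g) :
    (g, fun x => g (f.symm x)) ∈ G := by
  classical
  have hfin := hg.range_finite
  have key : (g, fun x => g (f.symm x)) =
      ∑ v ∈ hfin.toFinset, v • (ind (g ⁻¹' {v}), ind (f '' (g ⁻¹' {v}))) := by
    ext x
    · rw [Prod.fst_sum, Finset.sum_apply, Finset.sum_eq_single (g x)]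
      · simp [ind_apply]
      · intro v _ hv
        simp [ind_apply, hv.symm]
      · simp
    · rw [Prod.snd_sum, Finset.sum_apply, Finset.sum_eq_single (g (f.symm x))]
      · have : x ∈ f '' (g ⁻¹' {g (f.symm x)}) := ⟨f.symm x, rfl, f.apply_symm_apply x⟩
        simp only [Prod.smul_mk, Pi.smul_apply, ind_apply, if_pos this, smul_eq_mul, mul_one]
      · intro v _ hv
        have : x ∉ f '' (g ⁻¹' {v}) := by
          rintro ⟨y, hy, rfl⟩
          exact hv (by simpa using hy.symm)
        simp only [Prod.smul_mk, Pi.smul_apply, ind_apply, if_neg this, smul_zero]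
      · simp
  rw [key]
  exact G.sum_mem fun v _ => G.smul_mem v (h _ (hg.isClopen_fiber v))

end Conj

section Main

variable {X : Type} [TopologicalSpace X] [CompactSpace X] [TopologicalSpace.MetrizableSpace X]
  [MeasurableSpace X] [BorelSpace X] [TotallyDisconnectedSpace X] [PerfectSpace X]

theorem mint_ind {μ : Measure X} {A : Set X} (hA : IsClopen A) : mint μ (ind A) = μ.real A := by
  rw [mint, ← integral_indicator_one hA.isOpen.measurableSet]
  congr 1
  ext x
  classical
  simp only [ind, Set.indicator_apply, Pi.one_apply]
  split_ifs <;> simp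

theorem mint_ind_pos {T : X ≃ₜ X} (hT : Minimal' T) {μ : Measure X} (hμ : μ ∈ Inv T) {A : Set X}
    (hA : IsClopen A) (hne : A.Nonempty) : 0 < mint μ (ind A) := by
  have := hμ.1
  rw [mint_ind hA, measureReal_def, ENNReal.toReal_pos_iff]
  refine ⟨pos_iff_ne_zero.2 fun h0 => ?_, measure_lt_top μ A⟩
  have key : ∀ n : ℕ, μ (it T n ⁻¹' A) = 0 := by
    intro n
    induction n with
    | zero =>
      rwa [show it T ((0 : ℕ) : ℤ) ⁻¹' A = A by ext x; simp [it_zero]]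
    | succ n ih =>
      rw [← hμ.2, Measure.map_apply T.continuous.measurable
        ((hA.preimage (it_cont n)).isOpen.measurableSet)] at ih
      rwa [show it T ((n + 1 : ℕ) : ℤ) ⁻¹' A = T ⁻¹' (it T n ⁻¹' A) by
        ext x
        rw [mem_preimage, mem_preimage, mem_preimage, Nat.cast_add, it_add, Nat.cast_one, it_one]]
  have huniv : (univ : Set X) ⊆ ⋃ n : ℕ, it T n ⁻¹' A := by
    intro x _
    obtain ⟨n, hn⟩ := (hT.recur hA hne).fwd x
    exact mem_iUnion.2 ⟨n, hn.2⟩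
  have h1 := measure_mono_null huniv (measure_iUnion_null key)
  rw [measure_univ] at h1
  exact one_ne_zero h1

theorem Sys.injective_elim {T : X ≃ₜ X} {V : ℕ → Set X} {E : ℕ → Set X} {I : ℕ → X → ℕ}
    {U : ℕ → ℕ → Set X} (s : Sys T V E I U) {Y : Type} {φ : Y → X} (hφ : Function.Injective φ)
    (hE : ∀ y, φ y ∈ core E) : Function.Injective (Sum.elim φ fun y => T.symm (φ y)) := by
  refine hφ.sumElim (T.symm.injective.comp hφ) fun a b h => ?_
  refine s.core_it (hE a) one_ne_zero ?_
  rw [it_one, h]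
  simpa using hE b

theorem Sys.range_elim {T : X ≃ₜ X} {E : ℕ → Set X} {Y : Type} {φ : Y → X} (hE : ∀ y, φ y ∈ core E) :
    range (Sum.elim φ fun y => T.symm (φ y)) ⊆ core E ∪ T ⁻¹' core E := by
  rintro _ ⟨z | z, rfl⟩
  · exact Or.inl (hE z)
  · exact Or.inr (by simpa using hE z)

theorem exists_homeo_core {T S : X ≃ₜ X} [Nonempty X] {V : ℕ → Set X} (hV : EnumClopen V)
    {E : ℕ → Set X} {I : ℕ → X → ℕ} {U : ℕ → ℕ → Set X} (s : Sys T V E I U)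
    {E' : ℕ → Set X} {I' : ℕ → X → ℕ} {U' : ℕ → ℕ → Set X} (s' : Sys S V E' I' U') :
    Nonempty (core E ≃ₜ core E') := by
  have h1 := isCompact_iff_compactSpace.1 s.isClosed_core.isCompact
  have h2 := isCompact_iff_compactSpace.1 s'.isClosed_core.isCompact
  have h3 := s.core_nonempty.to_subtype
  have h4 := s'.core_nonempty.to_subtype
  have perf : ∀ {T : X ≃ₜ X} {E : ℕ → Set X} {I : ℕ → X → ℕ} {U : ℕ → ℕ → Set X} (s : Sys T V E I U)
      (x : core E) (W : Set (core E)), IsOpen W → x ∈ W → ∃ y ∈ W, y ≠ x := by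
    rintro T E I U s ⟨x, hx⟩ _ ⟨W, hW, rfl⟩ hxW
    obtain ⟨y, hy, hyW, hne⟩ := s.core_perfect hV hx hW hxW
    exact ⟨⟨y, hy⟩, hyW, fun h => hne (congrArg Subtype.val h)⟩
  exact exists_homeo_cantor (perf s) (perf s')

theorem exists_orbit_homeo [Nonempty X] {T S : X ≃ₜ X} (hT : Minimal' T) (hS : Minimal' S)
    (hTS : Inv T = Inv S) : ∃ H : X ≃ₜ X, (∀ x, ∃ j : ℤ, H (T x) = it S j (H x)) ∧
      ∀ x, ∃ j : ℤ, H.symm (S x) = it T j (H.symm x) := by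
  obtain ⟨V, hV⟩ := exists_enumClopen (X := X)
  obtain ⟨E, I, U, s⟩ := exists_sys hT hV
  obtain ⟨E', I', U', s'⟩ := exists_sys hS hV
  have A := s.alg hV (N := nullInt (Inv T)) (fun A hA => cob_mem_nullInt hA) (nullSub_le s)
  have A' := s'.alg hV (N := nullInt (Inv T)) (fun A hA => by rw [hTS]; exact cob_mem_nullInt hA)
    (by rw [hTS]; exact nullSub_le s')
  obtain ⟨G, g1, g2, g3, g4, g5, g6, g7⟩ := exists_total A A' (fun k f hf => s'.exists_mem_cellSub hV hf.1)
    (fun k f hf => s.exists_mem_cellSub hV hf.1) (fun n => ind (V n))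
    (fun n => s.exists_mem_cellSub hV (lc_ind (hV.1 n)))
  obtain ⟨ψ⟩ := exists_homeo_core hV s s'
  have hcomp := isCompact_iff_compactSpace.1 s.isClosed_core.isCompact
  have hM : (Inv T).Nonempty := by
    by_contra hne
    rw [not_nonempty_iff_eq_empty] at hne
    obtain ⟨k, hk⟩ := s.exists_tr_pos (f := -1) (IsLocallyConstant.const (-1)) (by simp [hne])
    have x : X := Classical.arbitrary X
    have h1 := hk x
    have h2 := tr_one_pos (s.rs.fr k) x
    rw [show (-1 : X → ℤ) = (-1 : ℤ) • (1 : X → ℤ) by simp, tr_zsmul (s.rs.fr k)] at h1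
    omega
  have glc : ∀ p ∈ G, IsLocallyConstant p.1 ∧ IsLocallyConstant p.2 := fun p hp => by
    obtain ⟨⟨k, hk⟩, l, hl⟩ := g7 p hp
    exact ⟨hk.1, hl.1⟩
  have gint : ∀ p ∈ G, ∀ μ ∈ Inv T, mint μ p.1 = mint μ p.2 := fun p hp μ hμ => by
    have := hμ.1
    have h := (g3 p hp).2 μ hμ hμ.1
    rwa [mint_sub (glc p hp).1 (glc p hp).2, sub_eq_zero] at h
  have ind_univ : ind (univ : Set X) = 1 := by ext x; simp [ind]
  set φ' : core E → X := fun c => (ψ c).1 with hφ'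
  have hφ : Function.Injective φ' := Subtype.val_injective.comp ψ.injective
  have mem_φ : ∀ c, φ' c ∈ core E' := fun c => (ψ c).2
  have cφ : Continuous φ' := continuous_subtype_val.comp ψ.continuous
  set i : core E ⊕ core E → X := Sum.elim Subtype.val fun c => T.symm c with hi
  set i' : core E ⊕ core E → X := Sum.elim φ' fun c => S.symm (φ' c) with hi'
  have ci : Continuous i :=
    continuous_subtype_val.sumElim (T.symm.continuous.comp continuous_subtype_val)
  have ci' : Continuous i' := cφ.sumElim (S.symm.continuous.comp cφ)
  have inj : Function.Injective i := s.injective_elim Subtype.val_injective fun c => c.2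
  have inj' : Function.Injective i' := s'.injective_elim hφ mem_φ
  have injOn : ∀ k, InjOn (base T (E k)) (range i) := fun k =>
    (s.injOn k).mono (Sys.range_elim fun c => c.2)
  have injOn' : ∀ k, InjOn (base S (E' k)) (range i') := fun k =>
    (s'.injOn k).mono (Sys.range_elim mem_φ)
  have h1 : Half (Inv T) (fun k => base S (E' k)) i i' G := by
    refine ⟨fun μ hμ => hμ.1, fun μ hμ A hA hne => mint_ind_pos hT hμ hA hne, s'.rs, fun f hf hp => ?_,
      ci, ci', inj', injOn', glc, gint, fun b hb hn => g2 ?_, by rwa [ind_univ], fun A hA => ?_⟩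
    · rw [hTS] at hp
      exact s'.exists_tr_pos hf hp
    · exact Submodule.mem_prod.2 ⟨Submodule.zero_mem _, hb, hn⟩
    · obtain ⟨n, rfl⟩ := hV.2 A hA
      exact g5 n
  have h2 : Half (Inv T) (fun k => base T (E k)) i' i
      (G.comap (LinearEquiv.prodComm ℤ (X → ℤ) (X → ℤ)).toLinearMap) := by
    refine ⟨fun μ hμ => hμ.1, fun μ hμ A hA hne => mint_ind_pos hT hμ hA hne, s.rs,
      fun f hf hp => s.exists_tr_pos hf hp, ci', ci, inj, injOn, fun p hp => (glc _ hp).symm,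
      fun p hp μ hμ => (gint _ hp μ hμ).symm, fun b hb hn => ?_, ?_, fun A hA => ?_⟩
    · exact g2 (Submodule.mem_prod.2 ⟨⟨hb, hn⟩, Submodule.zero_mem _⟩)
    · rw [ind_univ]
      exact g1
    · obtain ⟨n, rfl⟩ := hV.2 A hA
      exact g6 n
  obtain ⟨f, hfi, hf⟩ := exists_realizing_homeo hM h1 h2
  obtain ⟨h, hK, hh⟩ := exists_homeo_of_null_eq s.rs (s'.rs.conj f.symm) (fun g hg => by
    rw [null_conj]
    have := g4 _ (comp_mem_of_ind hf hg)
    exact ⟨fun hn => (this.1 ⟨hg, hn⟩).2, fun hn => (this.2 ⟨lc_comp hg f.symm.continuous, hn⟩).2⟩)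
    (isCompact_range ci).isClosed injOn (fun k => by
      rintro _ ⟨z, rfl⟩ _ ⟨w, rfl⟩ hzw
      have h3 := f.symm.injective hzw
      simp only [Homeomorph.symm_symm, hfi] at h3
      rw [inj' (injOn' k ⟨z, rfl⟩ ⟨w, rfl⟩ h3)])
  set H : X ≃ₜ X := h.trans f with hH
  have hHi : ∀ z, H (i z) = i' z := fun z => by
    rw [hH, Homeomorph.trans_apply, hK _ ⟨z, rfl⟩, hfi]
  have hrel : ∀ x y, (∃ k, base T (E k) x = base T (E k) y) ↔
      ∃ k, base S (E' k) (H x) = base S (E' k) (H y) := by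
    intro x y
    rw [hh]
    simp only [Homeomorph.symm_symm, EmbeddingLike.apply_eq_iff_eq]
    rfl
  refine ⟨H, fun x => ?_, fun y => ?_⟩
  · by_cases hx : T x ∈ core E
    · refine ⟨1, ?_⟩
      have e1 : i (Sum.inl ⟨T x, hx⟩) = T x := rfl
      have e2 : i (Sum.inr ⟨T x, hx⟩) = x := T.symm_apply_apply x
      have e3 := hHi (Sum.inr ⟨T x, hx⟩)
      rw [e2] at e3
      rw [it_one, ← e1, hHi, e3]
      exact (S.apply_symm_apply _).symm
    · obtain ⟨k, hk⟩ := s.related hx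
      obtain ⟨l, hl⟩ := (hrel _ _).1 ⟨k, hk⟩
      exact s'.base_orbit l hl.symm
  · by_cases hy : S y ∈ core E'
    · refine ⟨1, ?_⟩
      set c := ψ.symm ⟨S y, hy⟩ with hc
      have e0 : φ' c = S y := by simp [hφ', hc]
      have e1 : H c.1 = S y := (hHi (Sum.inl c)).trans e0
      have e2 : H (T.symm c.1) = y := (hHi (Sum.inr c)).trans (by
        simp only [hi', Sum.elim_inr, e0, Homeomorph.symm_apply_apply])
      have e3 : H.symm (S y) = c.1 := by rw [← e1, H.symm_apply_apply]
      have e4 : H.symm y = T.symm c.1 := by rw [← e2, H.symm_apply_apply]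
      rw [e3, e4, it_one, T.apply_symm_apply]
    · obtain ⟨k, hk⟩ := s'.related hy
      rw [← H.apply_symm_apply (S y), ← H.apply_symm_apply y] at hk
      simp only [H.apply_symm_apply (S y), H.apply_symm_apply y] at hk
      obtain ⟨l, hl⟩ := (hrel (H.symm (S y)) (H.symm y)).2
        ⟨k, by rwa [H.apply_symm_apply, H.apply_symm_apply]⟩
      exact s.base_orbit l hl.symm

end Main

section Reduction

variable {X Y : Type} [TopologicalSpace X] [TopologicalSpace Y] {T : X ≃ₜ X} {S : Y ≃ₜ Y}

theorem it_eq_toEquiv_zpow (n : ℤ) (x : X) : it T n x = (T.toEquiv ^ n) x := by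
  induction n generalizing x with
  | zero => simp [it_zero]
  | succ n ih => rw [it_add, ih, it_one, zpow_add_one]; rfl
  | pred n ih =>
    rw [zpow_sub_one, Equiv.Perm.mul_apply, ← ih, sub_eq_add_neg, it_add]
    congr 1

theorem orbit_eq (T : X ≃ₜ X) (x : X) : T.orbit x = range fun n : ℤ => it T n x := by
  simp only [Homeomorph.orbit, it_eq_toEquiv_zpow]

theorem exists_it_of_step {h : X ≃ₜ Y} (hs : ∀ x, ∃ j : ℤ, h (T x) = it S j (h x)) (n : ℤ) (x : X) :
    ∃ j : ℤ, h (it T n x) = it S j (h x) := by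
  induction n generalizing x with
  | zero => exact ⟨0, by rw [it_zero, it_zero]⟩
  | succ n ih =>
    obtain ⟨j, hj⟩ := ih (T x)
    obtain ⟨l, hl⟩ := hs x
    exact ⟨j + l, by rw [it_add, it_one, hj, hl, it_add]⟩
  | pred n ih =>
    obtain ⟨j, hj⟩ := ih (it T (-1) x)
    obtain ⟨l, hl⟩ := hs (it T (-1) x)
    rw [← it_one (T := T), it_it_neg] at hl
    refine ⟨j - l, ?_⟩
    rw [sub_eq_add_neg, it_add, hj, hl, sub_eq_add_neg, it_add, it_neg_it]

theorem orbitEquivalent_of_step {h : X ≃ₜ Y} (h1 : ∀ x, ∃ j : ℤ, h (T x) = it S j (h x))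
    (h2 : ∀ y, ∃ j : ℤ, h.symm (S y) = it T j (h.symm y)) : OrbitEquivalent T S := by
  refine ⟨h, fun x => ?_⟩
  rw [orbit_eq, orbit_eq]
  ext y
  constructor
  · rintro ⟨_, ⟨n, rfl⟩, rfl⟩
    obtain ⟨j, hj⟩ := exists_it_of_step h1 n x
    exact ⟨j, hj.symm⟩
  · rintro ⟨n, rfl⟩
    obtain ⟨j, hj⟩ := exists_it_of_step h2 n (h x)
    rw [h.symm_apply_apply] at hj
    exact ⟨_, ⟨j, rfl⟩, by simp only [← hj, h.apply_symm_apply]⟩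

variable [MeasurableSpace X] [BorelSpace X] [MeasurableSpace Y] [BorelSpace Y]

theorem map_it {μ : Measure X} (hμ : μ.map T = μ) (n : ℤ) : μ.map (it T n) = μ := by
  have key : ∀ n : ℤ, μ.map (it T (n + 1)) = μ.map (it T n) := by
    intro n
    conv_rhs => rw [← hμ]
    rw [Measure.map_map (it_cont n).measurable T.continuous.measurable]
    congr 1
    ext x
    rw [it_add, it_one, Function.comp_apply]
  induction n with
  | zero =>
    convert! Measure.map_id using 2
  | succ n ih => rw [key, ih]
  | pred n ih => rw [← key, sub_add_cancel, ih]

theorem map_eq_of_orbit [T2Space X] {μ : Measure X} (hμ : μ.map T = μ) {φ : X ≃ₜ X}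
    (hφ : ∀ x, ∃ n : ℤ, φ x = it T n x) : μ.map φ = μ := by
  obtain ⟨e, he⟩ := exists_surjective_nat ℤ
  set A : ℕ → Set X := fun k => {x | φ x = it T (e k) x} with hA
  set D := disjointed A with hD
  have hAm : ∀ k, MeasurableSet (A k) := fun k =>
    (isClosed_eq φ.continuous (it_cont (e k))).measurableSet
  have hDm : ∀ k, MeasurableSet (D k) := fun k => MeasurableSet.disjointed hAm k
  have hDd : Pairwise (Function.onFun Disjoint D) := disjoint_disjointed A
  have hDu : ⋃ k, D k = univ := by
    rw [hD, iUnion_disjointed, eq_univ_iff_forall]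
    intro x
    obtain ⟨n, hn⟩ := hφ x
    obtain ⟨k, rfl⟩ := he n
    exact mem_iUnion.2 ⟨k, hn⟩
  have himg : ∀ (ψ : X ≃ₜ X) C, MeasurableSet C → MeasurableSet (ψ '' C) := fun ψ C hC =>
    ψ.toMeasurableEquiv.measurableSet_image.2 hC
  ext B hB
  rw [Measure.map_apply φ.continuous.measurable hB]
  set C := φ ⁻¹' B with hC
  have hCm : MeasurableSet C := φ.continuous.measurable hB
  have e1 : C = ⋃ k, C ∩ D k := by rw [← inter_iUnion, hDu, inter_univ]
  have e2 : B = ⋃ k, φ '' (C ∩ D k) := by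
    rw [← image_iUnion, ← e1, hC, φ.image_preimage]
  have hd : Pairwise (Function.onFun Disjoint fun k => C ∩ D k) := fun k l hkl =>
    (hDd hkl).mono inter_subset_right inter_subset_right
  rw [e2, measure_iUnion (fun k l hkl => (disjoint_image_iff φ.injective).2 (hd hkl))
    fun k => himg _ _ (hCm.inter (hDm k))]
  conv_lhs => rw [e1]
  rw [measure_iUnion hd fun k => hCm.inter (hDm k)]
  congr 1
  ext k
  have e3 : φ '' (C ∩ D k) = it T (e k) '' (C ∩ D k) :=
    image_congr fun x hx => disjointed_subset A k hx.2
  rw [e3]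
  conv_rhs => rw [← map_it hμ (e k)]
  rw [Measure.map_apply (it_cont _).measurable (himg _ _ (hCm.inter (hDm k))),
    (it T (e k)).injective.preimage_image]

theorem map_map_homeo {Z : Type} [TopologicalSpace Z] [MeasurableSpace Z] [BorelSpace Z] (f : X ≃ₜ Y)
    (g : Y ≃ₜ Z) (μ : Measure X) : (μ.map f).map g = μ.map (fun x => g (f x)) :=
  Measure.map_map g.continuous.measurable f.continuous.measurable

theorem map_symm_map (f : X ≃ₜ Y) (μ : Measure X) : (μ.map f).map f.symm = μ := by
  rw [map_map_homeo]
  simp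

theorem map_mem_inv_of_orbit [T2Space X] {h : X ≃ₜ Y} (hh : ∀ x, ∃ n : ℤ, S (h x) = h (it T n x))
    {μ : Measure X} (hμ : μ ∈ Inv T) : μ.map h ∈ Inv S := by
  have := hμ.1
  refine ⟨Measure.isProbabilityMeasure_map h.continuous.measurable.aemeasurable, ?_⟩
  have h1 := map_eq_of_orbit hμ.2 (φ := (h.trans S).trans h.symm) fun x => by
    obtain ⟨n, hn⟩ := hh x
    exact ⟨n, by simp [hn]⟩
  conv_rhs => rw [← h1]
  rw [map_map_homeo, map_map_homeo]
  simp

theorem bijOn_of_orbitEquivalent [T2Space X] [T2Space Y] {h : X ≃ₜ Y}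
    (hh : ∀ x, h '' T.orbit x = S.orbit (h x)) :
    BijOn (fun μ : Measure X => μ.map h) (Inv T) (Inv S) := by
  have h1 : ∀ x, ∃ n : ℤ, S (h x) = h (it T n x) := by
    intro x
    have : S (h x) ∈ S.orbit (h x) := by
      rw [orbit_eq]
      exact ⟨1, it_one _⟩
    rw [← hh, orbit_eq] at this
    obtain ⟨_, ⟨n, rfl⟩, hn⟩ := this
    exact ⟨n, hn.symm⟩
  have h2 : ∀ y, ∃ n : ℤ, T (h.symm y) = h.symm (it S n y) := by
    intro y
    have : T (h.symm y) ∈ T.orbit (h.symm y) := by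
      rw [orbit_eq]
      exact ⟨1, it_one _⟩
    have := mem_image_of_mem h this
    rw [hh, orbit_eq, h.apply_symm_apply] at this
    obtain ⟨n, hn⟩ := this
    exact ⟨n, by simp only [hn, h.symm_apply_apply]⟩
  refine ⟨fun μ hμ => map_mem_inv_of_orbit h1 hμ, fun μ _ ν _ hμν => ?_, fun ν hν =>
    ⟨ν.map h.symm, map_mem_inv_of_orbit h2 hν, map_symm_map h.symm ν⟩⟩
  rw [← map_symm_map h μ, ← map_symm_map h ν]
  exact congrArg (fun μ : Measure Y => μ.map h.symm) hμν

theorem it_conj (F : X ≃ₜ Y) (n : ℤ) (x : X) :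
    it ((F.trans S).trans F.symm) n x = F.symm (it S n (F x)) := by
  induction n generalizing x with
  | zero => simp [it_zero]
  | succ n ih => rw [it_add, ih, it_one, it_add, it_one]; simp
  | pred n ih =>
    have key : it ((F.trans S).trans F.symm) (-1) x = F.symm (it S (-1) (F x)) := by
      have h1 := it_it_neg (T := (F.trans S).trans F.symm) 1 x
      refine ((F.trans S).trans F.symm).injective ?_
      rw [it_one] at h1
      rw [h1, Homeomorph.trans_apply,
        Homeomorph.trans_apply, F.apply_symm_apply, ← it_one (T := S) (it S (-1) _),
        it_it_neg, F.symm_apply_apply]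
    rw [sub_eq_add_neg, it_add, ih, key, F.apply_symm_apply, it_add]

theorem inv_conj {F : X ≃ₜ Y} (hF : BijOn (fun μ : Measure X => μ.map F) (Inv T) (Inv S)) :
    Inv T = Inv ((F.trans S).trans F.symm) := by
  have key : ∀ μ : Measure X, (μ.map F ∈ Inv S ↔ μ ∈ Inv ((F.trans S).trans F.symm)) := by
    intro μ
    have e1 : μ.map ((F.trans S).trans F.symm) = ((μ.map F).map S).map F.symm := by
      rw [map_map_homeo F S]
      exact (Measure.map_map F.symm.continuous.measurable
        (S.continuous.comp F.continuous).measurable).symm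
    constructor
    · rintro ⟨h1, h2⟩
      refine ⟨?_, by rw [e1, h2, map_symm_map]⟩
      have := Measure.isProbabilityMeasure_map (μ := μ.map F) F.symm.continuous.measurable.aemeasurable
      rwa [map_symm_map] at this
    · rintro ⟨h1, h2⟩
      refine ⟨Measure.isProbabilityMeasure_map F.continuous.measurable.aemeasurable, ?_⟩
      rw [e1] at h2
      have := map_symm_map F.symm ((μ.map F).map S)
      rw [h2] at this
      exact this.symm
  ext μ
  rw [← key]
  refine ⟨fun h => hF.mapsTo h, fun h => ?_⟩
  obtain ⟨ν, hν, hνμ⟩ := hF.surjOn h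
  have := congrArg (fun μ : Measure Y => μ.map F.symm) hνμ
  simp only [map_symm_map] at this
  exact this ▸ hν

end Reduction

end CantorOE

/-- **Giordano–Putnam–Skau.** Two minimal Cantor systems are orbit equivalent iff there
is a homeomorphism carrying the invariant probability measures of one system bijectively
onto those of the other. -/
theorem orbitEquivalent_iff_exists_measure_carrying_homeomorph
    (X Y : Type)
    [TopologicalSpace X] [CompactSpace X] [TopologicalSpace.MetrizableSpace X]
    [TotallyDisconnectedSpace X] [PerfectSpace X] [Nonempty X]
    [MeasurableSpace X] [BorelSpace X]
    [TopologicalSpace Y] [CompactSpace Y] [TopologicalSpace.MetrizableSpace Y]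
    [TotallyDisconnectedSpace Y] [PerfectSpace Y] [Nonempty Y]
    [MeasurableSpace Y] [BorelSpace Y]
    (T : X ≃ₜ X) (S : Y ≃ₜ Y)
    (hTmin : ∀ x : X, Dense (T.orbit x))
    (hSmin : ∀ y : Y, Dense (S.orbit y)) :
    OrbitEquivalent T S ↔
      ∃ F : X ≃ₜ Y,
        Set.BijOn (fun μ : Measure X => μ.map (F : X → Y))
          { μ : Measure X | IsProbabilityMeasure μ ∧ μ.map (T : X → X) = μ }
          { ν : Measure Y | IsProbabilityMeasure ν ∧ ν.map (S : Y → Y) = ν } := by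
  constructor
  · rintro ⟨h, hh⟩
    exact ⟨h, CantorOE.bijOn_of_orbitEquivalent hh⟩
  · rintro ⟨F, hF⟩
    have hT : CantorOE.Minimal' T := fun x => CantorOE.orbit_eq T x ▸ hTmin x
    have hS : CantorOE.Minimal' ((F.trans S).trans F.symm) := by
      intro x
      have h1 := F.symm.surjective.denseRange.dense_image F.symm.continuous (hSmin (F x))
      convert! h1 using 1
      rw [CantorOE.orbit_eq, ← Set.range_comp]
      congr 1
      ext n
      exact CantorOE.it_conj F n x
    obtain ⟨H, h1, h2⟩ := CantorOE.exists_orbit_homeo hT hS (CantorOE.inv_conj hF)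
    refine CantorOE.orbitEquivalent_of_step (h := H.trans F) (fun x => ?_) fun y => ?_
    · obtain ⟨j, hj⟩ := h1 x
      exact ⟨j, by simp [hj, CantorOE.it_conj]⟩
    · obtain ⟨j, hj⟩ := h2 (F.symm y)
      exact ⟨j, by simpa using hj⟩
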